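/- arXiv:2105.04858 — 16 statements merged into one kernel-verified Lean document; each statement's English description precedes it below -/
import Mathlib

section
/- Let R be an associative unital ring, let n ≥ 2 and let y₁,…,y_{2n} ∈ R. Then the even Euler continuant satisfies (y₁,y₂,…,y_{2n}) = (y₁,…,y_{2n−2})·(1 + y_{2n−1}y_{2n}) + Σ_{m=2}^{n−1} (y₁,…,y_{2m−2})·y_{2m−1}·y_{2n} + y₁·y_{2n}, where the sum is empty when n = 2. -/
/-- The Euler continuant `(y 1, …, y k)`, defined by the recursion
`( ) = 1`, `(x₁) = x₁`, `(x₁,…,x_k) = (x₁,…,x_{k−1})·x_k + (x₁,…,x_{k−2})`. -/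
def cont {R : Type*} [Ring R] (y : ℕ → R) : ℕ → R
  | 0 => 1
  | 1 => y 1
  | k + 2 => cont y (k + 1) * y (k + 2) + cont y k

theorem cont_odd_aux {R : Type*} [Ring R] (y : ℕ → R) (k : ℕ) :
    cont y (2 * k + 1) =
      (∑ m ∈ Finset.Icc 2 (k + 1), cont y (2 * m - 2) * y (2 * m - 1)) + y 1 := by
  induction k with
  | zero => simp [cont]
  | succ k ih =>
    rw [Finset.sum_Icc_succ_top (by omega)]
    have h : cont y (2 * (k + 1) + 1) =
      cont y (2 * k + 2) * y (2 * k + 3) + cont y (2 * k + 1) := rfl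
    have e1 : 2 * (k + 1 + 1) - 2 = 2 * k + 2 := by omega
    have e2 : 2 * (k + 1 + 1) - 1 = 2 * k + 3 := by omega
    rw [h, ih, e1, e2]
    abel

/-- The even Euler continuant satisfies
`(y₁,…,y_{2n}) = (y₁,…,y_{2n−2})·(1 + y_{2n−1}y_{2n})
  + Σ_{m=2}^{n−1} (y₁,…,y_{2m−2})·y_{2m−1}·y_{2n} + y₁·y_{2n}`. -/
theorem even_continuant_expansion {R : Type*} [Ring R] (n : ℕ) (hn : 2 ≤ n) (y : ℕ → R) :
    cont y (2 * n) =
      cont y (2 * n - 2) * (1 + y (2 * n - 1) * y (2 * n)) +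
        (∑ m ∈ Finset.Icc 2 (n - 1), cont y (2 * m - 2) * y (2 * m - 1) * y (2 * n)) +
        y 1 * y (2 * n) := by
  obtain ⟨k, rfl⟩ : ∃ k, n = k + 2 := ⟨n - 2, by omega⟩
  have h : cont y (2 * (k + 2)) = (cont y (2 * k + 2) * y (2 * k + 3) + cont y (2 * k + 1))
      * y (2 * (k + 2)) + cont y (2 * k + 2) := rfl
  have e1 : 2 * (k + 2) - 2 = 2 * k + 2 := by omega
  have e2 : 2 * (k + 2) - 1 = 2 * k + 3 := by omega
  have e3 : k + 2 - 1 = k + 1 := by omega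
  rw [h, e1, e2, e3, cont_odd_aux, ← Finset.sum_mul]
  noncomm_ring
end

section
/- Let R be an associative unital ring, let n ≥ 1 and let y₁,…,y_{2n} ∈ R. Then the Euler continuants satisfy the identity (y₁,y₂,…,y_{2n−1}) · (y_{2n},y_{2n−1},…,y₂,y₁) = (y₁,y₂,…,y_{2n}) · (y_{2n−1},y_{2n−2},…,y₂,y₁), where (y_i,y_{i−1},…,y₁) denotes the Euler continuant of the sequence listed in decreasing order of indices. -/
theorem cont_left {R : Type*} [Ring R] (x : ℕ → R) (k : ℕ) :
    cont x (k + 2) = x 1 * cont (fun i => x (i + 1)) (k + 1) + cont (fun i => x (i + 2)) k := by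
  induction k using Nat.twoStepInduction with
  | zero => simp [cont]
  | one => simp [cont, mul_add, add_mul, mul_assoc]; abel
  | more k h1 h2 =>
    have a1 : cont x (k + 2 + 2) = cont x (k + 1 + 2) * x (k + 4) + cont x (k + 2) := by rw [cont]
    have a2 : cont (fun i => x (i + 1)) (k + 2 + 1) =
        cont (fun i => x (i + 1)) (k + 1 + 1) * x (k + 4) + cont (fun i => x (i + 1)) (k + 1) := by
      rw [cont]
    have a3 : cont (fun i => x (i + 2)) (k + 2) =
        cont (fun i => x (i + 2)) (k + 1) * x (k + 4) + cont (fun i => x (i + 2)) k := by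
      rw [cont]
    rw [a1, a2, a3, h1, h2]
    simp only [add_mul, mul_add, mul_assoc]
    abel

theorem cont_aux {R : Type*} [Ring R] (y : ℕ → R) (k : ℕ) :
    cont y k * cont (fun i => y (k + 1 + 1 - i)) (k + 1) =
      cont y (k + 1) * cont (fun i => y (k + 1 - i)) k := by
  induction k with
  | zero => simp [cont]
  | succ k ih =>
    have h := cont_left (fun i => y (k + 1 + 1 + 1 - i)) k
    have e1 : (fun i => y (k + 1 + 1 + 1 - (i + 1))) = fun i => y (k + 1 + 1 - i) := by
      funext i; congr 1; omega
    have e2 : (fun i => y (k + 1 + 1 + 1 - (i + 2))) = fun i => y (k + 1 - i) := by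
      funext i; congr 1; omega
    rw [e1, e2] at h
    have e3 : k + 1 + 1 + 1 - 1 = k + 2 := by omega
    simp only [e3] at h
    rw [show k + 1 + 1 = k + 2 from rfl] at *
    rw [h, cont.eq_3 y, mul_add, ← ih, add_mul, mul_assoc]

/-- The "curious identity" for Euler continuants:
`(y₁,…,y_{2n−1}) · (y_{2n},…,y₁) = (y₁,…,y_{2n}) · (y_{2n−1},…,y₁)`,
where decreasing-index continuants are read in the order listed. -/
theorem continuant_curious_identity {R : Type*} [Ring R] (n : ℕ) (hn : 1 ≤ n) (y : ℕ → R) :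
    cont y (2 * n - 1) * cont (fun i => y (2 * n + 1 - i)) (2 * n) =
      cont y (2 * n) * cont (fun i => y (2 * n - i)) (2 * n - 1) := by
  have h := cont_aux y (2 * n - 1)
  rwa [show 2 * n - 1 + 1 = 2 * n by omega] at h
end

section
/- Let K be a field, n ≥ 1, and A₁,…,Aₙ,B₁,…,Bₙ ∈ K. Set x₁ = A₁, x₂ = B₁, x₃ = A₂, x₄ = B₂, …, x_{2n−1} = Aₙ, x_{2n} = Bₙ, and consider the four Euler continuants p := (x_{2n−1},x_{2n−2},…,x₂) (equal to 1 when n = 1), q := (x_{2n−1},x_{2n−2},…,x₁), r := (x_{2n},x_{2n−1},…,x₂), and s := (x_{2n},x_{2n−1},…,x₁), where sequences are read in decreasing order of indices. If s ≠ 0, then (p − q·s^{−1}·r)·(x₁,x₂,…,x_{2n}) = 1; in particular the Euler continuant (A₁,B₁,…,Aₙ,Bₙ) = (x₁,…,x_{2n}) is nonzero and p − q·s^{−1}·r equals its inverse. -/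
theorem cont_front {K : Type*} [Field K] (y : ℕ → K) (k : ℕ) :
    cont y (k + 2) = y 1 * cont (fun m => y (m + 1)) (k + 1) + cont (fun m => y (m + 2)) k := by
  induction k using Nat.strong_induction_on with
  | _ k ih =>
    match k with
    | 0 => simp [cont]
    | 1 => simp [cont]; ring
    | k + 2 =>
      have h1 := ih (k + 1) (by omega)
      have h0 := ih k (by omega)
      rw [cont, h1, h0, cont.eq_3 (fun m => y (m + 1)) (k + 1), cont.eq_3 (fun m => y (m + 2)) k]
      ring

theorem cont_det {K : Type*} [Field K] (y : ℕ → K) (k : ℕ) :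
    cont y (k + 2) * cont (fun m => y (m + 1)) k
      - cont (fun m => y (m + 1)) (k + 1) * cont y (k + 1) = (-1) ^ k := by
  induction k with
  | zero => simp [cont]; ring
  | succ k ih =>
    rw [cont.eq_3 y (k + 1), cont.eq_3 (fun m => y (m + 1)) k, pow_succ, ← ih]
    ring

theorem cont_rev {K : Type*} [Field K] (x : ℕ → K) (N : ℕ) :
    cont (fun m => x (N + 1 - m)) N = cont x N := by
  induction N using Nat.strong_induction_on with
  | _ N ih =>
    match N with
    | 0 => simp [cont]
    | 1 => simp [cont]
    | k + 2 =>
      have h1 := ih (k + 1) (by omega)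
      have h0 := ih k (by omega)
      have e1 : (fun m => x (k + 2 + 1 - (m + 1))) = fun m => x (k + 1 + 1 - m) := by
        funext m; congr 1; omega
      have e0 : (fun m => x (k + 2 + 1 - (m + 2))) = fun m => x (k + 1 - m) := by
        funext m; congr 1; omega
      rw [cont_front, e1, e0, h1, h0, cont]
      simp only [Nat.add_sub_cancel]
      ring

/-- With `x₁ = A₁, x₂ = B₁, …, x_{2n−1} = Aₙ, x_{2n} = Bₙ` and the continuants
`p = (x_{2n−1},…,x₂)`, `q = (x_{2n−1},…,x₁)`, `r = (x_{2n},…,x₂)`, `s = (x_{2n},…,x₁)`,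
if `s ≠ 0` then `(p − q·s⁻¹·r)·(x₁,…,x_{2n}) = 1`; in particular `(x₁,…,x_{2n}) ≠ 0`
and `p − q·s⁻¹·r` is its inverse. -/
theorem schur_complement_eq_continuant_inv {K : Type*} [Field K]
    (n : ℕ) (hn : 1 ≤ n) (A B x : ℕ → K)
    (hxA : ∀ i, 1 ≤ i → i ≤ n → x (2 * i - 1) = A i)
    (hxB : ∀ i, 1 ≤ i → i ≤ n → x (2 * i) = B i)
    (hs : cont (fun m => x (2 * n + 1 - m)) (2 * n) ≠ 0) :
    (cont (fun m => x (2 * n - m)) (2 * n - 2) -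
        cont (fun m => x (2 * n - m)) (2 * n - 1) *
          (cont (fun m => x (2 * n + 1 - m)) (2 * n))⁻¹ *
          cont (fun m => x (2 * n + 1 - m)) (2 * n - 1)) * cont x (2 * n) = 1 ∧
    cont x (2 * n) ≠ 0 ∧
    cont (fun m => x (2 * n - m)) (2 * n - 2) -
        cont (fun m => x (2 * n - m)) (2 * n - 1) *
          (cont (fun m => x (2 * n + 1 - m)) (2 * n))⁻¹ *
          cont (fun m => x (2 * n + 1 - m)) (2 * n - 1) = (cont x (2 * n))⁻¹ := by
  obtain ⟨k, rfl⟩ : ∃ k, n = k + 1 := ⟨n - 1, by omega⟩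
  have hd := cont_det (fun m => x (2 * (k + 1) + 1 - m)) (2 * k)
  have e1 : (fun m => x (2 * (k + 1) + 1 - (m + 1))) = fun m => x (2 * (k + 1) - m) := by
    funext m; congr 1; omega
  rw [e1, pow_mul, neg_one_sq, one_pow] at hd
  have a2 : 2 * (k + 1) - 2 = 2 * k := by omega
  have a1 : 2 * (k + 1) - 1 = 2 * k + 1 := by omega
  have a0 : 2 * k + 2 = 2 * (k + 1) := by omega
  rw [a0] at hd
  have hr := cont_rev x (2 * (k + 1))
  rw [a1, a2, ← hr]
  have key : ∀ p q r s : K, s ≠ 0 → s * p - q * r = 1 → (p - q * s⁻¹ * r) * s = 1 := by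
    intro p q r s h0 h
    rw [← h]
    field_simp
  have hk := key _ _ _ _ hs hd
  exact ⟨hk, hs, eq_inv_of_mul_eq_one_left hk⟩
end

section
/- With the data of the double bracket on the generators a₁,…,aₙ, b₁,…,bₙ described in the context, the following identities hold: (i) ⟨⟨(aₙ,bₙ), a_i⟩⟩ = (1/2)·((aₙ,bₙ)⊗a_i − e₂⊗(aₙ,bₙ)a_i) for 1 ≤ i ≤ n−1, and ⟨⟨(aₙ,bₙ), aₙ⟩⟩ = −(1/2)·((aₙ,bₙ)⊗aₙ + e₂⊗(aₙ,bₙ)aₙ); (ii) ⟨⟨(aₙ,bₙ), b_i⟩⟩ = (1/2)·(b_i⊗(aₙ,bₙ) − b_i(aₙ,bₙ)⊗e₂) for 1 ≤ i ≤ n−2, ⟨⟨(aₙ,bₙ), b_{n−1}⟩⟩ = (1/2)·(b_{n−1}⊗(aₙ,bₙ) − b_{n−1}(aₙ,bₙ)⊗e₂) − bₙ⊗e₂, and ⟨⟨(aₙ,bₙ), bₙ⟩⟩ = (1/2)·(bₙ⊗(aₙ,bₙ) + bₙ(aₙ,bₙ)⊗e₂). -/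
open TensorProduct

noncomputable section

/-- Lemma 3.2 of the paper: values of the double quasi-Poisson bracket on the second Euler
continuant `(aₙ,bₙ) = e₂ + aₙbₙ` against the generators. -/
theorem bracket_second_continuant {k : Type*} [Field k] [CharZero k]
    {A : Type*} [Ring A] [Algebra k A]
    (n : ℕ) (hn : 1 ≤ n)
    (e₁ e₂ : A) (a b : ℕ → A)
    (br : A →ₗ[k] A →ₗ[k] A ⊗[k] A)
    (he₁ : e₁ * e₁ = e₁) (he₂ : e₂ * e₂ = e₂)
    (h12 : e₁ * e₂ = 0) (h21 : e₂ * e₁ = 0) (hsum : e₁ + e₂ = 1)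
    (ha : ∀ i, 1 ≤ i → i ≤ n → a i = e₂ * a i * e₁)
    (hb : ∀ i, 1 ≤ i → i ≤ n → b i = e₁ * b i * e₂)
    (hskew : ∀ x y : A, br x y = - TensorProduct.comm k A A (br y x))
    (hleib : ∀ x y z : A, br x (y * z) = br x y * (1 ⊗ₜ[k] z) + (y ⊗ₜ[k] 1) * br x z)
    (hbr₁ : ∀ x : A, br x e₁ = 0) (hbr₂ : ∀ x : A, br x e₂ = 0)
    (haa_lt : ∀ i j, 1 ≤ i → i ≤ n → 1 ≤ j → j ≤ n → i < j →
      br (a i) (a j) = -((2 : k)⁻¹ • (a i ⊗ₜ[k] a j + a j ⊗ₜ[k] a i)))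
    (haa_eq : ∀ i, 1 ≤ i → i ≤ n → br (a i) (a i) = 0)
    (haa_gt : ∀ i j, 1 ≤ i → i ≤ n → 1 ≤ j → j ≤ n → j < i →
      br (a i) (a j) = (2 : k)⁻¹ • (a i ⊗ₜ[k] a j + a j ⊗ₜ[k] a i))
    (hbb_lt : ∀ i j, 1 ≤ i → i ≤ n → 1 ≤ j → j ≤ n → i < j →
      br (b i) (b j) = -((2 : k)⁻¹ • (b i ⊗ₜ[k] b j + b j ⊗ₜ[k] b i)))
    (hbb_eq : ∀ i, 1 ≤ i → i ≤ n → br (b i) (b i) = 0)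
    (hbb_gt : ∀ i j, 1 ≤ i → i ≤ n → 1 ≤ j → j ≤ n → j < i →
      br (b i) (b j) = (2 : k)⁻¹ • (b i ⊗ₜ[k] b j + b j ⊗ₜ[k] b i))
    (hab_lt : ∀ i j, 1 ≤ i → i ≤ n → 1 ≤ j → j ≤ n → i < j →
      br (a i) (b j) = (2 : k)⁻¹ • (e₁ ⊗ₜ[k] (a i * b j) + (b j * a i) ⊗ₜ[k] e₂))
    (hab_eq : ∀ i, 1 ≤ i → i ≤ n →
      br (a i) (b i) =
        (2 : k)⁻¹ • ((b i * a i) ⊗ₜ[k] e₂ + e₁ ⊗ₜ[k] (a i * b i)) + e₁ ⊗ₜ[k] e₂)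
    (hab_gt : ∀ i j, 1 ≤ i → i ≤ n → 1 ≤ j → j ≤ n → j < i →
      br (a i) (b j) = -((2 : k)⁻¹ • ((b j * a i) ⊗ₜ[k] e₂ + e₁ ⊗ₜ[k] (a i * b j)))
        - (if i = j + 1 then e₁ ⊗ₜ[k] e₂ else 0)) :
    (∀ i, 1 ≤ i → i ≤ n - 1 →
        br (e₂ + a n * b n) (a i) =
          (2 : k)⁻¹ • ((e₂ + a n * b n) ⊗ₜ[k] a i - e₂ ⊗ₜ[k] ((e₂ + a n * b n) * a i))) ∧
    (br (e₂ + a n * b n) (a n) =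
        -((2 : k)⁻¹ • ((e₂ + a n * b n) ⊗ₜ[k] a n + e₂ ⊗ₜ[k] ((e₂ + a n * b n) * a n)))) ∧
    (∀ i, 1 ≤ i → i ≤ n - 2 →
        br (e₂ + a n * b n) (b i) =
          (2 : k)⁻¹ • (b i ⊗ₜ[k] (e₂ + a n * b n) - (b i * (e₂ + a n * b n)) ⊗ₜ[k] e₂)) ∧
    (2 ≤ n →
        br (e₂ + a n * b n) (b (n - 1)) =
          (2 : k)⁻¹ • (b (n - 1) ⊗ₜ[k] (e₂ + a n * b n) -
              (b (n - 1) * (e₂ + a n * b n)) ⊗ₜ[k] e₂) - b n ⊗ₜ[k] e₂) ∧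
    (br (e₂ + a n * b n) (b n) =
        (2 : k)⁻¹ • (b n ⊗ₜ[k] (e₂ + a n * b n) + (b n * (e₂ + a n * b n)) ⊗ₜ[k] e₂)) := by
  have L : ∀ x y z : A, br (y * z) x =
      br y x * (z ⊗ₜ[k] 1) + ((1 : A) ⊗ₜ[k] y) * br z x := by
    have c1 : ∀ (t : A ⊗[k] A) (z : A), TensorProduct.comm k A A (t * (1 ⊗ₜ[k] z)) =
        TensorProduct.comm k A A t * (z ⊗ₜ[k] 1) := by
      intro t z
      induction t with
      | zero => simp
      | tmul u v => simp
      | add u v hu hv => rw [add_mul, map_add, hu, hv, map_add, add_mul]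
    have c2 : ∀ (t : A ⊗[k] A) (y : A), TensorProduct.comm k A A ((y ⊗ₜ[k] 1) * t) =
        ((1 : A) ⊗ₜ[k] y) * TensorProduct.comm k A A t := by
      intro t z
      induction t with
      | zero => simp
      | tmul u v => simp
      | add u v hu hv => rw [mul_add, map_add, hu, hv, map_add, mul_add]
    intro x y z
    rw [hskew (y * z) x, hleib, map_add, c1, c2, hskew y x, hskew z x, neg_mul, mul_neg, neg_add]
  have hE : ∀ x, br e₂ x = 0 := by
    intro x; rw [hskew, hbr₂]; simp
  have ea : ∀ i, 1 ≤ i → i ≤ n → e₂ * a i = a i := by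
    intro i h h'
    rw [ha i h h', ← mul_assoc, ← mul_assoc, he₂]
  have ae : ∀ i, 1 ≤ i → i ≤ n → a i * e₁ = a i := by
    intro i h h'
    rw [ha i h h', mul_assoc, he₁]
  have eb : ∀ i, 1 ≤ i → i ≤ n → e₁ * b i = b i := by
    intro i h h'
    rw [hb i h h', ← mul_assoc, ← mul_assoc, he₁]
  have be : ∀ i, 1 ≤ i → i ≤ n → b i * e₂ = b i := by
    intro i h h'
    rw [hb i h h', mul_assoc, he₂]
  have ae2 := ae n hn le_rfl
  have ea2 := ea n hn le_rfl
  have eb2 := eb n hn le_rfl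
  have be2 := be n hn le_rfl
  have ae3 : a n * e₂ = 0 := by rw [← ae2, mul_assoc, h12, mul_zero]
  have B : ∀ i, 1 ≤ i → i < n → br (e₂ + a n * b n) (b i) =
          (2 : k)⁻¹ • (b i ⊗ₜ[k] (e₂ + a n * b n) - (b i * (e₂ + a n * b n)) ⊗ₜ[k] e₂)
          - (if n = i + 1 then b n ⊗ₜ[k] e₂ else 0) := by
    intro i h h'
    rw [map_add, LinearMap.add_apply, hE, L, hab_gt n i hn le_rfl h h'.le h',
      hbb_gt n i hn le_rfl h h'.le h']
    split_ifs <;>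
    simp only [add_mul, mul_add, sub_mul, neg_mul, mul_neg, smul_mul_assoc, mul_smul_comm,
      Algebra.TensorProduct.tmul_mul_tmul, mul_one, one_mul, tmul_add, add_tmul, mul_assoc,
      eb2, be i h h'.le, zero_mul] <;> module
  refine ⟨?_, ?_, ?_, ?_, ?_⟩
  · intro i h h1
    have h' : i < n := by omega
    rw [map_add, LinearMap.add_apply, hE, L, haa_gt n i hn le_rfl h h'.le h',
      hskew (b n), hab_lt i n h h'.le hn le_rfl h']
    simp only [map_add, map_smul, comm_tmul, add_mul, mul_add, sub_mul, neg_mul, mul_neg,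
      smul_mul_assoc, mul_smul_comm,
      Algebra.TensorProduct.tmul_mul_tmul, mul_one, one_mul, tmul_add, add_tmul, mul_assoc,
      ae2, ea i h h'.le]
    module
  · rw [map_add, LinearMap.add_apply, hE, L, haa_eq n hn le_rfl,
      hskew (b n), hab_eq n hn le_rfl]
    simp only [map_add, map_smul, comm_tmul, add_mul, mul_add, sub_mul, neg_mul, mul_neg,
      smul_mul_assoc, mul_smul_comm, zero_mul,
      Algebra.TensorProduct.tmul_mul_tmul, mul_one, one_mul, tmul_add, add_tmul, mul_assoc,
      ae2, ea2]
    module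
  · intro i h h1
    rw [B i h (by omega), if_neg (by omega), sub_zero]
  · intro h
    rw [B (n - 1) (by omega) (by omega), if_pos (by omega)]
  · rw [map_add, LinearMap.add_apply, hE, L, hab_eq n hn le_rfl, hbb_eq n hn le_rfl]
    simp only [add_mul, mul_add, smul_mul_assoc, mul_smul_comm, mul_zero,
      Algebra.TensorProduct.tmul_mul_tmul, mul_one, one_mul, tmul_add, add_tmul, mul_assoc,
      eb2, be2]
    module
end
end

section
/- With the data of the double bracket on the generators a₁,…,aₙ, b₁,…,bₙ described in the context, the following identities hold: (i) 2·⟨⟨(a₁,…,b_i), b_j⟩⟩ = b_j(a₁,…,b_i)⊗e₂ − b_j⊗(a₁,…,b_i) for 1 ≤ i < j ≤ n; (ii) 2·⟨⟨(a₁,…,b_i), a_j⟩⟩ = e₂⊗(a₁,…,b_i)a_j − (a₁,…,b_i)⊗a_j whenever j ≥ i+2; (iii) ⟨⟨(a₁,…,b_i), a_{i+1}⟩⟩ = (1/2)·(e₂⊗(a₁,…,b_i)a_{i+1} − (a₁,…,b_i)⊗a_{i+1}) + e₂⊗(a₁,…,a_i) for 1 ≤ i ≤ n−1, where (a₁,…,b_i)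 denotes the Euler continuant of the alternating sequence a₁,b₁,…,a_i,b_i and (a₁,…,a_i) that of a₁,b₁,…,b_{i−1},a_i. -/
open TensorProduct

noncomputable section

/-- The pair of Euler continuants `((a₁,b₁,…,b_i,a_{i+1}), (a₁,b₁,…,a_{i+1},b_{i+1}))` of the
alternating sequence `a₁,b₁,a₂,b₂,…`, with `(a₁) = a₁`, `(a₁,b₁) = e₂ + a₁b₁` and the
recursions `(a₁,…,a_{i+1}) = (a₁,…,b_i)·a_{i+1} + (a₁,…,a_i)`,
`(a₁,…,b_{i+1}) = (a₁,…,a_{i+1})·b_{i+1} + (a₁,…,b_i)`. -/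
def contPair {A : Type*} [Ring A] (e₂ : A) (a b : ℕ → A) : ℕ → A × A
  | 0 => (a 1, e₂ + a 1 * b 1)
  | i + 1 =>
    ((contPair e₂ a b i).2 * a (i + 2) + (contPair e₂ a b i).1,
     ((contPair e₂ a b i).2 * a (i + 2) + (contPair e₂ a b i).1) * b (i + 2) +
       (contPair e₂ a b i).2)

/-- The odd Euler continuant `(a₁,b₁,…,b_{i−1},a_i)`. -/
def contA {A : Type*} [Ring A] (e₂ : A) (a b : ℕ → A) (i : ℕ) : A :=
  (contPair e₂ a b (i - 1)).1

/-- The even Euler continuant `(a₁,b₁,…,a_i,b_i)`, with the convention that it equals `e₂`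
when `i = 0`. -/
def contB {A : Type*} [Ring A] (e₂ : A) (a b : ℕ → A) (i : ℕ) : A :=
  if i = 0 then e₂ else (contPair e₂ a b (i - 1)).2

theorem cont_aux_s8 {k : Type*} [Field k] [CharZero k]
    {A : Type*} [Ring A] [Algebra k A]
    (n : ℕ) (e₁ e₂ : A) (a b P Q : ℕ → A)
    (br : A →ₗ[k] A →ₗ[k] A ⊗[k] A)
    (he₂ : e₂ * e₂ = e₂)
    (ha1 : ∀ i, 1 ≤ i → i ≤ n → a i * e₁ = a i)
    (ha2 : ∀ i, 1 ≤ i → i ≤ n → e₂ * a i = a i)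
    (hb1 : ∀ i, 1 ≤ i → i ≤ n → e₁ * b i = b i)
    (hb2 : ∀ i, 1 ≤ i → i ≤ n → b i * e₂ = b i)
    (hl : ∀ x y z : A, br (y * z) x = br y x * (z ⊗ₜ[k] 1) + (1 ⊗ₜ[k] y) * br z x)
    (hbr₂ : ∀ x : A, br e₂ x = 0)
    (haa : ∀ i j, 1 ≤ i → j ≤ n → i < j →
      br (a i) (a j) = -((2 : k)⁻¹ • (a i ⊗ₜ[k] a j + a j ⊗ₜ[k] a i)))
    (hbb : ∀ i j, 1 ≤ i → j ≤ n → i < j →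
      br (b i) (b j) = -((2 : k)⁻¹ • (b i ⊗ₜ[k] b j + b j ⊗ₜ[k] b i)))
    (hab : ∀ i j, 1 ≤ i → j ≤ n → i < j →
      br (a i) (b j) = (2 : k)⁻¹ • (e₁ ⊗ₜ[k] (a i * b j) + (b j * a i) ⊗ₜ[k] e₂))
    (hba : ∀ i j, 1 ≤ i → j ≤ n → i < j →
      br (b i) (a j) = (2 : k)⁻¹ • (e₂ ⊗ₜ[k] (b i * a j) + (a j * b i) ⊗ₜ[k] e₁)
        + (if j = i + 1 then e₂ ⊗ₜ[k] e₁ else 0))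
    (hP0 : P 0 = e₂) (hQ0 : Q 0 = 0)
    (hQ : ∀ i, Q (i + 1) = P i * a (i + 1) + Q i)
    (hP : ∀ i, P (i + 1) = Q (i + 1) * b (i + 1) + P i) (i : ℕ) : i ≤ n →
    (P i * e₂ = P i ∧ Q i * e₁ = Q i) ∧ ∀ j, i < j → j ≤ n →
      br (Q i) (b j) = (2 : k)⁻¹ • (e₁ ⊗ₜ[k] (Q i * b j) + (b j * Q i) ⊗ₜ[k] e₂) ∧
      br (Q i) (a j) = -((2 : k)⁻¹ • (Q i ⊗ₜ[k] a j + a j ⊗ₜ[k] Q i)) ∧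
      br (P i) (b j) = (2 : k)⁻¹ • ((b j * P i) ⊗ₜ[k] e₂ - b j ⊗ₜ[k] P i) ∧
      br (P i) (a j) = (2 : k)⁻¹ • (e₂ ⊗ₜ[k] (P i * a j) - P i ⊗ₜ[k] a j) +
        (if j = i + 1 then e₂ ⊗ₜ[k] Q i else 0) := by
  induction i with
  | zero =>
    intro _
    refine ⟨⟨by rw [hP0, he₂], by rw [hQ0, zero_mul]⟩, fun j hj hjn => ?_⟩
    simp [hP0, hQ0, hbr₂, hb2 j hj hjn, ha2 j hj hjn]
  | succ i ih =>
    intro hin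
    obtain ⟨⟨hPe, hQe⟩, ih⟩ := ih (by omega)
    have hi1 : 1 ≤ i + 1 := by omega
    have hQe' : Q (i + 1) * e₁ = Q (i + 1) := by
      rw [hQ, add_mul, mul_assoc, ha1 _ hi1 hin, hQe]
    have hPe' : P (i + 1) * e₂ = P (i + 1) := by
      rw [hP, add_mul, mul_assoc, hb2 _ hi1 hin, hPe]
    refine ⟨⟨hPe', hQe'⟩, fun j hj hjn => ?_⟩
    obtain ⟨h1, h2, h3, h4⟩ := ih j (by omega) hjn
    rw [if_neg (by omega), add_zero] at h4
    have k1 : br (Q (i + 1)) (b j) =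
        (2 : k)⁻¹ • (e₁ ⊗ₜ[k] (Q (i + 1) * b j) + (b j * Q (i + 1)) ⊗ₜ[k] e₂) := by
      rw [hQ, map_add, LinearMap.add_apply, hl, h1, h3, hab _ _ hi1 hjn hj]
      simp only [smul_mul_assoc, mul_smul_comm, add_mul, sub_mul, mul_add, mul_sub,
        Algebra.TensorProduct.tmul_mul_tmul, mul_one, one_mul, tmul_add, add_tmul, hPe, mul_assoc]
      module
    have k2 : br (Q (i + 1)) (a j) =
        -((2 : k)⁻¹ • (Q (i + 1) ⊗ₜ[k] a j + a j ⊗ₜ[k] Q (i + 1))) := by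
      rw [hQ, map_add, LinearMap.add_apply, hl, h2, h4, haa _ _ hi1 hjn hj]
      simp only [smul_mul_assoc, mul_smul_comm, add_mul, sub_mul, mul_add, mul_sub, mul_neg,
        Algebra.TensorProduct.tmul_mul_tmul, mul_one, one_mul, tmul_add, add_tmul,
        ha2 _ hi1 hin, mul_assoc]
      module
    refine ⟨k1, k2, ?_, ?_⟩
    · rw [hP, map_add, LinearMap.add_apply, hl, k1, h3, hbb _ _ hi1 hjn hj]
      simp only [smul_mul_assoc, mul_smul_comm, add_mul, sub_mul, mul_add, mul_sub, mul_neg,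
        Algebra.TensorProduct.tmul_mul_tmul, mul_one, one_mul, tmul_add, add_tmul,
        hb1 _ hi1 hin, mul_assoc]
      module
    · have k3 : (1 ⊗ₜ[k] Q (i + 1)) * (if j = i + 1 + 1 then e₂ ⊗ₜ[k] e₁ else 0) =
          (if j = i + 1 + 1 then e₂ ⊗ₜ[k] Q (i + 1) else 0) := by
        split_ifs
        · rw [Algebra.TensorProduct.tmul_mul_tmul, one_mul, hQe']
        · rw [mul_zero]
      rw [hP, map_add, LinearMap.add_apply, hl, k2, h4, hba _ _ hi1 hjn hj, mul_add, k3]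
      generalize (if j = i + 1 + 1 then e₂ ⊗ₜ[k] Q (i + 1) else 0) = D
      simp only [smul_mul_assoc, mul_smul_comm, add_mul, sub_mul, mul_add, mul_sub, neg_mul,
        Algebra.TensorProduct.tmul_mul_tmul, mul_one, one_mul, tmul_add, add_tmul,
        hQe', mul_assoc]
      module

/-- Lemma 3.3 of the paper: values of the double quasi-Poisson bracket of the even Euler
continuants `(a₁,…,b_i)` against later generators. -/
theorem bracket_even_continuant_later {k : Type*} [Field k] [CharZero k]
    {A : Type*} [Ring A] [Algebra k A]
    (n : ℕ) (hn : 1 ≤ n)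
    (e₁ e₂ : A) (a b : ℕ → A)
    (br : A →ₗ[k] A →ₗ[k] A ⊗[k] A)
    (he₁ : e₁ * e₁ = e₁) (he₂ : e₂ * e₂ = e₂)
    (h12 : e₁ * e₂ = 0) (h21 : e₂ * e₁ = 0) (hsum : e₁ + e₂ = 1)
    (ha : ∀ i, 1 ≤ i → i ≤ n → a i = e₂ * a i * e₁)
    (hb : ∀ i, 1 ≤ i → i ≤ n → b i = e₁ * b i * e₂)
    (hskew : ∀ x y : A, br x y = - TensorProduct.comm k A A (br y x))
    (hleib : ∀ x y z : A, br x (y * z) = br x y * (1 ⊗ₜ[k] z) + (y ⊗ₜ[k] 1) * br x z)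
    (hbr₁ : ∀ x : A, br x e₁ = 0) (hbr₂ : ∀ x : A, br x e₂ = 0)
    (haa_lt : ∀ i j, 1 ≤ i → i ≤ n → 1 ≤ j → j ≤ n → i < j →
      br (a i) (a j) = -((2 : k)⁻¹ • (a i ⊗ₜ[k] a j + a j ⊗ₜ[k] a i)))
    (haa_eq : ∀ i, 1 ≤ i → i ≤ n → br (a i) (a i) = 0)
    (haa_gt : ∀ i j, 1 ≤ i → i ≤ n → 1 ≤ j → j ≤ n → j < i →
      br (a i) (a j) = (2 : k)⁻¹ • (a i ⊗ₜ[k] a j + a j ⊗ₜ[k] a i))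
    (hbb_lt : ∀ i j, 1 ≤ i → i ≤ n → 1 ≤ j → j ≤ n → i < j →
      br (b i) (b j) = -((2 : k)⁻¹ • (b i ⊗ₜ[k] b j + b j ⊗ₜ[k] b i)))
    (hbb_eq : ∀ i, 1 ≤ i → i ≤ n → br (b i) (b i) = 0)
    (hbb_gt : ∀ i j, 1 ≤ i → i ≤ n → 1 ≤ j → j ≤ n → j < i →
      br (b i) (b j) = (2 : k)⁻¹ • (b i ⊗ₜ[k] b j + b j ⊗ₜ[k] b i))
    (hab_lt : ∀ i j, 1 ≤ i → i ≤ n → 1 ≤ j → j ≤ n → i < j →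
      br (a i) (b j) = (2 : k)⁻¹ • (e₁ ⊗ₜ[k] (a i * b j) + (b j * a i) ⊗ₜ[k] e₂))
    (hab_eq : ∀ i, 1 ≤ i → i ≤ n →
      br (a i) (b i) =
        (2 : k)⁻¹ • ((b i * a i) ⊗ₜ[k] e₂ + e₁ ⊗ₜ[k] (a i * b i)) + e₁ ⊗ₜ[k] e₂)
    (hab_gt : ∀ i j, 1 ≤ i → i ≤ n → 1 ≤ j → j ≤ n → j < i →
      br (a i) (b j) = -((2 : k)⁻¹ • ((b j * a i) ⊗ₜ[k] e₂ + e₁ ⊗ₜ[k] (a i * b j)))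
        - (if i = j + 1 then e₁ ⊗ₜ[k] e₂ else 0))
    :
    (∀ i j, 1 ≤ i → i < j → j ≤ n →
        (2 : k) • br (contB e₂ a b i) (b j) =
          (b j * contB e₂ a b i) ⊗ₜ[k] e₂ - b j ⊗ₜ[k] contB e₂ a b i) ∧
    (∀ i j, 1 ≤ i → i + 2 ≤ j → j ≤ n →
        (2 : k) • br (contB e₂ a b i) (a j) =
          e₂ ⊗ₜ[k] (contB e₂ a b i * a j) - contB e₂ a b i ⊗ₜ[k] a j) ∧
    (∀ i, 1 ≤ i → i ≤ n - 1 →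
        br (contB e₂ a b i) (a (i + 1)) =
          (2 : k)⁻¹ • (e₂ ⊗ₜ[k] (contB e₂ a b i * a (i + 1)) -
              contB e₂ a b i ⊗ₜ[k] a (i + 1)) + e₂ ⊗ₜ[k] contA e₂ a b i) := by
  have hl : ∀ x y z : A, br (y * z) x = br y x * (z ⊗ₜ[k] 1) + (1 ⊗ₜ[k] y) * br z x := by
    intro x y z
    have hc : ∀ s t : A ⊗[k] A, TensorProduct.comm k A A (s * t) =
        TensorProduct.comm k A A s * TensorProduct.comm k A A t :=
      fun s t => map_mul (Algebra.TensorProduct.comm k A A) s t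
    rw [hskew (y * z) x, hleib, map_add, hc, hc, hskew y x, hskew z x]
    simp only [TensorProduct.comm_tmul, neg_mul, mul_neg, neg_add]
  have ha1 : ∀ i, 1 ≤ i → i ≤ n → a i * e₁ = a i := fun i h h' => by
    rw [ha i h h', mul_assoc, he₁]
  have ha2 : ∀ i, 1 ≤ i → i ≤ n → e₂ * a i = a i := fun i h h' => by
    rw [ha i h h', ← mul_assoc, ← mul_assoc, he₂]
  have hb1 : ∀ i, 1 ≤ i → i ≤ n → e₁ * b i = b i := fun i h h' => by
    rw [hb i h h', ← mul_assoc, ← mul_assoc, he₁]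
  have hb2 : ∀ i, 1 ≤ i → i ≤ n → b i * e₂ = b i := fun i h h' => by
    rw [hb i h h', mul_assoc, he₂]
  have key := cont_aux_s8 n e₁ e₂ a b (contB e₂ a b)
    (fun i => if i = 0 then 0 else contA e₂ a b i) br he₂ ha1 ha2 hb1 hb2 hl
    (fun x => by rw [hskew, hbr₂, map_zero, neg_zero])
    (fun i j h h' h'' => haa_lt i j h (by omega) (by omega) h' h'')
    (fun i j h h' h'' => hbb_lt i j h (by omega) (by omega) h' h'')
    (fun i j h h' h'' => hab_lt i j h (by omega) (by omega) h' h'')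
    (fun i j h h' h'' => by
      rw [hskew, hab_gt j i (by omega) h' h (by omega) h'']
      split_ifs
      · simp only [map_sub, map_neg, map_smul, map_add, TensorProduct.comm_tmul]
        module
      · simp only [map_sub, map_neg, map_smul, map_add, TensorProduct.comm_tmul, map_zero]
        module)
    (by simp [contB]) (by simp)
    (fun i => by
      rcases i with _ | i
      · simp [contA, contB, contPair, ha2 1 le_rfl hn]
      · simp [contA, contB, contPair])
    (fun i => by
      rcases i with _ | i
      · simp [contA, contB, contPair, add_comm]
      · simp [contA, contB, contPair])
  refine ⟨fun i j h1 h2 h3 => ?_, fun i j h1 h2 h3 => ?_, fun i h1 h2 => ?_⟩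
  · obtain ⟨_, _, h, _⟩ := (key i (by omega)).2 j h2 h3
    rw [h, smul_smul, mul_inv_cancel₀ two_ne_zero, one_smul]
  · obtain ⟨_, _, _, h⟩ := (key i (by omega)).2 j (by omega) h3
    rw [h, if_neg (by omega), add_zero, smul_smul, mul_inv_cancel₀ two_ne_zero, one_smul]
  · obtain ⟨_, _, _, h⟩ := (key i (by omega)).2 (i + 1) (by omega) (by omega)
    rw [h, if_pos rfl, if_neg (by omega)]
end
end

section
/- With the data of the double bracket on the generators a₁,…,aₙ, b₁,…,bₙ described in the context, for all 1 ≤ i, j ≤ n the following hold, where (a₁,…,b_i) denotes the Euler continuant of the alternating sequence a₁,b₁,…,a_i,b_i and (a₁,…,a_i) that of a₁,b₁,…,b_{i−1},a_i: ⟨⟨(a₁,…,b_i), b_j⟩⟩ = (1/2)·(b_j(a₁,…,b_i)⊗e₂ − b_j⊗(a₁,…,b_i)) if i < j, and ⟨⟨(a₁,…,b_i), b_j⟩⟩ = (1/2)·(b_j(a₁,…,b_i)⊗e₂ + b_j⊗(a₁,…,b_i)) if i ≥ j; moreover ⟨⟨(a₁,…,b_i), a_j⟩⟩ = (1/2)·(e₂⊗(a₁,…,b_i)a_j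 − (a₁,…,b_i)⊗a_j) if i < j−1, ⟨⟨(a₁,…,b_i), a_j⟩⟩ = (1/2)·(e₂⊗(a₁,…,b_i)a_j − (a₁,…,b_i)⊗a_j) + e₂⊗(a₁,…,a_i) if i = j−1, and ⟨⟨(a₁,…,b_i), a_j⟩⟩ = −(1/2)·(e₂⊗(a₁,…,b_i)a_j + (a₁,…,b_i)⊗a_j) if i ≥ j. -/
open TensorProduct

noncomputable section

theorem brk_left {k : Type*} [Field k] {A : Type*} [Ring A] [Algebra k A]
    (br : A →ₗ[k] A →ₗ[k] A ⊗[k] A)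
    (hskew : ∀ x y : A, br x y = - TensorProduct.comm k A A (br y x))
    (hleib : ∀ x y z : A, br x (y * z) = br x y * (1 ⊗ₜ[k] z) + (y ⊗ₜ[k] 1) * br x z)
    (x y z : A) :
    br (y * z) x = br y x * (z ⊗ₜ[k] 1) + (1 ⊗ₜ[k] y) * br z x := by
  have hm : ∀ u v : A ⊗[k] A, TensorProduct.comm k A A (u * v) =
      TensorProduct.comm k A A u * TensorProduct.comm k A A v :=
    fun u v => map_mul (Algebra.TensorProduct.comm k A A) u v
  rw [hskew (y * z) x, hleib, map_add, hm, hm, hskew y x, hskew z x]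
  simp only [TensorProduct.comm_tmul]
  rw [neg_mul, mul_neg, neg_add]

theorem brk_aux {k : Type*} [Field k] [CharZero k]
    {A : Type*} [Ring A] [Algebra k A]
    (n : ℕ) (hn : 1 ≤ n)
    (e₁ e₂ : A) (a b : ℕ → A)
    (br : A →ₗ[k] A →ₗ[k] A ⊗[k] A)
    (he₁ : e₁ * e₁ = e₁) (he₂ : e₂ * e₂ = e₂)
    (h12 : e₁ * e₂ = 0) (h21 : e₂ * e₁ = 0) (hsum : e₁ + e₂ = 1)
    (ha : ∀ i, 1 ≤ i → i ≤ n → a i = e₂ * a i * e₁)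
    (hb : ∀ i, 1 ≤ i → i ≤ n → b i = e₁ * b i * e₂)
    (hskew : ∀ x y : A, br x y = - TensorProduct.comm k A A (br y x))
    (hleib : ∀ x y z : A, br x (y * z) = br x y * (1 ⊗ₜ[k] z) + (y ⊗ₜ[k] 1) * br x z)
    (hbr₁ : ∀ x : A, br x e₁ = 0) (hbr₂ : ∀ x : A, br x e₂ = 0)
    (haa_lt : ∀ i j, 1 ≤ i → i ≤ n → 1 ≤ j → j ≤ n → i < j →
      br (a i) (a j) = -((2 : k)⁻¹ • (a i ⊗ₜ[k] a j + a j ⊗ₜ[k] a i)))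
    (haa_eq : ∀ i, 1 ≤ i → i ≤ n → br (a i) (a i) = 0)
    (haa_gt : ∀ i j, 1 ≤ i → i ≤ n → 1 ≤ j → j ≤ n → j < i →
      br (a i) (a j) = (2 : k)⁻¹ • (a i ⊗ₜ[k] a j + a j ⊗ₜ[k] a i))
    (hbb_lt : ∀ i j, 1 ≤ i → i ≤ n → 1 ≤ j → j ≤ n → i < j →
      br (b i) (b j) = -((2 : k)⁻¹ • (b i ⊗ₜ[k] b j + b j ⊗ₜ[k] b i)))
    (hbb_eq : ∀ i, 1 ≤ i → i ≤ n → br (b i) (b i) = 0)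
    (hbb_gt : ∀ i j, 1 ≤ i → i ≤ n → 1 ≤ j → j ≤ n → j < i →
      br (b i) (b j) = (2 : k)⁻¹ • (b i ⊗ₜ[k] b j + b j ⊗ₜ[k] b i))
    (hab_lt : ∀ i j, 1 ≤ i → i ≤ n → 1 ≤ j → j ≤ n → i < j →
      br (a i) (b j) = (2 : k)⁻¹ • (e₁ ⊗ₜ[k] (a i * b j) + (b j * a i) ⊗ₜ[k] e₂))
    (hab_eq : ∀ i, 1 ≤ i → i ≤ n →
      br (a i) (b i) =
        (2 : k)⁻¹ • ((b i * a i) ⊗ₜ[k] e₂ + e₁ ⊗ₜ[k] (a i * b i)) + e₁ ⊗ₜ[k] e₂)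
    (hab_gt : ∀ i j, 1 ≤ i → i ≤ n → 1 ≤ j → j ≤ n → j < i →
      br (a i) (b j) = -((2 : k)⁻¹ • ((b j * a i) ⊗ₜ[k] e₂ + e₁ ⊗ₜ[k] (a i * b j)))
        - (if i = j + 1 then e₁ ⊗ₜ[k] e₂ else 0))
    (hba_lt : ∀ i j, 1 ≤ i → i ≤ n → 1 ≤ j → j ≤ n → j < i →
      br (b i) (a j) = -((2 : k)⁻¹ • ((a j * b i) ⊗ₜ[k] e₁ + e₂ ⊗ₜ[k] (b i * a j))))
    (hba_eq : ∀ i, 1 ≤ i → i ≤ n →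
      br (b i) (a i) =
        -((2 : k)⁻¹ • (e₂ ⊗ₜ[k] (b i * a i) + (a i * b i) ⊗ₜ[k] e₁)) - e₂ ⊗ₜ[k] e₁)
    (hba_gt : ∀ i j, 1 ≤ i → i ≤ n → 1 ≤ j → j ≤ n → i < j →
      br (b i) (a j) = (2 : k)⁻¹ • (e₂ ⊗ₜ[k] (b i * a j) + (a j * b i) ⊗ₜ[k] e₁)
        + (if j = i + 1 then e₂ ⊗ₜ[k] e₁ else 0))
    (S T : ℕ → A) (hS0 : S 0 = 0) (hT0 : T 0 = e₂)
    (hS : ∀ i, S (i + 1) = T i * a (i + 1) + S i)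
    (hT : ∀ i, T (i + 1) = S (i + 1) * b (i + 1) + T i) (i : ℕ) (hi : i ≤ n) :
    (e₂ * T i = T i ∧ T i * e₂ = T i ∧ e₂ * S i = S i ∧ S i * e₁ = S i) ∧
    (∀ j, 1 ≤ j → j ≤ n → i < j →
        br (T i) (b j) = (2 : k)⁻¹ • ((b j * T i) ⊗ₜ[k] e₂ - b j ⊗ₜ[k] T i)) ∧
    (∀ j, 1 ≤ j → j ≤ n → j ≤ i →
        br (T i) (b j) = (2 : k)⁻¹ • ((b j * T i) ⊗ₜ[k] e₂ + b j ⊗ₜ[k] T i)) ∧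
    (∀ j, 1 ≤ j → j ≤ n → i < j →
        br (T i) (a j) = (2 : k)⁻¹ • (e₂ ⊗ₜ[k] (T i * a j) - T i ⊗ₜ[k] a j) +
          (if j = i + 1 then e₂ ⊗ₜ[k] S i else 0)) ∧
    (∀ j, 1 ≤ j → j ≤ n → j ≤ i →
        br (T i) (a j) = -((2 : k)⁻¹ • (e₂ ⊗ₜ[k] (T i * a j) + T i ⊗ₜ[k] a j))) ∧
    (∀ j, 1 ≤ j → j ≤ n → i < j →
        br (S i) (b j) = (2 : k)⁻¹ • (e₁ ⊗ₜ[k] (S i * b j) + (b j * S i) ⊗ₜ[k] e₂)) ∧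
    (∀ j, 1 ≤ j → j ≤ n → j ≤ i →
        br (S i) (b j) = (2 : k)⁻¹ • ((b j * S i) ⊗ₜ[k] e₂ - e₁ ⊗ₜ[k] (S i * b j)) +
          (if i = j then e₁ ⊗ₜ[k] T i else 0)) ∧
    (∀ j, 1 ≤ j → j ≤ n → i < j →
        br (S i) (a j) = -((2 : k)⁻¹ • (S i ⊗ₜ[k] a j + a j ⊗ₜ[k] S i))) ∧
    (∀ j, 1 ≤ j → j ≤ n → j ≤ i →
        br (S i) (a j) = (2 : k)⁻¹ • (a j ⊗ₜ[k] S i - S i ⊗ₜ[k] a j)) := by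
  have hL := brk_left br hskew hleib
  have ea : ∀ j, 1 ≤ j → j ≤ n → e₂ * a j = a j := fun j h1 h2 => by
    rw [ha j h1 h2]; simp only [← mul_assoc, he₂]
  have ae : ∀ j, 1 ≤ j → j ≤ n → a j * e₁ = a j := fun j h1 h2 => by
    rw [ha j h1 h2]; simp only [mul_assoc, he₁]
  have eb : ∀ j, 1 ≤ j → j ≤ n → e₁ * b j = b j := fun j h1 h2 => by
    rw [hb j h1 h2]; simp only [← mul_assoc, he₁]
  have be : ∀ j, 1 ≤ j → j ≤ n → b j * e₂ = b j := fun j h1 h2 => by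
    rw [hb j h1 h2]; simp only [mul_assoc, he₂]
  have he2l : ∀ x, br e₂ x = 0 := fun x => by rw [hskew, hbr₂, map_zero, neg_zero]
  induction i with
  | zero =>
    rw [hS0, hT0]
    refine ⟨⟨he₂, he₂, by simp, by simp⟩, ?_, ?_, ?_, ?_, ?_, ?_, ?_, ?_⟩ <;> intro j h1 h2 h3
    · rw [he2l, be j h1 h2]; simp
    · omega
    · rw [he2l, ea j h1 h2]; simp
    · omega
    · simp
    · omega
    · simp
    · omega
  | succ i ih =>
    obtain ⟨⟨t1, t2, s1, s2⟩, Tb1, Tb2, Ta1, Ta2, Sb1, Sb2, Sa1, Sa2⟩ := ih (by omega)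
    have i1 : 1 ≤ i + 1 := by omega
    have q1 := ea _ i1 hi
    have q2 := ae _ i1 hi
    have q3 := eb _ i1 hi
    have q4 := be _ i1 hi
    have s1' : e₂ * S (i + 1) = S (i + 1) := by
      rw [hS, mul_add, ← mul_assoc, t1, s1]
    have s2' : S (i + 1) * e₁ = S (i + 1) := by
      rw [hS, add_mul, mul_assoc, q2, s2]
    have t1' : e₂ * T (i + 1) = T (i + 1) := by
      rw [hT, mul_add, ← mul_assoc, t1, s1']
    have t2' : T (i + 1) * e₂ = T (i + 1) := by
      rw [hT, add_mul, mul_assoc, q4, t2]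
    have SL : ∀ x, br (S (i + 1)) x = br (T i) x * (a (i + 1) ⊗ₜ[k] 1)
        + (1 ⊗ₜ[k] T i) * br (a (i + 1)) x + br (S i) x := fun x => by
      rw [hS, map_add, LinearMap.add_apply, hL]
    have TL : ∀ x, br (T (i + 1)) x = br (S (i + 1)) x * (b (i + 1) ⊗ₜ[k] 1)
        + (1 ⊗ₜ[k] S (i + 1)) * br (b (i + 1)) x + br (T i) x := fun x => by
      rw [hT, map_add, LinearMap.add_apply, hL]
    have Sb1' : ∀ j, 1 ≤ j → j ≤ n → i + 1 < j →
        br (S (i + 1)) (b j) = (2 : k)⁻¹ • (e₁ ⊗ₜ[k] (S (i + 1) * b j)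
          + (b j * S (i + 1)) ⊗ₜ[k] e₂) := by
      intro j h1 h2 h3
      have r1 := ea j h1 h2
      have r2 := ae j h1 h2
      have r3 := eb j h1 h2
      have r4 := be j h1 h2
      rw [SL, Tb1 j h1 h2 (by omega), Sb1 j h1 h2 (by omega), hab_lt _ j i1 hi h1 h2 h3, hS]
      simp only [mul_add, add_mul, sub_mul, smul_mul_assoc,
        mul_smul_comm, Algebra.TensorProduct.tmul_mul_tmul, TensorProduct.tmul_add,
        TensorProduct.add_tmul, mul_assoc, mul_one, one_mul,
        t2]
      module
    have Sb2' : ∀ j, 1 ≤ j → j ≤ n → j ≤ i + 1 →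
        br (S (i + 1)) (b j) = (2 : k)⁻¹ • ((b j * S (i + 1)) ⊗ₜ[k] e₂
          - e₁ ⊗ₜ[k] (S (i + 1) * b j)) + (if i + 1 = j then e₁ ⊗ₜ[k] T (i + 1) else 0) := by
      intro j h1 h2 h3
      have r1 := ea j h1 h2
      have r2 := ae j h1 h2
      have r3 := eb j h1 h2
      have r4 := be j h1 h2
      rcases Nat.lt_or_ge j (i + 1) with h | h
      · rw [SL, Tb2 j h1 h2 (by omega), Sb2 j h1 h2 (by omega), hab_gt _ j i1 hi h1 h2 h, hS,
          if_neg (show ¬ i + 1 = j by omega)]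
        by_cases h' : i = j
        · rw [if_pos h', if_pos (by omega)]
          subst h'
          simp only [mul_add, add_mul, mul_sub, mul_neg, smul_mul_assoc,
            mul_smul_comm, Algebra.TensorProduct.tmul_mul_tmul, TensorProduct.tmul_add,
            TensorProduct.add_tmul, mul_assoc, mul_one, one_mul,
            t2]
          module
        · rw [if_neg h', if_neg (by omega)]
          simp only [mul_add, add_mul, mul_sub, mul_neg, smul_mul_assoc,
            mul_smul_comm, Algebra.TensorProduct.tmul_mul_tmul, TensorProduct.tmul_add,
            TensorProduct.add_tmul, mul_assoc, mul_one, one_mul,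
            t2, mul_zero]
          module
      · obtain rfl : j = i + 1 := by omega
        rw [SL, Tb1 _ h1 h2 (by omega), Sb1 _ h1 h2 (by omega), hab_eq _ h1 h2, if_pos rfl, hT, hS]
        simp only [mul_add, add_mul, sub_mul, smul_mul_assoc,
          mul_smul_comm, Algebra.TensorProduct.tmul_mul_tmul, TensorProduct.tmul_add,
          TensorProduct.add_tmul, mul_assoc, mul_one, one_mul,
          t2]
        module
    have Sa1' : ∀ j, 1 ≤ j → j ≤ n → i + 1 < j →
        br (S (i + 1)) (a j) = -((2 : k)⁻¹ • (S (i + 1) ⊗ₜ[k] a j + a j ⊗ₜ[k] S (i + 1))) := by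
      intro j h1 h2 h3
      have r1 := ea j h1 h2
      have r2 := ae j h1 h2
      have r3 := eb j h1 h2
      have r4 := be j h1 h2
      rw [SL, Ta1 j h1 h2 (by omega), Sa1 j h1 h2 (by omega), haa_lt _ j i1 hi h1 h2 h3, hS,
        if_neg (by omega)]
      simp only [mul_add, add_mul, sub_mul, mul_neg, smul_mul_assoc,
        mul_smul_comm, Algebra.TensorProduct.tmul_mul_tmul, TensorProduct.tmul_add,
        TensorProduct.add_tmul, mul_one, one_mul,
        q1, zero_mul]
      module
    have Sa2' : ∀ j, 1 ≤ j → j ≤ n → j ≤ i + 1 →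
        br (S (i + 1)) (a j) = (2 : k)⁻¹ • (a j ⊗ₜ[k] S (i + 1) - S (i + 1) ⊗ₜ[k] a j) := by
      intro j h1 h2 h3
      have r1 := ea j h1 h2
      have r2 := ae j h1 h2
      have r3 := eb j h1 h2
      have r4 := be j h1 h2
      rcases Nat.lt_or_ge j (i + 1) with h | h
      · rw [SL, Ta2 j h1 h2 (by omega), Sa2 j h1 h2 (by omega), haa_gt _ j i1 hi h1 h2 h, hS]
        simp only [mul_add, add_mul, neg_mul, smul_mul_assoc,
          mul_smul_comm, Algebra.TensorProduct.tmul_mul_tmul, TensorProduct.tmul_add,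
          TensorProduct.add_tmul, mul_one, one_mul,
          q1]
        module
      · obtain rfl : j = i + 1 := by omega
        rw [SL, Ta1 _ h1 h2 (by omega), Sa1 _ h1 h2 (by omega), haa_eq _ h1 h2, if_pos rfl, hS]
        simp only [add_mul, sub_mul, smul_mul_assoc,
          Algebra.TensorProduct.tmul_mul_tmul, TensorProduct.tmul_add,
          TensorProduct.add_tmul, mul_one,
          q1, mul_zero]
        module
    refine ⟨⟨t1', t2', s1', s2'⟩, ?_, ?_, ?_, ?_, Sb1', Sb2', Sa1', Sa2'⟩ <;>
      intro j h1 h2 h3 <;>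
      have r1 := ea j h1 h2 <;>
      have r2 := ae j h1 h2 <;>
      have r3 := eb j h1 h2 <;>
      have r4 := be j h1 h2
    · rw [TL, Sb1' j h1 h2 h3, Tb1 j h1 h2 (by omega), hbb_lt _ j i1 hi h1 h2 h3, hT]
      simp only [mul_add, add_mul, mul_neg, smul_mul_assoc,
        mul_smul_comm, Algebra.TensorProduct.tmul_mul_tmul, TensorProduct.tmul_add,
        TensorProduct.add_tmul, mul_assoc, mul_one, one_mul,
        q3]
      module
    · rcases Nat.lt_or_ge j (i + 1) with h | h
      · rw [TL, Sb2' j h1 h2 h3, Tb2 j h1 h2 (by omega), hbb_gt _ j i1 hi h1 h2 h, hT,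
          if_neg (by omega)]
        simp only [mul_add, add_mul, sub_mul, smul_mul_assoc,
          mul_smul_comm, Algebra.TensorProduct.tmul_mul_tmul, TensorProduct.tmul_add,
          TensorProduct.add_tmul, mul_assoc, mul_one, one_mul,
          q3, zero_mul]
        module
      · obtain rfl : j = i + 1 := by omega
        rw [TL, Sb2' _ h1 h2 h3, Tb1 _ h1 h2 (by omega), hbb_eq _ h1 h2, hT, if_pos rfl]
        simp only [mul_add, add_mul, sub_mul, smul_mul_assoc,
          Algebra.TensorProduct.tmul_mul_tmul, TensorProduct.tmul_add,
          TensorProduct.add_tmul, mul_assoc, mul_one,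
          q3, mul_zero]
        module
    · rw [TL, Sa1' j h1 h2 h3, Ta1 j h1 h2 (by omega), hba_gt _ j i1 hi h1 h2 h3, hT,
        if_neg (show ¬ j = i + 1 by omega)]
      by_cases h' : j = i + 1 + 1
      · rw [if_pos h', if_pos h']
        simp only [mul_add, add_mul, neg_mul, smul_mul_assoc,
          mul_smul_comm, Algebra.TensorProduct.tmul_mul_tmul, TensorProduct.tmul_add,
          TensorProduct.add_tmul, mul_assoc, mul_one, one_mul,
          s2']
        module
      · rw [if_neg h', if_neg h']
        simp only [mul_add, add_mul, neg_mul, smul_mul_assoc,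
          mul_smul_comm, Algebra.TensorProduct.tmul_mul_tmul, TensorProduct.tmul_add,
          TensorProduct.add_tmul, mul_assoc, mul_one, one_mul,
          s2', mul_zero]
        module
    · rcases Nat.lt_or_ge j (i + 1) with h | h
      · rw [TL, Sa2' j h1 h2 h3, Ta2 j h1 h2 (by omega), hba_lt _ j i1 hi h1 h2 h, hT]
        simp only [mul_add, add_mul, sub_mul, mul_neg, smul_mul_assoc,
          mul_smul_comm, Algebra.TensorProduct.tmul_mul_tmul, TensorProduct.tmul_add,
          TensorProduct.add_tmul, mul_assoc, mul_one, one_mul,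
          s2']
        module
      · obtain rfl : j = i + 1 := by omega
        rw [TL, Sa2' _ h1 h2 h3, Ta1 _ h1 h2 (by omega), hba_eq _ h1 h2, hT, if_pos rfl]
        have hs := hS i
        have hs' : S i = S (i + 1) - T i * a (i + 1) := by rw [hs]; abel
        rw [hs']
        simp only [mul_add, add_mul, mul_sub, sub_mul, mul_neg, smul_mul_assoc,
          mul_smul_comm, Algebra.TensorProduct.tmul_mul_tmul, TensorProduct.tmul_add,
          TensorProduct.add_tmul, TensorProduct.tmul_sub, mul_assoc, mul_one, one_mul,
          s2']
        module

/-- Lemma 4.2 of the paper: values of the double quasi-Poisson bracket of the even Euler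
continuants `(a₁,…,b_i)` against all generators `a_j`, `b_j`. -/
theorem bracket_even_continuant_all {k : Type*} [Field k] [CharZero k]
    {A : Type*} [Ring A] [Algebra k A]
    (n : ℕ) (hn : 1 ≤ n)
    (e₁ e₂ : A) (a b : ℕ → A)
    (br : A →ₗ[k] A →ₗ[k] A ⊗[k] A)
    (he₁ : e₁ * e₁ = e₁) (he₂ : e₂ * e₂ = e₂)
    (h12 : e₁ * e₂ = 0) (h21 : e₂ * e₁ = 0) (hsum : e₁ + e₂ = 1)
    (ha : ∀ i, 1 ≤ i → i ≤ n → a i = e₂ * a i * e₁)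
    (hb : ∀ i, 1 ≤ i → i ≤ n → b i = e₁ * b i * e₂)
    (hskew : ∀ x y : A, br x y = - TensorProduct.comm k A A (br y x))
    (hleib : ∀ x y z : A, br x (y * z) = br x y * (1 ⊗ₜ[k] z) + (y ⊗ₜ[k] 1) * br x z)
    (hbr₁ : ∀ x : A, br x e₁ = 0) (hbr₂ : ∀ x : A, br x e₂ = 0)
    (haa_lt : ∀ i j, 1 ≤ i → i ≤ n → 1 ≤ j → j ≤ n → i < j →
      br (a i) (a j) = -((2 : k)⁻¹ • (a i ⊗ₜ[k] a j + a j ⊗ₜ[k] a i)))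
    (haa_eq : ∀ i, 1 ≤ i → i ≤ n → br (a i) (a i) = 0)
    (haa_gt : ∀ i j, 1 ≤ i → i ≤ n → 1 ≤ j → j ≤ n → j < i →
      br (a i) (a j) = (2 : k)⁻¹ • (a i ⊗ₜ[k] a j + a j ⊗ₜ[k] a i))
    (hbb_lt : ∀ i j, 1 ≤ i → i ≤ n → 1 ≤ j → j ≤ n → i < j →
      br (b i) (b j) = -((2 : k)⁻¹ • (b i ⊗ₜ[k] b j + b j ⊗ₜ[k] b i)))
    (hbb_eq : ∀ i, 1 ≤ i → i ≤ n → br (b i) (b i) = 0)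
    (hbb_gt : ∀ i j, 1 ≤ i → i ≤ n → 1 ≤ j → j ≤ n → j < i →
      br (b i) (b j) = (2 : k)⁻¹ • (b i ⊗ₜ[k] b j + b j ⊗ₜ[k] b i))
    (hab_lt : ∀ i j, 1 ≤ i → i ≤ n → 1 ≤ j → j ≤ n → i < j →
      br (a i) (b j) = (2 : k)⁻¹ • (e₁ ⊗ₜ[k] (a i * b j) + (b j * a i) ⊗ₜ[k] e₂))
    (hab_eq : ∀ i, 1 ≤ i → i ≤ n →
      br (a i) (b i) =
        (2 : k)⁻¹ • ((b i * a i) ⊗ₜ[k] e₂ + e₁ ⊗ₜ[k] (a i * b i)) + e₁ ⊗ₜ[k] e₂)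
    (hab_gt : ∀ i j, 1 ≤ i → i ≤ n → 1 ≤ j → j ≤ n → j < i →
      br (a i) (b j) = -((2 : k)⁻¹ • ((b j * a i) ⊗ₜ[k] e₂ + e₁ ⊗ₜ[k] (a i * b j)))
        - (if i = j + 1 then e₁ ⊗ₜ[k] e₂ else 0))
    :
    (∀ i j, 1 ≤ i → i ≤ n → 1 ≤ j → j ≤ n → i < j →
        br (contB e₂ a b i) (b j) =
          (2 : k)⁻¹ • ((b j * contB e₂ a b i) ⊗ₜ[k] e₂ - b j ⊗ₜ[k] contB e₂ a b i)) ∧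
    (∀ i j, 1 ≤ i → i ≤ n → 1 ≤ j → j ≤ n → j ≤ i →
        br (contB e₂ a b i) (b j) =
          (2 : k)⁻¹ • ((b j * contB e₂ a b i) ⊗ₜ[k] e₂ + b j ⊗ₜ[k] contB e₂ a b i)) ∧
    (∀ i j, 1 ≤ i → i ≤ n → 1 ≤ j → j ≤ n → i + 1 < j →
        br (contB e₂ a b i) (a j) =
          (2 : k)⁻¹ • (e₂ ⊗ₜ[k] (contB e₂ a b i * a j) - contB e₂ a b i ⊗ₜ[k] a j)) ∧
    (∀ i j, 1 ≤ i → i ≤ n → 1 ≤ j → j ≤ n → i + 1 = j →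
        br (contB e₂ a b i) (a j) =
          (2 : k)⁻¹ • (e₂ ⊗ₜ[k] (contB e₂ a b i * a j) - contB e₂ a b i ⊗ₜ[k] a j) +
            e₂ ⊗ₜ[k] contA e₂ a b i) ∧
    (∀ i j, 1 ≤ i → i ≤ n → 1 ≤ j → j ≤ n → j ≤ i →
        br (contB e₂ a b i) (a j) =
          -((2 : k)⁻¹ • (e₂ ⊗ₜ[k] (contB e₂ a b i * a j) + contB e₂ a b i ⊗ₜ[k] a j))) := by
  have hba_lt : ∀ i j, 1 ≤ i → i ≤ n → 1 ≤ j → j ≤ n → j < i →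
      br (b i) (a j) = -((2 : k)⁻¹ • ((a j * b i) ⊗ₜ[k] e₁ + e₂ ⊗ₜ[k] (b i * a j))) := by
    intro i j h1 h2 h3 h4 h5
    rw [hskew, hab_lt j i h3 h4 h1 h2 h5]
    simp only [map_smul, map_add, TensorProduct.comm_tmul]
  have hba_eq : ∀ i, 1 ≤ i → i ≤ n → br (b i) (a i) =
        -((2 : k)⁻¹ • (e₂ ⊗ₜ[k] (b i * a i) + (a i * b i) ⊗ₜ[k] e₁)) - e₂ ⊗ₜ[k] e₁ := by
    intro i h1 h2
    rw [hskew, hab_eq i h1 h2]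
    simp only [map_smul, map_add, TensorProduct.comm_tmul]
    abel
  have hba_gt : ∀ i j, 1 ≤ i → i ≤ n → 1 ≤ j → j ≤ n → i < j →
      br (b i) (a j) = (2 : k)⁻¹ • (e₂ ⊗ₜ[k] (b i * a j) + (a j * b i) ⊗ₜ[k] e₁)
        + (if j = i + 1 then e₂ ⊗ₜ[k] e₁ else 0) := by
    intro i j h1 h2 h3 h4 h5
    rw [hskew, hab_gt j i h3 h4 h1 h2 h5]
    split_ifs <;> simp only [map_smul, map_add, map_neg, map_sub, map_zero,
      TensorProduct.comm_tmul] <;> abel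
  have key := brk_aux n hn e₁ e₂ a b br he₁ he₂ h12 h21 hsum ha hb hskew hleib hbr₁ hbr₂
    haa_lt haa_eq haa_gt hbb_lt hbb_eq hbb_gt hab_lt hab_eq hab_gt hba_lt hba_eq hba_gt
    (fun i => if i = 0 then 0 else contA e₂ a b i) (contB e₂ a b) (by simp) (by simp [contB])
    (by
      rintro (_ | i)
      · have h := ha 1 le_rfl hn
        have : e₂ * a 1 = a 1 := by rw [h]; simp only [← mul_assoc, he₂]
        simp [contA, contB, contPair, this]
      · simp [contA, contB, contPair])
    (by
      rintro (_ | i)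
      · simp [contA, contB, contPair, add_comm]
      · simp [contA, contB, contPair])
  refine ⟨?_, ?_, ?_, ?_, ?_⟩ <;> intro i j h1 h2 h3 h4 h5 <;>
    obtain ⟨-, k1, k2, k3, k4, -⟩ := key i h2
  · exact k1 j h3 h4 h5
  · exact k2 j h3 h4 h5
  · have := k3 j h3 h4 (by omega)
    rwa [if_neg (by omega), add_zero] at this
  · have := k3 j h3 h4 (by omega)
    rwa [if_pos h5.symm, if_neg (by omega)] at this
  · exact k4 j h3 h4 h5
end
end

section
/- With the data of the double bracket on the generators a₁,…,aₙ, b₁,…,bₙ described in the context, for all 1 ≤ i, j ≤ n the following hold, where (a₁,…,a_i) denotes the Euler continuant of the alternating sequence a₁,b₁,…,b_{i−1},a_i and (a₁,…,b_{i−1}) that of a₁,b₁,…,a_{i−1},b_{i−1} (with the convention that this is e₂ when i = 1): ⟨⟨(a₁,…,a_i), b_j⟩⟩ = (1/2)·(b_j(a₁,…,a_i)⊗e₂ + e₁⊗(a₁,…,a_i)b_j) if i < j; ⟨⟨(a₁,…,a_i), b_i⟩⟩ = (1/2)·(b_i(a₁,…,a_i)⊗e₂ + e₁⊗(a₁,…,a_i)b_i)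 + e₁⊗(a₁,…,b_{i−1}); and ⟨⟨(a₁,…,a_i), b_j⟩⟩ = (1/2)·(b_j(a₁,…,a_i)⊗e₂ − e₁⊗(a₁,…,a_i)b_j) if i > j. -/
open TensorProduct

noncomputable section

set_option linter.unusedSimpArgs false

/-- Auxiliary continuants with index shifted so that `A 0 = 0`, `B 0 = e₂`. -/
def auxP {A : Type*} [Ring A] (e₂ : A) (a b : ℕ → A) : ℕ → A × A
  | 0 => (0, e₂)
  | i + 1 =>
    ((auxP e₂ a b i).2 * a (i + 1) + (auxP e₂ a b i).1,
     ((auxP e₂ a b i).2 * a (i + 1) + (auxP e₂ a b i).1) * b (i + 1) + (auxP e₂ a b i).2)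

theorem contPair_eq_auxP {A : Type*} [Ring A] (e₂ : A) (a b : ℕ → A) (h : e₂ * a 1 = a 1)
    (i : ℕ) : contPair e₂ a b i = auxP e₂ a b (i + 1) := by
  induction i with
  | zero => simp [contPair, auxP, h, add_comm]
  | succ i ih => rw [contPair, ih]; rfl

/-- Lemma 4.3 of the paper: values of the double quasi-Poisson bracket of the odd Euler
continuants `(a₁,…,a_i)` against the generators `b_j`; here `(a₁,…,b_{i−1})` is `contB (i−1)`,
with the convention that it equals `e₂` when `i = 1`. -/
theorem bracket_odd_continuant_b {k : Type*} [Field k] [CharZero k]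
    {A : Type*} [Ring A] [Algebra k A]
    (n : ℕ) (hn : 1 ≤ n)
    (e₁ e₂ : A) (a b : ℕ → A)
    (br : A →ₗ[k] A →ₗ[k] A ⊗[k] A)
    (he₁ : e₁ * e₁ = e₁) (he₂ : e₂ * e₂ = e₂)
    (h12 : e₁ * e₂ = 0) (h21 : e₂ * e₁ = 0) (hsum : e₁ + e₂ = 1)
    (ha : ∀ i, 1 ≤ i → i ≤ n → a i = e₂ * a i * e₁)
    (hb : ∀ i, 1 ≤ i → i ≤ n → b i = e₁ * b i * e₂)
    (hskew : ∀ x y : A, br x y = - TensorProduct.comm k A A (br y x))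
    (hleib : ∀ x y z : A, br x (y * z) = br x y * (1 ⊗ₜ[k] z) + (y ⊗ₜ[k] 1) * br x z)
    (hbr₁ : ∀ x : A, br x e₁ = 0) (hbr₂ : ∀ x : A, br x e₂ = 0)
    (haa_lt : ∀ i j, 1 ≤ i → i ≤ n → 1 ≤ j → j ≤ n → i < j →
      br (a i) (a j) = -((2 : k)⁻¹ • (a i ⊗ₜ[k] a j + a j ⊗ₜ[k] a i)))
    (haa_eq : ∀ i, 1 ≤ i → i ≤ n → br (a i) (a i) = 0)
    (haa_gt : ∀ i j, 1 ≤ i → i ≤ n → 1 ≤ j → j ≤ n → j < i →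
      br (a i) (a j) = (2 : k)⁻¹ • (a i ⊗ₜ[k] a j + a j ⊗ₜ[k] a i))
    (hbb_lt : ∀ i j, 1 ≤ i → i ≤ n → 1 ≤ j → j ≤ n → i < j →
      br (b i) (b j) = -((2 : k)⁻¹ • (b i ⊗ₜ[k] b j + b j ⊗ₜ[k] b i)))
    (hbb_eq : ∀ i, 1 ≤ i → i ≤ n → br (b i) (b i) = 0)
    (hbb_gt : ∀ i j, 1 ≤ i → i ≤ n → 1 ≤ j → j ≤ n → j < i →
      br (b i) (b j) = (2 : k)⁻¹ • (b i ⊗ₜ[k] b j + b j ⊗ₜ[k] b i))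
    (hab_lt : ∀ i j, 1 ≤ i → i ≤ n → 1 ≤ j → j ≤ n → i < j →
      br (a i) (b j) = (2 : k)⁻¹ • (e₁ ⊗ₜ[k] (a i * b j) + (b j * a i) ⊗ₜ[k] e₂))
    (hab_eq : ∀ i, 1 ≤ i → i ≤ n →
      br (a i) (b i) =
        (2 : k)⁻¹ • ((b i * a i) ⊗ₜ[k] e₂ + e₁ ⊗ₜ[k] (a i * b i)) + e₁ ⊗ₜ[k] e₂)
    (hab_gt : ∀ i j, 1 ≤ i → i ≤ n → 1 ≤ j → j ≤ n → j < i →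
      br (a i) (b j) = -((2 : k)⁻¹ • ((b j * a i) ⊗ₜ[k] e₂ + e₁ ⊗ₜ[k] (a i * b j)))
        - (if i = j + 1 then e₁ ⊗ₜ[k] e₂ else 0))
    :
    (∀ i j, 1 ≤ i → i ≤ n → 1 ≤ j → j ≤ n → i < j →
        br (contA e₂ a b i) (b j) =
          (2 : k)⁻¹ • ((b j * contA e₂ a b i) ⊗ₜ[k] e₂ + e₁ ⊗ₜ[k] (contA e₂ a b i * b j))) ∧
    (∀ i, 1 ≤ i → i ≤ n →
        br (contA e₂ a b i) (b i) =
          (2 : k)⁻¹ • ((b i * contA e₂ a b i) ⊗ₜ[k] e₂ + e₁ ⊗ₜ[k] (contA e₂ a b i * b i)) +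
            e₁ ⊗ₜ[k] contB e₂ a b (i - 1)) ∧
    (∀ i j, 1 ≤ i → i ≤ n → 1 ≤ j → j ≤ n → j < i →
        br (contA e₂ a b i) (b j) =
          (2 : k)⁻¹ • ((b j * contA e₂ a b i) ⊗ₜ[k] e₂ - e₁ ⊗ₜ[k] (contA e₂ a b i * b j))) := by
  have hab1 : ∀ i, 1 ≤ i → i ≤ n → e₂ * a i = a i := by
    intro i h1 h2
    rw [ha i h1 h2, ← mul_assoc, ← mul_assoc, he₂]
  have hbl : ∀ i, 1 ≤ i → i ≤ n → e₁ * b i = b i := by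
    intro i h1 h2
    rw [hb i h1 h2, ← mul_assoc, ← mul_assoc, he₁]
  have hbr : ∀ i, 1 ≤ i → i ≤ n → b i * e₂ = b i := by
    intro i h1 h2
    rw [hb i h1 h2, mul_assoc, he₂]
  have hσ1 : ∀ (t : A ⊗[k] A) (z : A), TensorProduct.comm k A A (t * (1 ⊗ₜ[k] z)) =
      TensorProduct.comm k A A t * (z ⊗ₜ[k] 1) := by
    intro t z
    induction t with
    | zero => simp
    | tmul x y => simp
    | add x y hx hy => simp only [add_mul, map_add, hx, hy]
  have hσ2 : ∀ (t : A ⊗[k] A) (z : A), TensorProduct.comm k A A ((z ⊗ₜ[k] 1) * t) =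
      (1 ⊗ₜ[k] z) * TensorProduct.comm k A A t := by
    intro t z
    induction t with
    | zero => simp
    | tmul x y => simp
    | add x y hx hy => simp only [mul_add, map_add, hx, hy]
  have hL : ∀ x y z : A, br (y * z) x = br y x * (z ⊗ₜ[k] 1) + (1 ⊗ₜ[k] y) * br z x := by
    intro x y z
    rw [hskew (y * z) x, hleib, map_add, hσ1, hσ2, hskew y x, hskew z x]
    rw [neg_add, neg_mul, mul_neg]
  have hE2 : ∀ x, br e₂ x = 0 := by
    intro x
    rw [hskew, hbr₂]; simp
  have hBe : ∀ i, i ≤ n → (auxP e₂ a b i).2 * e₂ = (auxP e₂ a b i).2 := by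
    intro i
    induction i with
    | zero => intro _; exact he₂
    | succ i ih =>
      intro h
      simp only [auxP]
      rw [add_mul, ih (by omega), mul_assoc _ (b (i+1)), hbr (i+1) (by omega) h]
  have key : ∀ j, 1 ≤ j → j ≤ n → ∀ i, i ≤ n →
      (br (auxP e₂ a b i).1 (b j) =
        if i < j then (2 : k)⁻¹ • ((b j * (auxP e₂ a b i).1) ⊗ₜ[k] e₂
            + e₁ ⊗ₜ[k] ((auxP e₂ a b i).1 * b j))
        else if i = j then (2 : k)⁻¹ • ((b j * (auxP e₂ a b i).1) ⊗ₜ[k] e₂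
            + e₁ ⊗ₜ[k] ((auxP e₂ a b i).1 * b j)) + e₁ ⊗ₜ[k] (auxP e₂ a b (i-1)).2
        else (2 : k)⁻¹ • ((b j * (auxP e₂ a b i).1) ⊗ₜ[k] e₂
            - e₁ ⊗ₜ[k] ((auxP e₂ a b i).1 * b j))) ∧
      (br (auxP e₂ a b i).2 (b j) =
        if i < j then (2 : k)⁻¹ • ((b j * (auxP e₂ a b i).2) ⊗ₜ[k] e₂
            - b j ⊗ₜ[k] (auxP e₂ a b i).2)
        else (2 : k)⁻¹ • ((b j * (auxP e₂ a b i).2) ⊗ₜ[k] e₂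
            + b j ⊗ₜ[k] (auxP e₂ a b i).2)) := by
    intro j hj1 hjn i
    induction i with
    | zero =>
      intro _
      have : 0 < j := by omega
      simp [auxP, this, hE2, hbr j hj1 hjn]
    | succ i ih =>
      intro hi
      obtain ⟨ihA, ihB⟩ := ih (by omega)
      have hBi := hBe i (by omega)
      have hA1 : (auxP e₂ a b (i+1)).1 = (auxP e₂ a b i).2 * a (i+1) + (auxP e₂ a b i).1 := rfl
      have hB1 : (auxP e₂ a b (i+1)).2 =
        (auxP e₂ a b (i+1)).1 * b (i+1) + (auxP e₂ a b i).2 := rfl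
      have hB0 : 1 ≤ i → (auxP e₂ a b i).2 =
          (auxP e₂ a b i).1 * b i + (auxP e₂ a b (i-1)).2 := by
        intro h
        obtain ⟨m, rfl⟩ : ∃ m, i = m + 1 := ⟨i - 1, by omega⟩
        rfl
      have hbj := hbl (i+1) (by omega) hi
      have hbje := hbr j hj1 hjn
      have stepA : br (auxP e₂ a b (i+1)).1 (b j) =
        if i+1 < j then (2 : k)⁻¹ • ((b j * (auxP e₂ a b (i+1)).1) ⊗ₜ[k] e₂
            + e₁ ⊗ₜ[k] ((auxP e₂ a b (i+1)).1 * b j))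
        else if i+1 = j then (2 : k)⁻¹ • ((b j * (auxP e₂ a b (i+1)).1) ⊗ₜ[k] e₂
            + e₁ ⊗ₜ[k] ((auxP e₂ a b (i+1)).1 * b j)) + e₁ ⊗ₜ[k] (auxP e₂ a b i).2
        else (2 : k)⁻¹ • ((b j * (auxP e₂ a b (i+1)).1) ⊗ₜ[k] e₂
            - e₁ ⊗ₜ[k] ((auxP e₂ a b (i+1)).1 * b j)) := by
        rw [hA1]
        generalize (auxP e₂ a b i).2 = B at *
        generalize (auxP e₂ a b i).1 = C at *
        rw [map_add, LinearMap.add_apply, hL, ihA, ihB]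
        rcases lt_trichotomy (i+1) j with h | h | h
        · rw [if_pos h, if_pos (by omega), if_pos (by omega),
            hab_lt (i+1) j (by omega) hi hj1 hjn h]
          simp only [add_mul, mul_add, sub_mul, smul_mul_assoc, mul_smul_comm,
            Algebra.TensorProduct.tmul_mul_tmul, tmul_add, add_tmul, mul_one, one_mul, hBi,
            mul_assoc]
          module
        · subst h
          rw [if_neg (lt_irrefl (i+1)), if_pos rfl, if_pos (Nat.lt_succ_self i),
            if_pos (Nat.lt_succ_self i), hab_eq (i+1) (by omega) hi]
          simp only [add_mul, mul_add, sub_mul, smul_mul_assoc, mul_smul_comm,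
            Algebra.TensorProduct.tmul_mul_tmul, tmul_add, add_tmul, mul_one, one_mul, hBi,
            mul_assoc]
          module
        · rw [if_neg (by omega : ¬ i+1 < j), if_neg (by omega : ¬ i+1 = j),
            if_neg (by omega : ¬ i < j), if_neg (by omega : ¬ i < j),
            hab_gt (i+1) j (by omega) hi hj1 hjn h]
          by_cases hij : i = j
          · subst hij
            rw [if_pos rfl, if_pos rfl]
            have h0 := hB0 hj1
            have h0' : e₁ ⊗ₜ[k] B = e₁ ⊗ₜ[k] (C * b i) + e₁ ⊗ₜ[k] (auxP e₂ a b (i-1)).2 := by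
              rw [← tmul_add, ← h0]
            simp only [add_mul, mul_add, sub_mul, mul_sub, mul_neg, smul_mul_assoc, mul_smul_comm,
              Algebra.TensorProduct.tmul_mul_tmul, tmul_add, add_tmul, mul_one, one_mul, hBi,
              mul_assoc]
            rw [h0']
            module
          · rw [if_neg hij, if_neg (by omega)]
            simp only [add_mul, mul_add, sub_mul, mul_sub, mul_neg, smul_mul_assoc, mul_smul_comm,
              Algebra.TensorProduct.tmul_mul_tmul, tmul_add, add_tmul, mul_one, one_mul, hBi,
              mul_assoc]
            simp only [mul_zero]
            module
      refine ⟨stepA, ?_⟩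
      rw [hB1, map_add, LinearMap.add_apply, hL, stepA, ihB]
      generalize (auxP e₂ a b i).2 = B at *
      generalize (auxP e₂ a b (i+1)).1 = C at *
      rcases lt_trichotomy (i+1) j with h | h | h
      · rw [if_pos h, if_pos (by omega), if_pos (by omega),
          hbb_lt (i+1) j (by omega) hi hj1 hjn h]
        simp only [add_mul, mul_add, sub_mul, mul_sub, mul_neg, smul_mul_assoc, mul_smul_comm,
          Algebra.TensorProduct.tmul_mul_tmul, tmul_add, add_tmul, mul_one, one_mul, hbj,
          mul_assoc]
        module
      · subst h
        rw [if_neg (lt_irrefl (i+1)), if_pos rfl, if_pos (Nat.lt_succ_self i),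
          if_neg (lt_irrefl (i+1)), hbb_eq (i+1) (by omega) hi]
        simp only [add_mul, mul_add, sub_mul, mul_sub, mul_neg, smul_mul_assoc, mul_smul_comm,
          Algebra.TensorProduct.tmul_mul_tmul, tmul_add, add_tmul, mul_one, one_mul, hbj,
          mul_assoc, mul_zero]
        module
      · rw [if_neg (by omega : ¬ i+1 < j), if_neg (by omega : ¬ i+1 = j),
          if_neg (by omega : ¬ i < j), if_neg (by omega : ¬ i+1 < j),
          hbb_gt (i+1) j (by omega) hi hj1 hjn h]
        simp only [add_mul, mul_add, sub_mul, mul_sub, mul_neg, smul_mul_assoc, mul_smul_comm,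
          Algebra.TensorProduct.tmul_mul_tmul, tmul_add, add_tmul, mul_one, one_mul, hbj,
          mul_assoc]
        module
  have h11 := hab1 1 le_rfl hn
  have hcA : ∀ i, 1 ≤ i → contA e₂ a b i = (auxP e₂ a b i).1 := by
    intro i hi
    rw [contA, contPair_eq_auxP e₂ a b h11, Nat.sub_add_cancel hi]
  have hcB : ∀ i, contB e₂ a b i = (auxP e₂ a b i).2 := by
    intro i
    rw [contB]
    split_ifs with h
    · subst h; rfl
    · rw [contPair_eq_auxP e₂ a b h11, Nat.sub_add_cancel (by omega)]
  refine ⟨?_, ?_, ?_⟩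
  · intro i j hi hi' hj hj' h
    rw [hcA i hi, (key j hj hj' i hi').1, if_pos h]
  · intro i hi hi'
    rw [hcA i hi, hcB, (key i hi hi' i hi').1, if_neg (lt_irrefl _), if_pos rfl]
  · intro i j hi hi' hj hj' h
    rw [hcA i hi, (key j hj hj' i hi').1, if_neg (by omega), if_neg (by omega)]
end
end

section
/- With the data of the double bracket on the generators a₁,…,aₙ, b₁,…,bₙ described in the context, for all 1 ≤ i, j ≤ n the following hold, where (a₁,…,a_i) denotes the Euler continuant of the alternating sequence a₁,b₁,…,b_{i−1},a_i: if i ≥ j then ⟨⟨(a₁,…,a_i), a_j⟩⟩ = (1/2)·(a_j⊗(a₁,…,a_i) − (a₁,…,a_i)⊗a_j); and if i = j−1 with j ≠ 1 then ⟨⟨(a₁,…,a_i), a_j⟩⟩ = −(1/2)·(a_j⊗(a₁,…,a_i) + (a₁,…,a_i)⊗a_j). -/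
open TensorProduct

noncomputable section

theorem aux_core {k : Type*} [Field k] [CharZero k]
    {A : Type*} [Ring A] [Algebra k A]
    (n j : ℕ) (hj1 : 1 ≤ j) (hjn : j ≤ n)
    (e₁ e₂ : A) (a b P Q : ℕ → A)
    (D : A →ₗ[k] A ⊗[k] A)
    (hea : ∀ i, 1 ≤ i → i ≤ n → e₂ * a i = a i)
    (hPe : ∀ i, i ≤ n → P i * e₁ = P i)
    (hP0 : P 0 = 0) (hQ0 : Q 0 = e₂)
    (hP : ∀ i, P (i + 1) = Q i * a (i + 1) + P i)
    (hQ : ∀ i, Q (i + 1) = P (i + 1) * b (i + 1) + Q i)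
    (hleib : ∀ y z : A, D (y * z) = D y * (1 ⊗ₜ[k] z) + (y ⊗ₜ[k] 1) * D z)
    (hbr₂ : D e₂ = 0)
    (haa_lt : ∀ i, 1 ≤ i → i ≤ n → j < i →
      D (a i) = -((2 : k)⁻¹ • (a j ⊗ₜ[k] a i + a i ⊗ₜ[k] a j)))
    (haa_eq : D (a j) = 0)
    (haa_gt : ∀ i, 1 ≤ i → i ≤ n → i < j →
      D (a i) = (2 : k)⁻¹ • (a j ⊗ₜ[k] a i + a i ⊗ₜ[k] a j))
    (hab_lt : ∀ i, 1 ≤ i → i ≤ n → j < i →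
      D (b i) = (2 : k)⁻¹ • (e₁ ⊗ₜ[k] (a j * b i) + (b i * a j) ⊗ₜ[k] e₂))
    (hab_eq : D (b j) =
        (2 : k)⁻¹ • ((b j * a j) ⊗ₜ[k] e₂ + e₁ ⊗ₜ[k] (a j * b j)) + e₁ ⊗ₜ[k] e₂)
    (hab_gt : ∀ i, 1 ≤ i → i ≤ n → i < j →
      D (b i) = -((2 : k)⁻¹ • ((b i * a j) ⊗ₜ[k] e₂ + e₁ ⊗ₜ[k] (a j * b i)))
        - (if j = i + 1 then e₁ ⊗ₜ[k] e₂ else 0)) (i : ℕ) (hi : i ≤ n) :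
    (i < j → D (P i) = (2 : k)⁻¹ • (a j ⊗ₜ[k] P i + P i ⊗ₜ[k] a j)) ∧
    (i + 1 < j → D (Q i) = (2 : k)⁻¹ • (a j ⊗ₜ[k] Q i - (Q i * a j) ⊗ₜ[k] e₂)) ∧
    (i + 1 = j → D (Q i) = (2 : k)⁻¹ • (a j ⊗ₜ[k] Q i - (Q i * a j) ⊗ₜ[k] e₂)
        - P i ⊗ₜ[k] e₂) ∧
    (j ≤ i → D (P i) = (2 : k)⁻¹ • (a j ⊗ₜ[k] P i - P i ⊗ₜ[k] a j)) ∧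
    (j ≤ i → D (Q i) = (2 : k)⁻¹ • (a j ⊗ₜ[k] Q i + (Q i * a j) ⊗ₜ[k] e₂)) := by
  induction i with
  | zero =>
    refine ⟨fun _ => ?_, fun _ => ?_, fun _ => ?_, fun _ => by omega, fun _ => by omega⟩ <;>
    simp [hP0, hQ0, hbr₂, hea j hj1 hjn]
  | succ i ih =>
    obtain ⟨h1, h2, h3, h4, h5⟩ := ih (by omega)
    have e := hea (i + 1) (by omega) hi
    have pe := hPe (i + 1) hi
    have DP : D (P (i + 1)) = D (Q i) * (1 ⊗ₜ[k] a (i + 1)) + (Q i ⊗ₜ[k] 1) * D (a (i + 1))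
        + D (P i) := by rw [hP, map_add, hleib]
    have DQ : D (Q (i + 1)) = D (P (i + 1)) * (1 ⊗ₜ[k] b (i + 1))
        + (P (i + 1) ⊗ₜ[k] 1) * D (b (i + 1)) + D (Q i) := by
      conv_lhs => rw [hQ, map_add, hleib]
    rcases lt_trichotomy (i + 1) j with h | h | h
    · have c1 : D (P (i + 1)) = (2 : k)⁻¹ • (a j ⊗ₜ[k] P (i + 1) + P (i + 1) ⊗ₜ[k] a j) := by
        rw [DP, h1 (by omega), h2 h, haa_gt _ (by omega) hi h, hP]
        simp only [smul_add, smul_sub, add_mul, sub_mul, mul_add, mul_sub, smul_mul_assoc,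
          mul_smul_comm, Algebra.TensorProduct.tmul_mul_tmul, mul_one, one_mul,
          TensorProduct.tmul_add, TensorProduct.add_tmul, mul_assoc, e]
        module
      refine ⟨fun _ => c1, fun h' => ?_, fun h' => ?_, fun _ => by omega, fun _ => by omega⟩
      · rw [DQ, c1, h2 h, hab_gt _ (by omega) hi h, if_neg (by omega), hQ]
        simp only [smul_add, smul_sub, add_mul, sub_mul, mul_add, mul_sub, smul_mul_assoc,
          mul_smul_comm, Algebra.TensorProduct.tmul_mul_tmul, mul_one, one_mul, mul_neg,
          TensorProduct.tmul_add, TensorProduct.add_tmul, mul_assoc, pe, mul_zero]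
        module
      · rw [DQ, c1, h2 h, hab_gt _ (by omega) hi h, if_pos (by omega), hQ]
        simp only [smul_add, smul_sub, add_mul, sub_mul, mul_add, mul_sub, smul_mul_assoc,
          mul_smul_comm, Algebra.TensorProduct.tmul_mul_tmul, mul_one, one_mul, mul_neg,
          TensorProduct.tmul_add, TensorProduct.add_tmul, mul_assoc, pe, mul_zero]
        module
    · subst h
      have c1 : D (P (i + 1)) = (2 : k)⁻¹ •
          (a (i + 1) ⊗ₜ[k] P (i + 1) - P (i + 1) ⊗ₜ[k] a (i + 1)) := by
        rw [DP, h1 (by omega), h3 rfl, haa_eq, hP]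
        simp only [smul_add, smul_sub, add_mul, sub_mul, mul_add, mul_sub, smul_mul_assoc,
          mul_smul_comm, Algebra.TensorProduct.tmul_mul_tmul, mul_one, one_mul, mul_zero,
          TensorProduct.tmul_add, TensorProduct.add_tmul, mul_assoc, e]
        module
      refine ⟨fun _ => by omega, fun h' => by omega, fun h' => by omega, fun _ => c1,
        fun _ => ?_⟩
      rw [DQ, c1, h3 rfl, hab_eq, hQ]
      have hPt : P (i + 1) ⊗ₜ[k] e₂ = (Q i * a (i + 1)) ⊗ₜ[k] e₂ + P i ⊗ₜ[k] e₂ := by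
        rw [hP, TensorProduct.add_tmul]
      simp only [smul_add, smul_sub, add_mul, sub_mul, mul_add, mul_sub, smul_mul_assoc,
          mul_smul_comm, Algebra.TensorProduct.tmul_mul_tmul, mul_one, one_mul, mul_neg,
          TensorProduct.tmul_add, TensorProduct.add_tmul, mul_assoc, pe, mul_zero]
      rw [hPt]
      module
    · have c1 : D (P (i + 1)) = (2 : k)⁻¹ • (a j ⊗ₜ[k] P (i + 1) - P (i + 1) ⊗ₜ[k] a j) := by
        rw [DP, h4 (by omega), h5 (by omega), haa_lt _ (by omega) hi h, hP]
        simp only [smul_add, smul_sub, add_mul, sub_mul, mul_add, mul_sub, smul_mul_assoc,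
          mul_smul_comm, Algebra.TensorProduct.tmul_mul_tmul, mul_one, one_mul, mul_neg,
          TensorProduct.tmul_add, TensorProduct.add_tmul, mul_assoc, e]
        module
      refine ⟨fun _ => by omega, fun h' => by omega, fun h' => by omega, fun _ => c1,
        fun _ => ?_⟩
      rw [DQ, c1, h5 (by omega), hab_lt _ (by omega) hi h, hQ]
      simp only [smul_add, smul_sub, add_mul, sub_mul, mul_add, mul_sub, smul_mul_assoc,
          mul_smul_comm, Algebra.TensorProduct.tmul_mul_tmul, mul_one, one_mul, mul_neg,
          TensorProduct.tmul_add, TensorProduct.add_tmul, mul_assoc, pe, mul_zero]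
      module

/-- Lemma 4.4 of the paper: values of the double quasi-Poisson bracket of the odd Euler
continuants `(a₁,…,a_i)` against the generators `a_j`. -/
theorem bracket_odd_continuant_a {k : Type*} [Field k] [CharZero k]
    {A : Type*} [Ring A] [Algebra k A]
    (n : ℕ) (hn : 1 ≤ n)
    (e₁ e₂ : A) (a b : ℕ → A)
    (br : A →ₗ[k] A →ₗ[k] A ⊗[k] A)
    (he₁ : e₁ * e₁ = e₁) (he₂ : e₂ * e₂ = e₂)
    (h12 : e₁ * e₂ = 0) (h21 : e₂ * e₁ = 0) (hsum : e₁ + e₂ = 1)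
    (ha : ∀ i, 1 ≤ i → i ≤ n → a i = e₂ * a i * e₁)
    (hb : ∀ i, 1 ≤ i → i ≤ n → b i = e₁ * b i * e₂)
    (hskew : ∀ x y : A, br x y = - TensorProduct.comm k A A (br y x))
    (hleib : ∀ x y z : A, br x (y * z) = br x y * (1 ⊗ₜ[k] z) + (y ⊗ₜ[k] 1) * br x z)
    (hbr₁ : ∀ x : A, br x e₁ = 0) (hbr₂ : ∀ x : A, br x e₂ = 0)
    (haa_lt : ∀ i j, 1 ≤ i → i ≤ n → 1 ≤ j → j ≤ n → i < j →
      br (a i) (a j) = -((2 : k)⁻¹ • (a i ⊗ₜ[k] a j + a j ⊗ₜ[k] a i)))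
    (haa_eq : ∀ i, 1 ≤ i → i ≤ n → br (a i) (a i) = 0)
    (haa_gt : ∀ i j, 1 ≤ i → i ≤ n → 1 ≤ j → j ≤ n → j < i →
      br (a i) (a j) = (2 : k)⁻¹ • (a i ⊗ₜ[k] a j + a j ⊗ₜ[k] a i))
    (hbb_lt : ∀ i j, 1 ≤ i → i ≤ n → 1 ≤ j → j ≤ n → i < j →
      br (b i) (b j) = -((2 : k)⁻¹ • (b i ⊗ₜ[k] b j + b j ⊗ₜ[k] b i)))
    (hbb_eq : ∀ i, 1 ≤ i → i ≤ n → br (b i) (b i) = 0)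
    (hbb_gt : ∀ i j, 1 ≤ i → i ≤ n → 1 ≤ j → j ≤ n → j < i →
      br (b i) (b j) = (2 : k)⁻¹ • (b i ⊗ₜ[k] b j + b j ⊗ₜ[k] b i))
    (hab_lt : ∀ i j, 1 ≤ i → i ≤ n → 1 ≤ j → j ≤ n → i < j →
      br (a i) (b j) = (2 : k)⁻¹ • (e₁ ⊗ₜ[k] (a i * b j) + (b j * a i) ⊗ₜ[k] e₂))
    (hab_eq : ∀ i, 1 ≤ i → i ≤ n →
      br (a i) (b i) =
        (2 : k)⁻¹ • ((b i * a i) ⊗ₜ[k] e₂ + e₁ ⊗ₜ[k] (a i * b i)) + e₁ ⊗ₜ[k] e₂)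
    (hab_gt : ∀ i j, 1 ≤ i → i ≤ n → 1 ≤ j → j ≤ n → j < i →
      br (a i) (b j) = -((2 : k)⁻¹ • ((b j * a i) ⊗ₜ[k] e₂ + e₁ ⊗ₜ[k] (a i * b j)))
        - (if i = j + 1 then e₁ ⊗ₜ[k] e₂ else 0))
    :
    (∀ i j, 1 ≤ i → i ≤ n → 1 ≤ j → j ≤ n → j ≤ i →
        br (contA e₂ a b i) (a j) =
          (2 : k)⁻¹ • (a j ⊗ₜ[k] contA e₂ a b i - contA e₂ a b i ⊗ₜ[k] a j)) ∧
    (∀ i j, 1 ≤ i → i ≤ n → 1 ≤ j → j ≤ n → i + 1 = j →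
        br (contA e₂ a b i) (a j) =
          -((2 : k)⁻¹ • (a j ⊗ₜ[k] contA e₂ a b i + contA e₂ a b i ⊗ₜ[k] a j))) := by
  have ea : ∀ i, 1 ≤ i → i ≤ n → e₂ * a i = a i := fun i h h' => by
    rw [ha i h h', ← mul_assoc, ← mul_assoc, he₂]
  have ae : ∀ i, 1 ≤ i → i ≤ n → a i * e₁ = a i := fun i h h' => by
    rw [ha i h h', mul_assoc, he₁]
  let P : ℕ → A := fun i => if i = 0 then 0 else contA e₂ a b i
  have hPc : ∀ i, 1 ≤ i → P i = contA e₂ a b i := fun i h => if_neg (by omega)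
  have hP0 : P 0 = 0 := if_pos rfl
  have hQ0 : contB e₂ a b 0 = e₂ := if_pos rfl
  have ha1 : e₂ * a 1 = a 1 := ea 1 le_rfl hn
  have hP : ∀ i, P (i + 1) = contB e₂ a b i * a (i + 1) + P i := by
    intro i
    rcases i with _ | i
    · rw [hP0, hQ0, hPc _ le_rfl]; simp [contA, contPair, ha1]
    · rw [hPc _ (by omega), hPc _ (by omega)]; simp [contA, contB, contPair]
  have hQ : ∀ i, contB e₂ a b (i + 1) = P (i + 1) * b (i + 1) + contB e₂ a b i := by
    intro i
    rcases i with _ | i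
    · rw [hQ0, hPc _ le_rfl]; simp [contA, contB, contPair, add_comm]
    · rw [hPc _ (by omega)]; simp [contA, contB, contPair]
  have hPe : ∀ i, i ≤ n → P i * e₁ = P i := by
    intro i
    induction i with
    | zero => intro _; rw [hP0, zero_mul]
    | succ i ih =>
      intro h
      rw [hP, add_mul, mul_assoc, ae _ (by omega) h, ih (by omega)]
  have key := fun j hj1 hjn => aux_core (k := k) n j hj1 hjn e₁ e₂ a b P (contB e₂ a b) (br (a j))
    ea hPe hP0 hQ0 hP hQ (hleib _) (hbr₂ _) (fun i h h' => haa_lt j i hj1 hjn h h')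
    (haa_eq j hj1 hjn) (fun i h h' => haa_gt j i hj1 hjn h h')
    (fun i h h' => hab_lt j i hj1 hjn h h') (hab_eq j hj1 hjn)
    (fun i h h' => hab_gt j i hj1 hjn h h')
  constructor
  · intro i j hi hi' hj hj' h
    have := (key j hj hj' i hi').2.2.2.1 h
    rw [hPc i hi] at this
    rw [hskew, this]
    simp only [map_smul, map_sub, TensorProduct.comm_tmul]
    module
  · intro i j hi hi' hj hj' h
    have := (key j hj hj' i hi').1 (by omega)
    rw [hPc i hi] at this
    rw [hskew, this]
    simp only [map_smul, map_add, TensorProduct.comm_tmul]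
    module
end
end

section
/- With the data of the double bracket on the generators a₁,…,aₙ, b₁,…,bₙ described in the context, assume in addition that for every m = 1,…,n−1 the continuant (a₁,…,b_m) of the alternating sequence a₁,b₁,…,a_m,b_m has a two-sided inverse (a₁,…,b_m)^{−1} ∈ e₂Ae₂, i.e. (a₁,…,b_m)^{−1}(a₁,…,b_m) = (a₁,…,b_m)(a₁,…,b_m)^{−1} = e₂. Define a′₁ := a₁ and a′_i := a_i + (a₁,…,b_{i−1})^{−1}·(a₁,…,a_{i−1}) for 2 ≤ i ≤ n, where (a₁,…,a_{i−1}) is the continuant of a₁,b₁,…,b_{i−2},a_{i−1}. Then for i > j one has ⟨⟨a′_i, a_j⟩⟩ = (1/2)·(a′_i⊗a_j + a_j⊗a′_i), and for every j one has ⟨⟨a′_j, a_j⟩⟩ = (1/2)·(a′_j⊗a_j + a_j⊗a′_j) − a′_j⊗a′_j. -/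
open TensorProduct

noncomputable section

set_option linter.unusedSimpArgs false

/-- Zero-extended odd continuant. -/
def cP {A : Type*} [Ring A] (e₂ : A) (a b : ℕ → A) (i : ℕ) : A :=
  if i = 0 then 0 else contA e₂ a b i

theorem cP_succ {A : Type*} [Ring A] (e₂ : A) (a b : ℕ → A) (h : e₂ * a 1 = a 1) (i : ℕ) :
    cP e₂ a b (i + 1) = contB e₂ a b i * a (i + 1) + cP e₂ a b i := by
  cases i with
  | zero => simp [cP, contA, contB, contPair, h]
  | succ i => simp [cP, contA, contB, contPair]

theorem contB_succ {A : Type*} [Ring A] (e₂ : A) (a b : ℕ → A) (i : ℕ) :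
    contB e₂ a b (i + 1) = cP e₂ a b (i + 1) * b (i + 1) + contB e₂ a b i := by
  cases i with
  | zero => simp [cP, contA, contB, contPair, add_comm]
  | succ i => simp [cP, contA, contB, contPair]

/-- The inverse rule for a derivation into the outer bimodule. -/
theorem outerDer_inv {k : Type*} [Field k] {A : Type*} [Ring A] [Algebra k A]
    (D : A →ₗ[k] A ⊗[k] A) (e Q w : A)
    (hD : ∀ y z : A, D (y * z) = D y * (1 ⊗ₜ[k] z) + (y ⊗ₜ[k] 1) * D z)
    (he : D e = 0) (hwe : w * e = w) (h1 : w * Q = e) (h2 : Q * w = e) :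
    D w = -((w ⊗ₜ[k] 1) * D Q * (1 ⊗ₜ[k] w)) := by
  have h3 : D w * (1 ⊗ₜ[k] Q) + (w ⊗ₜ[k] 1) * D Q = 0 := by rw [← hD, h1, he]
  have h4 : D w * (1 ⊗ₜ[k] e) = D w := by
    conv_rhs => rw [← hwe, hD, he, mul_zero, add_zero]
  have h5 := congrArg (fun t => t * ((1 : A) ⊗ₜ[k] w)) h3
  simp only [add_mul, zero_mul] at h5
  rw [mul_assoc (D w), Algebra.TensorProduct.tmul_mul_tmul, one_mul, h2, h4] at h5
  exact eq_neg_of_add_eq_zero_left h5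

/-- Lemma 5.7 (prep-4) of the paper: with `a′₁ = a₁` and
`a′_i = a_i + (a₁,…,b_{i−1})⁻¹·(a₁,…,a_{i−1})` for `2 ≤ i ≤ n`, where
`(a₁,…,b_m)⁻¹ = w m ∈ e₂Ae₂` is a two-sided inverse of `(a₁,…,b_m)`, one has
`⟨⟨a′_i, a_j⟩⟩ = (1/2)·(a′_i⊗a_j + a_j⊗a′_i)` for `i > j`, and
`⟨⟨a′_j, a_j⟩⟩ = (1/2)·(a′_j⊗a_j + a_j⊗a′_j) − a′_j⊗a′_j`. -/
theorem bracket_primed_generators {k : Type*} [Field k] [CharZero k]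
    {A : Type*} [Ring A] [Algebra k A]
    (n : ℕ) (hn : 1 ≤ n)
    (e₁ e₂ : A) (a b : ℕ → A)
    (br : A →ₗ[k] A →ₗ[k] A ⊗[k] A)
    (he₁ : e₁ * e₁ = e₁) (he₂ : e₂ * e₂ = e₂)
    (h12 : e₁ * e₂ = 0) (h21 : e₂ * e₁ = 0) (hsum : e₁ + e₂ = 1)
    (ha : ∀ i, 1 ≤ i → i ≤ n → a i = e₂ * a i * e₁)
    (hb : ∀ i, 1 ≤ i → i ≤ n → b i = e₁ * b i * e₂)
    (hskew : ∀ x y : A, br x y = - TensorProduct.comm k A A (br y x))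
    (hleib : ∀ x y z : A, br x (y * z) = br x y * (1 ⊗ₜ[k] z) + (y ⊗ₜ[k] 1) * br x z)
    (hbr₁ : ∀ x : A, br x e₁ = 0) (hbr₂ : ∀ x : A, br x e₂ = 0)
    (haa_lt : ∀ i j, 1 ≤ i → i ≤ n → 1 ≤ j → j ≤ n → i < j →
      br (a i) (a j) = -((2 : k)⁻¹ • (a i ⊗ₜ[k] a j + a j ⊗ₜ[k] a i)))
    (haa_eq : ∀ i, 1 ≤ i → i ≤ n → br (a i) (a i) = 0)
    (haa_gt : ∀ i j, 1 ≤ i → i ≤ n → 1 ≤ j → j ≤ n → j < i →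
      br (a i) (a j) = (2 : k)⁻¹ • (a i ⊗ₜ[k] a j + a j ⊗ₜ[k] a i))
    (hbb_lt : ∀ i j, 1 ≤ i → i ≤ n → 1 ≤ j → j ≤ n → i < j →
      br (b i) (b j) = -((2 : k)⁻¹ • (b i ⊗ₜ[k] b j + b j ⊗ₜ[k] b i)))
    (hbb_eq : ∀ i, 1 ≤ i → i ≤ n → br (b i) (b i) = 0)
    (hbb_gt : ∀ i j, 1 ≤ i → i ≤ n → 1 ≤ j → j ≤ n → j < i →
      br (b i) (b j) = (2 : k)⁻¹ • (b i ⊗ₜ[k] b j + b j ⊗ₜ[k] b i))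
    (hab_lt : ∀ i j, 1 ≤ i → i ≤ n → 1 ≤ j → j ≤ n → i < j →
      br (a i) (b j) = (2 : k)⁻¹ • (e₁ ⊗ₜ[k] (a i * b j) + (b j * a i) ⊗ₜ[k] e₂))
    (hab_eq : ∀ i, 1 ≤ i → i ≤ n →
      br (a i) (b i) =
        (2 : k)⁻¹ • ((b i * a i) ⊗ₜ[k] e₂ + e₁ ⊗ₜ[k] (a i * b i)) + e₁ ⊗ₜ[k] e₂)
    (hab_gt : ∀ i j, 1 ≤ i → i ≤ n → 1 ≤ j → j ≤ n → j < i →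
      br (a i) (b j) = -((2 : k)⁻¹ • ((b j * a i) ⊗ₜ[k] e₂ + e₁ ⊗ₜ[k] (a i * b j)))
        - (if i = j + 1 then e₁ ⊗ₜ[k] e₂ else 0))
    (w : ℕ → A)
    (hw_mem : ∀ m, 1 ≤ m → m ≤ n - 1 → w m = e₂ * w m * e₂)
    (hw_inv : ∀ m, 1 ≤ m → m ≤ n - 1 →
      w m * contB e₂ a b m = e₂ ∧ contB e₂ a b m * w m = e₂)
    (a' : ℕ → A)
    (ha'₁ : a' 1 = a 1)
    (ha' : ∀ i, 2 ≤ i → i ≤ n → a' i = a i + w (i - 1) * contA e₂ a b (i - 1)) :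
    (∀ i j, 1 ≤ j → j < i → i ≤ n →
        br (a' i) (a j) = (2 : k)⁻¹ • (a' i ⊗ₜ[k] a j + a j ⊗ₜ[k] a' i)) ∧
    (∀ j, 1 ≤ j → j ≤ n →
        br (a' j) (a j) =
          (2 : k)⁻¹ • (a' j ⊗ₜ[k] a j + a j ⊗ₜ[k] a' j) - a' j ⊗ₜ[k] a' j) := by
  have hae1 : ∀ i, 1 ≤ i → i ≤ n → a i * e₁ = a i := fun i h h' => by
    rw [ha i h h', mul_assoc, he₁]
  have hae2 : ∀ i, 1 ≤ i → i ≤ n → e₂ * a i = a i := fun i h h' => by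
    rw [ha i h h', ← mul_assoc, ← mul_assoc, he₂]
  have hbe2 : ∀ i, 1 ≤ i → i ≤ n → b i * e₂ = b i := fun i h h' => by
    rw [hb i h h', mul_assoc, he₂]
  set P := cP e₂ a b with hP
  set Q := contB e₂ a b with hQ
  have P0 : P 0 = 0 := by simp [hP, cP]
  have Q0 : Q 0 = e₂ := by simp [hQ, contB]
  have PS : ∀ i, P (i + 1) = Q i * a (i + 1) + P i := cP_succ e₂ a b (hae2 1 le_rfl hn)
  have QS : ∀ i, Q (i + 1) = P (i + 1) * b (i + 1) + Q i := contB_succ e₂ a b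
  have hPQ : ∀ i, i ≤ n → P i * e₁ = P i ∧ Q i * e₂ = Q i := by
    intro i
    induction i with
    | zero => intro _; simp [P0, Q0, he₂]
    | succ i ih =>
      intro h
      obtain ⟨h1, h2⟩ := ih (by omega)
      constructor
      · rw [PS, add_mul, mul_assoc, hae1 _ (by omega) h, h1]
      · rw [QS, add_mul, mul_assoc, hbe2 _ (by omega) h, h2]
  have hPe : ∀ i, i ≤ n → P i * e₁ = P i := fun i h => (hPQ i h).1
  have hQe : ∀ i, i ≤ n → Q i * e₂ = Q i := fun i h => (hPQ i h).2
  have hPQl : ∀ i, i ≤ n → e₂ * P i = P i ∧ e₂ * Q i = Q i := by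
    intro i
    induction i with
    | zero => intro _; simp [P0, Q0, he₂]
    | succ i ih =>
      intro h
      obtain ⟨h1, h2⟩ := ih (by omega)
      have h3 : e₂ * P (i + 1) = P (i + 1) := by rw [PS, mul_add, ← mul_assoc, h2, h1]
      exact ⟨h3, by rw [QS, mul_add, ← mul_assoc, h3, h2]⟩
  -- below j
  have low : ∀ j, 1 ≤ j → j ≤ n → ∀ i, i + 1 < j →
      br (a j) (P i) = (2 : k)⁻¹ • (a j ⊗ₜ[k] P i + P i ⊗ₜ[k] a j) ∧
      br (a j) (Q i) = (2 : k)⁻¹ • (a j ⊗ₜ[k] Q i - (Q i * a j) ⊗ₜ[k] e₂) := by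
    intro j hj hjn i
    induction i with
    | zero => intro _; simp [P0, Q0, hbr₂, hae2 j hj hjn]
    | succ i ih =>
      intro h
      obtain ⟨h1, h2⟩ := ih (by omega)
      have h3 : br (a j) (P (i + 1)) =
          (2 : k)⁻¹ • (a j ⊗ₜ[k] P (i + 1) + P (i + 1) ⊗ₜ[k] a j) := by
        rw [PS, map_add, hleib, h1, h2, haa_gt j (i + 1) hj hjn (by omega) (by omega) (by omega)]
        simp only [smul_mul_assoc, mul_smul_comm, add_mul, mul_add, sub_mul, mul_neg,
          Algebra.TensorProduct.tmul_mul_tmul, one_mul, mul_one, add_tmul, tmul_add, mul_assoc,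
          hae2 (i + 1) (by omega) (by omega)]
        module
      refine ⟨h3, ?_⟩
      rw [QS, map_add, hleib, h3, h2, hab_gt j (i + 1) hj hjn (by omega) (by omega) (by omega),
        if_neg (by omega)]
      simp only [smul_mul_assoc, mul_smul_comm, add_mul, mul_add, sub_mul, mul_neg, sub_zero,
          Algebra.TensorProduct.tmul_mul_tmul, one_mul, mul_one, add_tmul, tmul_add,
          ← mul_assoc, hPe (i + 1) (by omega)]
      module
  -- at Q (j-1)
  have mid : ∀ j, j + 1 ≤ n →
      br (a (j + 1)) (P j) = (2 : k)⁻¹ • (a (j + 1) ⊗ₜ[k] P j + P j ⊗ₜ[k] a (j + 1)) ∧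
      br (a (j + 1)) (Q j) = (2 : k)⁻¹ • (a (j + 1) ⊗ₜ[k] Q j - (Q j * a (j + 1)) ⊗ₜ[k] e₂)
        - P j ⊗ₜ[k] e₂ := by
    intro j hj
    cases j with
    | zero => simp [P0, Q0, hbr₂, hae2 1 le_rfl hn]
    | succ i =>
      obtain ⟨h1, h2⟩ := low (i + 1 + 1) (by omega) hj i (by omega)
      have h3 : br (a (i + 1 + 1)) (P (i + 1)) =
          (2 : k)⁻¹ • (a (i + 1 + 1) ⊗ₜ[k] P (i + 1) + P (i + 1) ⊗ₜ[k] a (i + 1 + 1)) := by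
        rw [PS, map_add, hleib, h1, h2,
          haa_gt (i + 1 + 1) (i + 1) (by omega) hj (by omega) (by omega) (by omega)]
        simp only [smul_mul_assoc, mul_smul_comm, add_mul, mul_add, sub_mul, mul_neg,
          Algebra.TensorProduct.tmul_mul_tmul, one_mul, mul_one, add_tmul, tmul_add, mul_assoc,
          hae2 (i + 1) (by omega) (by omega)]
        module
      refine ⟨h3, ?_⟩
      rw [QS, map_add, hleib, h3, h2,
        hab_gt (i + 1 + 1) (i + 1) (by omega) hj (by omega) (by omega) (by omega),
        if_pos rfl]
      simp only [smul_mul_assoc, mul_smul_comm, add_mul, mul_add, sub_mul, mul_sub, mul_neg,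
          Algebra.TensorProduct.tmul_mul_tmul, one_mul, mul_one, add_tmul, tmul_add,
          ← mul_assoc, hPe (i + 1) (by omega)]
      module
  have diagP : ∀ j, j + 1 ≤ n → br (a (j + 1)) (P (j + 1)) =
      (2 : k)⁻¹ • (a (j + 1) ⊗ₜ[k] P (j + 1) - P (j + 1) ⊗ₜ[k] a (j + 1)) := by
    intro j hj
    obtain ⟨h1, h2⟩ := mid j hj
    rw [PS, map_add, hleib, h1, h2, haa_eq (j + 1) (by omega) hj]
    simp only [smul_mul_assoc, mul_smul_comm, add_mul, mul_add, sub_mul, mul_sub, mul_neg,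
      mul_zero, Algebra.TensorProduct.tmul_mul_tmul, one_mul, mul_one, add_tmul, tmul_add,
      mul_assoc, hae2 (j + 1) (by omega) (by omega)]
    module
  have high : ∀ j, j + 1 ≤ n → ∀ i, j + 1 + i ≤ n →
      br (a (j + 1)) (P (j + 1 + i)) =
        (2 : k)⁻¹ • (a (j + 1) ⊗ₜ[k] P (j + 1 + i) - P (j + 1 + i) ⊗ₜ[k] a (j + 1)) ∧
      br (a (j + 1)) (Q (j + 1 + i)) =
        (2 : k)⁻¹ • (a (j + 1) ⊗ₜ[k] Q (j + 1 + i) + (Q (j + 1 + i) * a (j + 1)) ⊗ₜ[k] e₂) := by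
    intro j hj i
    induction i with
    | zero =>
      intro _
      rw [add_zero]
      refine ⟨diagP j hj, ?_⟩
      have h5 : (P (j + 1)) ⊗ₜ[k] e₂ = (Q j * a (j + 1)) ⊗ₜ[k] e₂ + P j ⊗ₜ[k] e₂ := by
        rw [PS, add_tmul]
      rw [QS, map_add, hleib, diagP j hj, (mid j hj).2, hab_eq (j + 1) (by omega) hj]
      simp only [smul_mul_assoc, mul_smul_comm, add_mul, mul_add, sub_mul, mul_sub, mul_neg,
        Algebra.TensorProduct.tmul_mul_tmul, one_mul, mul_one, add_tmul, tmul_add,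
        ← mul_assoc, hPe (j + 1) hj, h5]
      module
    | succ i ih =>
      intro h
      rw [← add_assoc] at h ⊢
      obtain ⟨h1, h2⟩ := ih (by omega)
      have h3 : br (a (j + 1)) (P (j + 1 + i + 1)) =
          (2 : k)⁻¹ • (a (j + 1) ⊗ₜ[k] P (j + 1 + i + 1)
            - P (j + 1 + i + 1) ⊗ₜ[k] a (j + 1)) := by
        rw [PS, map_add, hleib, h1, h2,
          haa_lt (j + 1) (j + 1 + i + 1) (by omega) hj (by omega) (by omega) (by omega)]
        simp only [smul_mul_assoc, mul_smul_comm, add_mul, mul_add, sub_mul, mul_neg,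
          Algebra.TensorProduct.tmul_mul_tmul, one_mul, mul_one, add_tmul, tmul_add, mul_assoc,
          hae2 (j + 1 + i + 1) (by omega) (by omega)]
        module
      refine ⟨h3, ?_⟩
      rw [QS, map_add, hleib, h3, h2,
        hab_lt (j + 1) (j + 1 + i + 1) (by omega) hj (by omega) (by omega) (by omega)]
      simp only [smul_mul_assoc, mul_smul_comm, add_mul, mul_add, sub_mul, mul_sub, mul_neg,
          Algebra.TensorProduct.tmul_mul_tmul, one_mul, mul_one, add_tmul, tmul_add,
          ← mul_assoc, hPe (j + 1 + i + 1) (by omega)]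
      module
  -- inverses, including index zero
  have hinv : ∀ i, i + 1 ≤ n → ∃ v, v * e₂ = v ∧ v * Q i = e₂ ∧ Q i * v = e₂ ∧
      a' (i + 1) = v * P (i + 1) ∧ a' (i + 1) = a (i + 1) + v * P i := by
    intro i hi
    cases i with
    | zero =>
      refine ⟨e₂, he₂, by rw [Q0, he₂], by rw [Q0, he₂], ?_, ?_⟩
      · rw [PS, P0, Q0, add_zero, ← mul_assoc, he₂, hae2 1 le_rfl hn, ha'₁]
      · rw [P0, mul_zero, add_zero, ha'₁]
    | succ i =>
      obtain ⟨h1, h2⟩ := hw_inv (i + 1) (by omega) (by omega)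
      have h3 : a' (i + 1 + 1) = a (i + 1 + 1) + w (i + 1) * P (i + 1) := by
        rw [ha' (i + 1 + 1) (by omega) hi]
        simp [hP, cP]
      refine ⟨w (i + 1), ?_, h1, h2, ?_, h3⟩
      · rw [hw_mem (i + 1) (by omega) (by omega), mul_assoc, he₂]
      · rw [h3, PS (i + 1), mul_add, ← mul_assoc, h1, hae2 _ (by omega) hi]
  constructor
  · intro i j hj hji hi
    obtain ⟨j, rfl⟩ : ∃ j', j = j' + 1 := ⟨j - 1, by omega⟩
    obtain ⟨d, rfl⟩ : ∃ d, i = j + 1 + d + 1 := ⟨i - j - 2, by omega⟩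
    obtain ⟨v, hv, h1, h2, h3, -⟩ := hinv (j + 1 + d) hi
    have hDQ := (high j (by omega) d (by omega)).2
    have hDP := (high j (by omega) (d + 1) (by omega)).1
    rw [← add_assoc] at hDP
    have hDv := outerDer_inv (br (a (j + 1))) e₂ _ v (hleib _) (hbr₂ _) hv h1 h2
    have key : br (a (j + 1)) (a' (j + 1 + d + 1)) = -((2 : k)⁻¹ •
        (a' (j + 1 + d + 1) ⊗ₜ[k] a (j + 1) + a (j + 1) ⊗ₜ[k] a' (j + 1 + d + 1))) := by
      have h6 : v * (Q (j + 1 + d) * a (j + 1)) = a (j + 1) := by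
        rw [← mul_assoc, h1, hae2 _ (by omega) (by omega)]
      have h7 : e₂ * (v * P (j + 1 + d + 1)) = v * P (j + 1 + d + 1) := by
        rw [← mul_assoc, ← h1, mul_assoc v, h2, hv]
      have h8 : Q (j + 1 + d) * (v * P (j + 1 + d + 1)) = P (j + 1 + d + 1) := by
        rw [← mul_assoc, h2, (hPQl _ hi).1]
      rw [h3, hleib, hDv, hDQ, hDP]
      simp only [smul_mul_assoc, mul_smul_comm, add_mul, mul_add, sub_mul, mul_sub, mul_neg,
        neg_mul, Algebra.TensorProduct.tmul_mul_tmul, one_mul, mul_one, mul_assoc, h6, h7, h8]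
      module
    rw [hskew, key]
    simp only [map_neg, map_smul, map_add, TensorProduct.comm_tmul, neg_neg]
    module
  · intro j hj hjn
    obtain ⟨j, rfl⟩ : ∃ j', j = j' + 1 := ⟨j - 1, by omega⟩
    obtain ⟨v, hv, h1, h2, h3, h4⟩ := hinv j hjn
    have hDQ := (mid j hjn).2
    have hDP := diagP j hjn
    have hDv := outerDer_inv (br (a (j + 1))) e₂ _ v (hleib _) (hbr₂ _) hv h1 h2
    have key : br (a (j + 1)) (a' (j + 1)) = -((2 : k)⁻¹ •
        (a' (j + 1) ⊗ₜ[k] a (j + 1) + a (j + 1) ⊗ₜ[k] a' (j + 1)))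
        + a' (j + 1) ⊗ₜ[k] a' (j + 1) := by
      have h6 : v * (Q j * a (j + 1)) = a (j + 1) := by
        rw [← mul_assoc, h1, hae2 _ (by omega) (by omega)]
      have h7 : e₂ * (v * P (j + 1)) = v * P (j + 1) := by
        rw [← mul_assoc, ← h1, mul_assoc v, h2, hv]
      have h8 : Q j * (v * P (j + 1)) = P (j + 1) := by
        rw [← mul_assoc, h2, (hPQl _ hjn).1]
      have h9 : v * P j = v * P (j + 1) - a (j + 1) := by
        rw [← h3, h4]; abel
      rw [h3, hleib, hDv, hDQ, hDP]
      simp only [smul_mul_assoc, mul_smul_comm, add_mul, mul_add, sub_mul, mul_sub, mul_neg,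
        neg_mul, Algebra.TensorProduct.tmul_mul_tmul, one_mul, mul_one, mul_assoc, h6, h7, h8,
        h9, sub_tmul]
      module
    rw [hskew, key]
    simp only [map_neg, map_smul, map_add, TensorProduct.comm_tmul, neg_neg]
    module
end
end

section
/- With the data of the double bracket on the generators a₁,…,aₙ, b₁,…,bₙ described in the context, let Φ₂ := (a₁,b₁,a₂,b₂,…,aₙ,bₙ) be the 2n-th Euler continuant. Then Φ₂ satisfies the multiplicative moment map identity on the generators: for every 1 ≤ i ≤ n, ⟨⟨Φ₂, b_i⟩⟩ = (1/2)·(b_i⊗Φ₂ + b_iΦ₂⊗e₂) and ⟨⟨Φ₂, a_i⟩⟩ = −(1/2)·(e₂⊗Φ₂a_i + Φ₂⊗a_i). Equivalently, for every generator x ∈ {a₁,…,aₙ,b₁,…,bₙ}: ⟨⟨Φ₂, x⟩⟩ = (1/2)·(x e₂⊗Φ₂ − e₂⊗Φ₂x + xΦ₂⊗e₂ − Φ₂⊗e₂x). -/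
open TensorProduct

noncomputable section

set_option linter.unusedSimpArgs false

theorem cmm_key {k : Type*} [Field k] [CharZero k]
    {A : Type*} [Ring A] [Algebra k A]
    (n : ℕ) (hn : 1 ≤ n)
    (e₁ e₂ : A) (a b : ℕ → A)
    (br : A →ₗ[k] A →ₗ[k] A ⊗[k] A)
    (he₁ : e₁ * e₁ = e₁) (he₂ : e₂ * e₂ = e₂)
    (h12 : e₁ * e₂ = 0) (h21 : e₂ * e₁ = 0) (hsum : e₁ + e₂ = 1)
    (ha : ∀ i, 1 ≤ i → i ≤ n → a i = e₂ * a i * e₁)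
    (hb : ∀ i, 1 ≤ i → i ≤ n → b i = e₁ * b i * e₂)
    (hskew : ∀ x y : A, br x y = - TensorProduct.comm k A A (br y x))
    (hleib : ∀ x y z : A, br x (y * z) = br x y * (1 ⊗ₜ[k] z) + (y ⊗ₜ[k] 1) * br x z)
    (hbr₁ : ∀ x : A, br x e₁ = 0) (hbr₂ : ∀ x : A, br x e₂ = 0)
    (haa_lt : ∀ i j, 1 ≤ i → i ≤ n → 1 ≤ j → j ≤ n → i < j →
      br (a i) (a j) = -((2 : k)⁻¹ • (a i ⊗ₜ[k] a j + a j ⊗ₜ[k] a i)))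
    (haa_eq : ∀ i, 1 ≤ i → i ≤ n → br (a i) (a i) = 0)
    (haa_gt : ∀ i j, 1 ≤ i → i ≤ n → 1 ≤ j → j ≤ n → j < i →
      br (a i) (a j) = (2 : k)⁻¹ • (a i ⊗ₜ[k] a j + a j ⊗ₜ[k] a i))
    (hbb_lt : ∀ i j, 1 ≤ i → i ≤ n → 1 ≤ j → j ≤ n → i < j →
      br (b i) (b j) = -((2 : k)⁻¹ • (b i ⊗ₜ[k] b j + b j ⊗ₜ[k] b i)))
    (hbb_eq : ∀ i, 1 ≤ i → i ≤ n → br (b i) (b i) = 0)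
    (hbb_gt : ∀ i j, 1 ≤ i → i ≤ n → 1 ≤ j → j ≤ n → j < i →
      br (b i) (b j) = (2 : k)⁻¹ • (b i ⊗ₜ[k] b j + b j ⊗ₜ[k] b i))
    (hab_lt : ∀ i j, 1 ≤ i → i ≤ n → 1 ≤ j → j ≤ n → i < j →
      br (a i) (b j) = (2 : k)⁻¹ • (e₁ ⊗ₜ[k] (a i * b j) + (b j * a i) ⊗ₜ[k] e₂))
    (hab_eq : ∀ i, 1 ≤ i → i ≤ n →
      br (a i) (b i) =
        (2 : k)⁻¹ • ((b i * a i) ⊗ₜ[k] e₂ + e₁ ⊗ₜ[k] (a i * b i)) + e₁ ⊗ₜ[k] e₂)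
    (hab_gt : ∀ i j, 1 ≤ i → i ≤ n → 1 ≤ j → j ≤ n → j < i →
      br (a i) (b j) = -((2 : k)⁻¹ • ((b j * a i) ⊗ₜ[k] e₂ + e₁ ⊗ₜ[k] (a i * b j)))
        - (if i = j + 1 then e₁ ⊗ₜ[k] e₂ else 0))
    (P Q : ℕ → A) (hP0 : P 0 = 0) (hQ0 : Q 0 = e₂)
    (hP : ∀ m, m + 1 ≤ n → P (m + 1) = Q m * a (m + 1) + P m)
    (hQ : ∀ m, m + 1 ≤ n → Q (m + 1) = P (m + 1) * b (m + 1) + Q m) :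
    ∀ m, m ≤ n → (e₂ * P m = P m ∧ P m * e₁ = P m ∧ e₂ * Q m = Q m ∧ Q m * e₂ = Q m) ∧
      ∀ i, 1 ≤ i → i ≤ n →
      (m < i → br (Q m) (b i) = (2 : k)⁻¹ • ((b i * Q m) ⊗ₜ[k] e₂ - b i ⊗ₜ[k] Q m)) ∧
      (m < i → br (Q m) (a i) = (2 : k)⁻¹ • (e₂ ⊗ₜ[k] (Q m * a i) - Q m ⊗ₜ[k] a i)
        + (if i = m + 1 then e₂ ⊗ₜ[k] P m else 0)) ∧
      (m < i → br (P m) (b i) = (2 : k)⁻¹ • (e₁ ⊗ₜ[k] (P m * b i) + (b i * P m) ⊗ₜ[k] e₂)) ∧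
      (m < i → br (P m) (a i) = -((2 : k)⁻¹ • (P m ⊗ₜ[k] a i + a i ⊗ₜ[k] P m))) ∧
      (i ≤ m → br (Q m) (b i) = (2 : k)⁻¹ • (b i ⊗ₜ[k] Q m + (b i * Q m) ⊗ₜ[k] e₂)) ∧
      (i ≤ m → br (Q m) (a i) = -((2 : k)⁻¹ • (e₂ ⊗ₜ[k] (Q m * a i) + Q m ⊗ₜ[k] a i))) ∧
      (i ≤ m → br (P m) (b i) = (2 : k)⁻¹ • ((b i * P m) ⊗ₜ[k] e₂ - e₁ ⊗ₜ[k] (P m * b i))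
        + (if i = m then e₁ ⊗ₜ[k] Q m else 0)) ∧
      (i ≤ m → br (P m) (a i) = (2 : k)⁻¹ • (a i ⊗ₜ[k] P m - P m ⊗ₜ[k] a i)) := by
  have hl : ∀ y z x : A, br (y * z) x = br y x * (z ⊗ₜ[k] 1) + (1 ⊗ₜ[k] y) * br z x := by
    have hc : ∀ S T : A ⊗[k] A, TensorProduct.comm k A A (S * T) =
        TensorProduct.comm k A A S * TensorProduct.comm k A A T := fun S T =>
      map_mul (Algebra.TensorProduct.comm k A A) S T
    intro y z x
    rw [hskew (y * z) x, hleib, map_add, hc, hc, hskew y x, hskew z x]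
    simp only [TensorProduct.comm_tmul, neg_mul, mul_neg, neg_add]
  have hbr₂' : ∀ x, br e₂ x = 0 := by
    intro x; rw [hskew, hbr₂]; simp
  have hba_lt : ∀ i j, 1 ≤ i → i ≤ n → 1 ≤ j → j ≤ n → i < j →
      br (b j) (a i) = -((2 : k)⁻¹ • ((a i * b j) ⊗ₜ[k] e₁ + e₂ ⊗ₜ[k] (b j * a i))) := by
    intro i j h1 h2 h3 h4 h5
    rw [hskew, hab_lt i j h1 h2 h3 h4 h5]; simp
  have hba_eq : ∀ i, 1 ≤ i → i ≤ n →
      br (b i) (a i) = -((2 : k)⁻¹ • ((a i * b i) ⊗ₜ[k] e₁ + e₂ ⊗ₜ[k] (b i * a i)))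
        - e₂ ⊗ₜ[k] e₁ := by
    intro i h1 h2
    rw [hskew, hab_eq i h1 h2]; simp; module
  have hba_gt : ∀ i j, 1 ≤ i → i ≤ n → 1 ≤ j → j ≤ n → j < i →
      br (b j) (a i) = (2 : k)⁻¹ • ((a i * b j) ⊗ₜ[k] e₁ + e₂ ⊗ₜ[k] (b j * a i))
        + (if i = j + 1 then e₂ ⊗ₜ[k] e₁ else 0) := by
    intro i j h1 h2 h3 h4 h5
    rw [hskew, hab_gt i j h1 h2 h3 h4 h5]
    split_ifs <;> simp <;> module
  have hb1 : ∀ i, 1 ≤ i → i ≤ n → e₁ * b i = b i := by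
    intro i h1 h2
    rw [hb i h1 h2]; simp only [← mul_assoc, he₁]
  have hb2 : ∀ i, 1 ≤ i → i ≤ n → b i * e₂ = b i := by
    intro i h1 h2
    rw [hb i h1 h2]; simp only [mul_assoc, he₂]
  have ha1 : ∀ i, 1 ≤ i → i ≤ n → e₂ * a i = a i := by
    intro i h1 h2
    rw [ha i h1 h2]; simp only [← mul_assoc, he₂]
  have ha2 : ∀ i, 1 ≤ i → i ≤ n → a i * e₁ = a i := by
    intro i h1 h2
    rw [ha i h1 h2]; simp only [mul_assoc, he₁]
  have h2k : (2 : k) ≠ 0 := two_ne_zero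
  intro m
  induction m with
  | zero =>
    intro _
    refine ⟨by simp [hP0, hQ0, he₂], ?_⟩
    intro i h1 h2
    have t1 := hb2 i h1 h2
    have t2 := ha1 i h1 h2
    refine ⟨?_, ?_, ?_, ?_, ?_, ?_, ?_, ?_⟩ <;> intro h <;>
      first | omega | simp [hP0, hQ0, hbr₂', t1, t2]
  | succ m ih =>
    intro hm
    obtain ⟨⟨p1, p2, q1, q2⟩, ih⟩ := ih (by omega)
    have a1 := ha1 (m + 1) (by omega) hm
    have a2 := ha2 (m + 1) (by omega) hm
    have b1 := hb1 (m + 1) (by omega) hm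
    have b2 := hb2 (m + 1) (by omega) hm
    have p1' : e₂ * P (m + 1) = P (m + 1) := by
      rw [hP m hm, mul_add, ← mul_assoc, q1, p1]
    have p2' : P (m + 1) * e₁ = P (m + 1) := by
      rw [hP m hm, add_mul, mul_assoc, a2, p2]
    have q1' : e₂ * Q (m + 1) = Q (m + 1) := by
      rw [hQ m hm, mul_add, ← mul_assoc, q1, p1']
    have q2' : Q (m + 1) * e₂ = Q (m + 1) := by
      rw [hQ m hm, add_mul, mul_assoc, b2, q2]
    refine ⟨⟨p1', p2', q1', q2'⟩, ?_⟩
    intro i h1 h2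
    obtain ⟨i1, i2, i3, i4, i5, i6, i7, i8⟩ := ih i h1 h2
    have eP : ∀ x, br (P (m + 1)) x = br (Q m) x * (a (m + 1) ⊗ₜ[k] 1)
        + (1 ⊗ₜ[k] Q m) * br (a (m + 1)) x + br (P m) x := by
      intro x; rw [hP m hm, map_add, LinearMap.add_apply, hl]
    have eQ : ∀ x, br (Q (m + 1)) x = br (P (m + 1)) x * (b (m + 1) ⊗ₜ[k] 1)
        + (1 ⊗ₜ[k] P (m + 1)) * br (b (m + 1)) x + br (Q m) x := by
      intro x; rw [hQ m hm, map_add, LinearMap.add_apply, hl]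
    have hPm := hP m hm
    have hQm := hQ m hm
    rcases lt_trichotomy i (m + 1) with hi | hi | hi
    · have h3 := hab_gt (m + 1) i (by omega) hm h1 h2 hi
      have h4 := haa_gt (m + 1) i (by omega) hm h1 h2 hi
      have h5 := hbb_gt (m + 1) i (by omega) hm h1 h2 hi
      have h6 := hba_lt i (m + 1) h1 h2 (by omega) hm hi
      have j5 := i5 (by omega)
      have j6 := i6 (by omega)
      have j7 := i7 (by omega)
      have j8 := i8 (by omega)
      clear i1 i2 i3 i4 i5 i6 i7 i8
      have hne : i ≠ m + 1 := by omega
      have k7 : br (P (m + 1)) (b i) = (2 : k)⁻¹ • ((b i * P (m + 1)) ⊗ₜ[k] e₂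
          - e₁ ⊗ₜ[k] (P (m + 1) * b i)) := by
        rw [eP, j5, j7, h3]
        by_cases him : i = m
        · subst him
          simp only [hPm, if_true, add_mul, mul_add, sub_mul, mul_sub, neg_mul, mul_neg, smul_mul_assoc,
            mul_smul_comm, Algebra.TensorProduct.tmul_mul_tmul, TensorProduct.add_tmul,
            TensorProduct.tmul_add, TensorProduct.sub_tmul, TensorProduct.tmul_sub, mul_assoc, one_mul,
            mul_one, a1, a2, b1, b2, p1, p2, q1, q2, p1', p2', q1', q2', zero_mul, mul_zero, he₁, he₂]
          module
        · have : ¬ (m + 1 = i + 1) := by omega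
          simp only [him, this, if_false]
          simp only [hPm, if_true, add_mul, mul_add, sub_mul, mul_sub, neg_mul, mul_neg, smul_mul_assoc,
            mul_smul_comm, Algebra.TensorProduct.tmul_mul_tmul, TensorProduct.add_tmul,
            TensorProduct.tmul_add, TensorProduct.sub_tmul, TensorProduct.tmul_sub, mul_assoc, one_mul,
            mul_one, a1, a2, b1, b2, p1, p2, q1, q2, p1', p2', q1', q2', zero_mul, mul_zero, he₁, he₂]
          module
      have k8 : br (P (m + 1)) (a i) = (2 : k)⁻¹ • (a i ⊗ₜ[k] P (m + 1)
          - P (m + 1) ⊗ₜ[k] a i) := by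
        rw [eP, j6, j8, h4]
        simp only [hPm, if_true, add_mul, mul_add, sub_mul, mul_sub, neg_mul, mul_neg, smul_mul_assoc,
          mul_smul_comm, Algebra.TensorProduct.tmul_mul_tmul, TensorProduct.add_tmul,
          TensorProduct.tmul_add, TensorProduct.sub_tmul, TensorProduct.tmul_sub, mul_assoc, one_mul,
          mul_one, a1, a2, b1, b2, p1, p2, q1, q2, p1', p2', q1', q2', zero_mul, mul_zero, he₁, he₂]
        module
      refine ⟨by omega, by omega, by omega, by omega, fun _ => ?_, fun _ => ?_, fun _ => ?_,
        fun _ => k8⟩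
      · rw [eQ, k7, j5, h5]
        simp only [hQm, if_true, add_mul, mul_add, sub_mul, mul_sub, neg_mul, mul_neg, smul_mul_assoc,
          mul_smul_comm, Algebra.TensorProduct.tmul_mul_tmul, TensorProduct.add_tmul,
          TensorProduct.tmul_add, TensorProduct.sub_tmul, TensorProduct.tmul_sub, mul_assoc, one_mul,
          mul_one, a1, a2, b1, b2, p1, p2, q1, q2, p1', p2', q1', q2', zero_mul, mul_zero, he₁, he₂]
        module
      · rw [eQ, k8, j6, h6]
        simp only [hQm, if_true, add_mul, mul_add, sub_mul, mul_sub, neg_mul, mul_neg, smul_mul_assoc,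
          mul_smul_comm, Algebra.TensorProduct.tmul_mul_tmul, TensorProduct.add_tmul,
          TensorProduct.tmul_add, TensorProduct.sub_tmul, TensorProduct.tmul_sub, mul_assoc, one_mul,
          mul_one, a1, a2, b1, b2, p1, p2, q1, q2, p1', p2', q1', q2', zero_mul, mul_zero, he₁, he₂]
        module
      · rw [k7, if_neg hne, add_zero]
    · subst hi
      have h3 := hab_eq (m + 1) (by omega) hm
      have h4 := haa_eq (m + 1) (by omega) hm
      have h5 := hbb_eq (m + 1) (by omega) hm
      have h6 := hba_eq (m + 1) (by omega) hm
      have j1 := i1 (by omega)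
      have j2 := i2 (by omega)
      have j3 := i3 (by omega)
      have j4 := i4 (by omega)
      clear i1 i2 i3 i4 i5 i6 i7 i8
      rw [if_pos rfl] at j2
      have k7 : br (P (m + 1)) (b (m + 1)) = (2 : k)⁻¹ • ((b (m + 1) * P (m + 1)) ⊗ₜ[k] e₂
          - e₁ ⊗ₜ[k] (P (m + 1) * b (m + 1))) + e₁ ⊗ₜ[k] Q (m + 1) := by
        rw [eP, j1, j3, h3, hQm]
        simp only [hPm, if_true, add_mul, mul_add, sub_mul, mul_sub, neg_mul, mul_neg, smul_mul_assoc,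
          mul_smul_comm, Algebra.TensorProduct.tmul_mul_tmul, TensorProduct.add_tmul,
          TensorProduct.tmul_add, TensorProduct.sub_tmul, TensorProduct.tmul_sub, mul_assoc, one_mul,
          mul_one, a1, a2, b1, b2, p1, p2, q1, q2, p1', p2', q1', q2', zero_mul, mul_zero, he₁, he₂]
        module
      have k8 : br (P (m + 1)) (a (m + 1)) = (2 : k)⁻¹ • (a (m + 1) ⊗ₜ[k] P (m + 1)
          - P (m + 1) ⊗ₜ[k] a (m + 1)) := by
        rw [eP, j2, j4, h4]
        simp only [hPm, if_true, add_mul, mul_add, sub_mul, mul_sub, neg_mul, mul_neg, smul_mul_assoc,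
          mul_smul_comm, Algebra.TensorProduct.tmul_mul_tmul, TensorProduct.add_tmul,
          TensorProduct.tmul_add, TensorProduct.sub_tmul, TensorProduct.tmul_sub, mul_assoc, one_mul,
          mul_one, a1, a2, b1, b2, p1, p2, q1, q2, p1', p2', q1', q2', zero_mul, mul_zero, he₁, he₂]
        module
      refine ⟨by omega, by omega, by omega, by omega, fun _ => ?_, fun _ => ?_, fun _ => ?_,
        fun _ => k8⟩
      · rw [eQ, k7, j1, h5]
        simp only [hQm, if_true, add_mul, mul_add, sub_mul, mul_sub, neg_mul, mul_neg, smul_mul_assoc,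
          mul_smul_comm, Algebra.TensorProduct.tmul_mul_tmul, TensorProduct.add_tmul,
          TensorProduct.tmul_add, TensorProduct.sub_tmul, TensorProduct.tmul_sub, mul_assoc, one_mul,
          mul_one, a1, a2, b1, b2, p1, p2, q1, q2, p1', p2', q1', q2', zero_mul, mul_zero, he₁, he₂]
        module
      · rw [eQ, k8, j2, h6]
        have hz : P m = P (m + 1) - Q m * a (m + 1) := by rw [hPm]; abel
        rw [hz]
        simp only [hQm, if_true, add_mul, mul_add, sub_mul, mul_sub, neg_mul, mul_neg, smul_mul_assoc,
          mul_smul_comm, Algebra.TensorProduct.tmul_mul_tmul, TensorProduct.add_tmul,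
          TensorProduct.tmul_add, TensorProduct.sub_tmul, TensorProduct.tmul_sub, mul_assoc, one_mul,
          mul_one, a1, a2, b1, b2, p1, p2, q1, q2, p1', p2', q1', q2', zero_mul, mul_zero, he₁, he₂]
        module
      · rw [k7, if_pos rfl]
    · have h3 := hab_lt (m + 1) i (by omega) hm h1 h2 hi
      have h4 := haa_lt (m + 1) i (by omega) hm h1 h2 hi
      have h5 := hbb_lt (m + 1) i (by omega) hm h1 h2 hi
      have h6 := hba_gt i (m + 1) h1 h2 (by omega) hm hi
      have j1 := i1 (by omega)
      have j2 := i2 (by omega)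
      have j3 := i3 (by omega)
      have j4 := i4 (by omega)
      clear i1 i2 i3 i4 i5 i6 i7 i8
      rw [if_neg (by omega), add_zero] at j2
      have k3 : br (P (m + 1)) (b i) = (2 : k)⁻¹ • (e₁ ⊗ₜ[k] (P (m + 1) * b i)
          + (b i * P (m + 1)) ⊗ₜ[k] e₂) := by
        rw [eP, j1, j3, h3]
        simp only [hPm, if_true, add_mul, mul_add, sub_mul, mul_sub, neg_mul, mul_neg, smul_mul_assoc,
          mul_smul_comm, Algebra.TensorProduct.tmul_mul_tmul, TensorProduct.add_tmul,
          TensorProduct.tmul_add, TensorProduct.sub_tmul, TensorProduct.tmul_sub, mul_assoc, one_mul,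
          mul_one, a1, a2, b1, b2, p1, p2, q1, q2, p1', p2', q1', q2', zero_mul, mul_zero, he₁, he₂]
        module
      have k4 : br (P (m + 1)) (a i) = -((2 : k)⁻¹ • (P (m + 1) ⊗ₜ[k] a i
          + a i ⊗ₜ[k] P (m + 1))) := by
        rw [eP, j2, j4, h4]
        simp only [hPm, if_true, add_mul, mul_add, sub_mul, mul_sub, neg_mul, mul_neg, smul_mul_assoc,
          mul_smul_comm, Algebra.TensorProduct.tmul_mul_tmul, TensorProduct.add_tmul,
          TensorProduct.tmul_add, TensorProduct.sub_tmul, TensorProduct.tmul_sub, mul_assoc, one_mul,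
          mul_one, a1, a2, b1, b2, p1, p2, q1, q2, p1', p2', q1', q2', zero_mul, mul_zero, he₁, he₂]
        module
      refine ⟨fun _ => ?_, fun _ => ?_, fun _ => k3, fun _ => k4, by omega, by omega, by omega,
        by omega⟩
      · rw [eQ, k3, j1, h5]
        simp only [hQm, if_true, add_mul, mul_add, sub_mul, mul_sub, neg_mul, mul_neg, smul_mul_assoc,
          mul_smul_comm, Algebra.TensorProduct.tmul_mul_tmul, TensorProduct.add_tmul,
          TensorProduct.tmul_add, TensorProduct.sub_tmul, TensorProduct.tmul_sub, mul_assoc, one_mul,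
          mul_one, a1, a2, b1, b2, p1, p2, q1, q2, p1', p2', q1', q2', zero_mul, mul_zero, he₁, he₂]
        module
      · rw [eQ, k4, j2, h6]
        by_cases him : i = m + 1 + 1
        · simp only [him, if_true]
          simp only [hQm, if_true, add_mul, mul_add, sub_mul, mul_sub, neg_mul, mul_neg, smul_mul_assoc,
            mul_smul_comm, Algebra.TensorProduct.tmul_mul_tmul, TensorProduct.add_tmul,
            TensorProduct.tmul_add, TensorProduct.sub_tmul, TensorProduct.tmul_sub, mul_assoc, one_mul,
            mul_one, a1, a2, b1, b2, p1, p2, q1, q2, p1', p2', q1', q2', zero_mul, mul_zero, he₁, he₂]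
          module
        · simp only [him, if_false]
          simp only [hQm, if_true, add_mul, mul_add, sub_mul, mul_sub, neg_mul, mul_neg, smul_mul_assoc,
            mul_smul_comm, Algebra.TensorProduct.tmul_mul_tmul, TensorProduct.add_tmul,
            TensorProduct.tmul_add, TensorProduct.sub_tmul, TensorProduct.tmul_sub, mul_assoc, one_mul,
            mul_one, a1, a2, b1, b2, p1, p2, q1, q2, p1', p2', q1', q2', zero_mul, mul_zero, he₁, he₂]
          module

/-- The 2n-th Euler continuant `Φ₂ = (a₁,b₁,…,aₙ,bₙ)` satisfies the multiplicative moment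
map identity against every generator. -/
theorem continuant_is_moment_map {k : Type*} [Field k] [CharZero k]
    {A : Type*} [Ring A] [Algebra k A]
    (n : ℕ) (hn : 1 ≤ n)
    (e₁ e₂ : A) (a b : ℕ → A)
    (br : A →ₗ[k] A →ₗ[k] A ⊗[k] A)
    (he₁ : e₁ * e₁ = e₁) (he₂ : e₂ * e₂ = e₂)
    (h12 : e₁ * e₂ = 0) (h21 : e₂ * e₁ = 0) (hsum : e₁ + e₂ = 1)
    (ha : ∀ i, 1 ≤ i → i ≤ n → a i = e₂ * a i * e₁)
    (hb : ∀ i, 1 ≤ i → i ≤ n → b i = e₁ * b i * e₂)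
    (hskew : ∀ x y : A, br x y = - TensorProduct.comm k A A (br y x))
    (hleib : ∀ x y z : A, br x (y * z) = br x y * (1 ⊗ₜ[k] z) + (y ⊗ₜ[k] 1) * br x z)
    (hbr₁ : ∀ x : A, br x e₁ = 0) (hbr₂ : ∀ x : A, br x e₂ = 0)
    (haa_lt : ∀ i j, 1 ≤ i → i ≤ n → 1 ≤ j → j ≤ n → i < j →
      br (a i) (a j) = -((2 : k)⁻¹ • (a i ⊗ₜ[k] a j + a j ⊗ₜ[k] a i)))
    (haa_eq : ∀ i, 1 ≤ i → i ≤ n → br (a i) (a i) = 0)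
    (haa_gt : ∀ i j, 1 ≤ i → i ≤ n → 1 ≤ j → j ≤ n → j < i →
      br (a i) (a j) = (2 : k)⁻¹ • (a i ⊗ₜ[k] a j + a j ⊗ₜ[k] a i))
    (hbb_lt : ∀ i j, 1 ≤ i → i ≤ n → 1 ≤ j → j ≤ n → i < j →
      br (b i) (b j) = -((2 : k)⁻¹ • (b i ⊗ₜ[k] b j + b j ⊗ₜ[k] b i)))
    (hbb_eq : ∀ i, 1 ≤ i → i ≤ n → br (b i) (b i) = 0)
    (hbb_gt : ∀ i j, 1 ≤ i → i ≤ n → 1 ≤ j → j ≤ n → j < i →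
      br (b i) (b j) = (2 : k)⁻¹ • (b i ⊗ₜ[k] b j + b j ⊗ₜ[k] b i))
    (hab_lt : ∀ i j, 1 ≤ i → i ≤ n → 1 ≤ j → j ≤ n → i < j →
      br (a i) (b j) = (2 : k)⁻¹ • (e₁ ⊗ₜ[k] (a i * b j) + (b j * a i) ⊗ₜ[k] e₂))
    (hab_eq : ∀ i, 1 ≤ i → i ≤ n →
      br (a i) (b i) =
        (2 : k)⁻¹ • ((b i * a i) ⊗ₜ[k] e₂ + e₁ ⊗ₜ[k] (a i * b i)) + e₁ ⊗ₜ[k] e₂)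
    (hab_gt : ∀ i j, 1 ≤ i → i ≤ n → 1 ≤ j → j ≤ n → j < i →
      br (a i) (b j) = -((2 : k)⁻¹ • ((b j * a i) ⊗ₜ[k] e₂ + e₁ ⊗ₜ[k] (a i * b j)))
        - (if i = j + 1 then e₁ ⊗ₜ[k] e₂ else 0))
    :
    ∀ i, 1 ≤ i → i ≤ n →
      br (contB e₂ a b n) (b i) =
        (2 : k)⁻¹ • (b i ⊗ₜ[k] contB e₂ a b n + (b i * contB e₂ a b n) ⊗ₜ[k] e₂) ∧
      br (contB e₂ a b n) (a i) =
        -((2 : k)⁻¹ • (e₂ ⊗ₜ[k] (contB e₂ a b n * a i) + contB e₂ a b n ⊗ₜ[k] a i)) ∧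
      br (contB e₂ a b n) (a i) =
        (2 : k)⁻¹ • ((a i * e₂) ⊗ₜ[k] contB e₂ a b n - e₂ ⊗ₜ[k] (contB e₂ a b n * a i) +
          (a i * contB e₂ a b n) ⊗ₜ[k] e₂ - contB e₂ a b n ⊗ₜ[k] (e₂ * a i)) ∧
      br (contB e₂ a b n) (b i) =
        (2 : k)⁻¹ • ((b i * e₂) ⊗ₜ[k] contB e₂ a b n - e₂ ⊗ₜ[k] (contB e₂ a b n * b i) +
          (b i * contB e₂ a b n) ⊗ₜ[k] e₂ - contB e₂ a b n ⊗ₜ[k] (e₂ * b i)) := by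
  have ha1 : ∀ i, 1 ≤ i → i ≤ n → e₂ * a i = a i := by
    intro i h1 h2
    rw [ha i h1 h2]; simp only [← mul_assoc, he₂]
  have hb2 : ∀ i, 1 ≤ i → i ≤ n → b i * e₂ = b i := by
    intro i h1 h2
    rw [hb i h1 h2]; simp only [mul_assoc, he₂]
  have ha3 : ∀ i, 1 ≤ i → i ≤ n → a i * e₂ = 0 := by
    intro i h1 h2
    rw [ha i h1 h2]; simp only [mul_assoc, h12, mul_zero]
  have hb3 : ∀ i, 1 ≤ i → i ≤ n → e₂ * b i = 0 := by
    intro i h1 h2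
    rw [hb i h1 h2]; simp only [← mul_assoc, h21, zero_mul]
  obtain ⟨⟨-, -, q1, q2⟩, H⟩ := cmm_key n hn e₁ e₂ a b br he₁ he₂ h12 h21 hsum ha hb hskew hleib
    hbr₁ hbr₂ haa_lt haa_eq haa_gt hbb_lt hbb_eq hbb_gt hab_lt hab_eq hab_gt
    (fun m => if m = 0 then 0 else contA e₂ a b m) (contB e₂ a b) (by simp) (by simp [contB])
    (by
      intro m hm
      rcases m with _ | m
      · simp [contA, contB, contPair, ha1 1 le_rfl hn]
      · simp [contA, contB, contPair])
    (by
      intro m hm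
      rcases m with _ | m
      · simp [contA, contB, contPair, add_comm]
      · simp [contA, contB, contPair]) n le_rfl
  intro i h1 h2
  obtain ⟨-, -, -, -, h5, h6, -, -⟩ := H i h1 h2
  have h5 := h5 h2
  have h6 := h6 h2
  have z1 : a i * contB e₂ a b n = 0 := by
    rw [← q1, ← mul_assoc, ha3 i h1 h2, zero_mul]
  have z2 : contB e₂ a b n * b i = 0 := by
    rw [← q2, mul_assoc, hb3 i h1 h2, mul_zero]
  refine ⟨h5, h6, ?_, ?_⟩
  · rw [h6, z1, ha3 i h1 h2, ha1 i h1 h2]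
    simp only [TensorProduct.zero_tmul]
    module
  · rw [h5, z2, hb3 i h1 h2, hb2 i h1 h2]
    simp only [TensorProduct.tmul_zero]
    module
end
end

section
/- With the data of the double bracket on the generators a₁,…,aₙ, b₁,…,bₙ described in the context, the associated triple bracket satisfies, for all i, j, k ∈ {1,…,n}: ⟨⟨a_i, a_j, a_k⟩⟩ = (1/4)·(a_k⊗a_i⊗a_j − a_i⊗a_j⊗a_k). This is the quasi-Poisson property of the double bracket on triples of the generators a₁,…,aₙ. -/
open TensorProduct

noncomputable section

variable {k : Type*} [Field k] {A : Type*} [Ring A] [Algebra k A]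

/-- The extension `⟨⟨x, u⊗v⟩⟩_L = ⟨⟨x,u⟩⟩ ⊗ v` of a double bracket, extended bilinearly. -/
def brL (br : A →ₗ[k] A →ₗ[k] A ⊗[k] A) (x : A) :
    A ⊗[k] A →ₗ[k] A ⊗[k] (A ⊗[k] A) :=
  (TensorProduct.assoc k A A A).toLinearMap.comp (LinearMap.rTensor A (br x))

/-- The cyclic permutation `τ₍₁₃₂₎ (u⊗v⊗w) = v⊗w⊗u`. -/
def tau132 : A ⊗[k] (A ⊗[k] A) →ₗ[k] A ⊗[k] (A ⊗[k] A) :=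
  (TensorProduct.assoc k A A A).toLinearMap.comp
    (TensorProduct.comm k A (A ⊗[k] A)).toLinearMap

/-- The cyclic permutation `τ₍₁₂₃₎ (u⊗v⊗w) = w⊗u⊗v`. -/
def tau123 : A ⊗[k] (A ⊗[k] A) →ₗ[k] A ⊗[k] (A ⊗[k] A) :=
  (tau132 (k := k) (A := A)).comp (tau132 (k := k) (A := A))

/-- The triple bracket associated with a double bracket:
`⟨⟨x,y,z⟩⟩ = ⟨⟨x,⟨⟨y,z⟩⟩⟩⟩_L + τ₍₁₂₃₎⟨⟨y,⟨⟨z,x⟩⟩⟩⟩_L + τ₍₁₃₂₎⟨⟨z,⟨⟨x,y⟩⟩⟩⟩_L`. -/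
def trip (br : A →ₗ[k] A →ₗ[k] A ⊗[k] A) (x y z : A) : A ⊗[k] (A ⊗[k] A) :=
  brL br x (br y z) + tau123 (brL br y (br z x)) + tau132 (brL br z (br x y))

theorem trip_aux {k : Type*} [Field k] {A : Type*} [Ring A] [Algebra k A]
    (br : A →ₗ[k] A →ₗ[k] A ⊗[k] A) (x y z : A) (p q r : k)
    (hxy : br x y = p • (x ⊗ₜ[k] y + y ⊗ₜ[k] x))
    (hyx : br y x = (-p) • (x ⊗ₜ[k] y + y ⊗ₜ[k] x))
    (hyz : br y z = q • (y ⊗ₜ[k] z + z ⊗ₜ[k] y))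
    (hzy : br z y = (-q) • (y ⊗ₜ[k] z + z ⊗ₜ[k] y))
    (hzx : br z x = r • (z ⊗ₜ[k] x + x ⊗ₜ[k] z))
    (hxz : br x z = (-r) • (z ⊗ₜ[k] x + x ⊗ₜ[k] z)) :
    trip br x y z = (p * q + q * r + r * p) •
      (x ⊗ₜ[k] (y ⊗ₜ[k] z) - z ⊗ₜ[k] (x ⊗ₜ[k] y)) := by
  simp only [trip, brL, tau123, tau132, hxy, hyx, hyz, hzy, hzx, hxz, map_add, map_smul,
    LinearMap.comp_apply, LinearEquiv.coe_coe, LinearMap.rTensor_tmul, TensorProduct.add_tmul,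
    ← TensorProduct.smul_tmul', TensorProduct.assoc_tmul, TensorProduct.comm_tmul, smul_add]
  module

/-- The quasi-Poisson property of the double bracket on triples of `a`-generators:
`⟨⟨a_i, a_j, a_l⟩⟩ = (1/4)·(a_l⊗a_i⊗a_j − a_i⊗a_j⊗a_l)`. -/
theorem triple_bracket_aaa {k : Type*} [Field k] [CharZero k]
    {A : Type*} [Ring A] [Algebra k A]
    (n : ℕ) (hn : 1 ≤ n)
    (e₁ e₂ : A) (a b : ℕ → A)
    (br : A →ₗ[k] A →ₗ[k] A ⊗[k] A)
    (he₁ : e₁ * e₁ = e₁) (he₂ : e₂ * e₂ = e₂)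
    (h12 : e₁ * e₂ = 0) (h21 : e₂ * e₁ = 0) (hsum : e₁ + e₂ = 1)
    (ha : ∀ i, 1 ≤ i → i ≤ n → a i = e₂ * a i * e₁)
    (hb : ∀ i, 1 ≤ i → i ≤ n → b i = e₁ * b i * e₂)
    (hskew : ∀ x y : A, br x y = - TensorProduct.comm k A A (br y x))
    (hleib : ∀ x y z : A, br x (y * z) = br x y * (1 ⊗ₜ[k] z) + (y ⊗ₜ[k] 1) * br x z)
    (hbr₁ : ∀ x : A, br x e₁ = 0) (hbr₂ : ∀ x : A, br x e₂ = 0)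
    (haa_lt : ∀ i j, 1 ≤ i → i ≤ n → 1 ≤ j → j ≤ n → i < j →
      br (a i) (a j) = -((2 : k)⁻¹ • (a i ⊗ₜ[k] a j + a j ⊗ₜ[k] a i)))
    (haa_eq : ∀ i, 1 ≤ i → i ≤ n → br (a i) (a i) = 0)
    (haa_gt : ∀ i j, 1 ≤ i → i ≤ n → 1 ≤ j → j ≤ n → j < i →
      br (a i) (a j) = (2 : k)⁻¹ • (a i ⊗ₜ[k] a j + a j ⊗ₜ[k] a i))
    (hbb_lt : ∀ i j, 1 ≤ i → i ≤ n → 1 ≤ j → j ≤ n → i < j →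
      br (b i) (b j) = -((2 : k)⁻¹ • (b i ⊗ₜ[k] b j + b j ⊗ₜ[k] b i)))
    (hbb_eq : ∀ i, 1 ≤ i → i ≤ n → br (b i) (b i) = 0)
    (hbb_gt : ∀ i j, 1 ≤ i → i ≤ n → 1 ≤ j → j ≤ n → j < i →
      br (b i) (b j) = (2 : k)⁻¹ • (b i ⊗ₜ[k] b j + b j ⊗ₜ[k] b i))
    (hab_lt : ∀ i j, 1 ≤ i → i ≤ n → 1 ≤ j → j ≤ n → i < j →
      br (a i) (b j) = (2 : k)⁻¹ • (e₁ ⊗ₜ[k] (a i * b j) + (b j * a i) ⊗ₜ[k] e₂))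
    (hab_eq : ∀ i, 1 ≤ i → i ≤ n →
      br (a i) (b i) =
        (2 : k)⁻¹ • ((b i * a i) ⊗ₜ[k] e₂ + e₁ ⊗ₜ[k] (a i * b i)) + e₁ ⊗ₜ[k] e₂)
    (hab_gt : ∀ i j, 1 ≤ i → i ≤ n → 1 ≤ j → j ≤ n → j < i →
      br (a i) (b j) = -((2 : k)⁻¹ • ((b j * a i) ⊗ₜ[k] e₂ + e₁ ⊗ₜ[k] (a i * b j)))
        - (if i = j + 1 then e₁ ⊗ₜ[k] e₂ else 0))
    :
    ∀ i j l, 1 ≤ i → i ≤ n → 1 ≤ j → j ≤ n → 1 ≤ l → l ≤ n →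
      trip br (a i) (a j) (a l) =
        (4 : k)⁻¹ • (a l ⊗ₜ[k] (a i ⊗ₜ[k] a j) - a i ⊗ₜ[k] (a j ⊗ₜ[k] a l)) := by
  intro i j l hi hi' hj hj' hl hl'
  have key : ∀ i j, 1 ≤ i → i ≤ n → 1 ≤ j → j ≤ n →
      br (a i) (a j) = ((2 : k)⁻¹ * (if i < j then -1 else if j < i then 1 else 0)) •
        (a i ⊗ₜ[k] a j + a j ⊗ₜ[k] a i) := by
    intro i j hi hi' hj hj'
    rcases lt_trichotomy i j with h | h | h
    · rw [haa_lt i j hi hi' hj hj' h]; simp only [h, if_true]; module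
    · subst h; rw [haa_eq i hi hi']; simp
    · rw [haa_gt i j hi hi' hj hj' h]; simp [h, not_lt.mpr h.le]
  have key' : ∀ i j, 1 ≤ i → i ≤ n → 1 ≤ j → j ≤ n →
      br (a j) (a i) = (-((2 : k)⁻¹ * (if i < j then -1 else if j < i then 1 else 0))) •
        (a i ⊗ₜ[k] a j + a j ⊗ₜ[k] a i) := by
    intro i j hi hi' hj hj'
    rw [hskew, key i j hi hi' hj hj', map_smul, map_add, TensorProduct.comm_tmul,
      TensorProduct.comm_tmul, neg_smul, add_comm]
  rw [trip_aux br (a i) (a j) (a l) _ _ _ (key i j hi hi' hj hj') (key' i j hi hi' hj hj')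
    (key j l hj hj' hl hl') (key' j l hj hj' hl hl')
    (key l i hl hl' hi hi') (key' l i hl hl' hi hi')]
  by_cases hall : i = j ∧ j = l
  · obtain ⟨rfl, rfl⟩ := hall
    simp
  · rw [← neg_sub (a i ⊗ₜ[k] (a j ⊗ₜ[k] a l)), smul_neg, ← neg_smul]
    congr 1
    have h4 : (4 : k)⁻¹ = 2⁻¹ * 2⁻¹ := by norm_num
    rw [h4]
    split_ifs <;> first | omega | ring
end
end

section
/- With the data of the double bracket on the generators a₁,…,aₙ, b₁,…,bₙ described in the context, the associated triple bracket satisfies, for all i, j, k ∈ {1,…,n}: ⟨⟨a_i, a_j, b_k⟩⟩ = (1/4)·(b_k a_i⊗a_j⊗e₂ − e₁⊗a_i⊗a_j b_k). This is the quasi-Poisson property of the double bracket on triples consisting of two a-generators and one b-generator. -/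
open TensorProduct

noncomputable section

variable {k : Type*} [Field k] {A : Type*} [Ring A] [Algebra k A]

lemma trip_aux_s15 {k : Type*} [Field k] [CharZero k]
    {A : Type*} [Ring A] [Algebra k A]
    (e₁ e₂ x y z : A) (br : A →ₗ[k] A →ₗ[k] A ⊗[k] A)
    (hx2 : e₂ * x = x) (hx1 : x * e₁ = x) (hy2 : e₂ * y = y) (hz1 : z * e₂ = z)
    (hz2 : e₁ * z = z)
    (hskew : ∀ x y : A, br x y = - TensorProduct.comm k A A (br y x))
    (hleib : ∀ x y z : A, br x (y * z) = br x y * (1 ⊗ₜ[k] z) + (y ⊗ₜ[k] 1) * br x z)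
    (hbr₁ : ∀ x : A, br x e₁ = 0) (hbr₂ : ∀ x : A, br x e₂ = 0)
    (s p q c d : k)
    (hxy : br x y = (s * (2 : k)⁻¹) • (x ⊗ₜ[k] y + y ⊗ₜ[k] x))
    (hxz : br x z = (p * (2 : k)⁻¹) • ((z * x) ⊗ₜ[k] e₂ + e₁ ⊗ₜ[k] (x * z))
      + c • (e₁ ⊗ₜ[k] e₂))
    (hyz : br y z = (q * (2 : k)⁻¹) • ((z * y) ⊗ₜ[k] e₂ + e₁ ⊗ₜ[k] (y * z))
      + d • (e₁ ⊗ₜ[k] e₂))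
    (H1 : p * q + s * (q - p) = 1)
    (H2 : (c * (q - s)) • (e₁ ⊗ₜ[k] (y ⊗ₜ[k] e₂) : A ⊗[k] (A ⊗[k] A))
      = (d * (p + s)) • (e₁ ⊗ₜ[k] (x ⊗ₜ[k] e₂))) :
    trip br x y z =
        (4 : k)⁻¹ • ((z * x) ⊗ₜ[k] (y ⊗ₜ[k] e₂) -
          e₁ ⊗ₜ[k] (x ⊗ₜ[k] (y * z))) := by
  have hyx : br y x = -((s * (2 : k)⁻¹) • (x ⊗ₜ[k] y + y ⊗ₜ[k] x)) := by
    rw [hskew, hxy]; simp [add_comm]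
  have hzx : br z x = -((p * (2 : k)⁻¹) • (e₂ ⊗ₜ[k] (z * x) + (x * z) ⊗ₜ[k] e₁)
      + c • (e₂ ⊗ₜ[k] e₁)) := by
    rw [hskew, hxz]; simp
  have hzy : br z y = -((q * (2 : k)⁻¹) • (e₂ ⊗ₜ[k] (z * y) + (y * z) ⊗ₜ[k] e₁)
      + d • (e₂ ⊗ₜ[k] e₁)) := by
    rw [hskew, hyz]; simp
  have L : ∀ w u v : A, brL br w (u ⊗ₜ[k] v)
      = TensorProduct.assoc k A A A ((br w u) ⊗ₜ[k] v) := fun w u v => rfl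
  have T : ∀ u v w : A, tau132 (u ⊗ₜ[k] (v ⊗ₜ[k] w)) = v ⊗ₜ[k] (w ⊗ₜ[k] u) :=
    fun u v w => rfl
  have T' : ∀ u v w : A, tau123 (u ⊗ₜ[k] (v ⊗ₜ[k] w)) = w ⊗ₜ[k] (u ⊗ₜ[k] v) :=
    fun u v w => rfl
  have t1 : brL br x (br y z) = (q * (2 : k)⁻¹) • (
      (p * (2 : k)⁻¹) • ((z * x) ⊗ₜ[k] (y ⊗ₜ[k] e₂) + e₁ ⊗ₜ[k] ((x * z * y) ⊗ₜ[k] e₂))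
      + c • (e₁ ⊗ₜ[k] (y ⊗ₜ[k] e₂))
      + (s * (2 : k)⁻¹) • ((z * x) ⊗ₜ[k] (y ⊗ₜ[k] e₂) + (z * y) ⊗ₜ[k] (x ⊗ₜ[k] e₂))) := by
    rw [hyz]
    simp only [map_add, map_smul, L, hbr₁, hbr₂, hleib, hxz, hxy, add_mul, mul_add,
      smul_mul_assoc, mul_smul_comm, Algebra.TensorProduct.tmul_mul_tmul, mul_one, one_mul,
      hy2, TensorProduct.add_tmul, TensorProduct.zero_tmul, ← TensorProduct.smul_tmul',
      TensorProduct.assoc_tmul, map_zero]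
    module
  have t2 : tau123 (brL br y (br z x)) = -((p * (2 : k)⁻¹) • (
      (q * (2 : k)⁻¹) • (e₁ ⊗ₜ[k] ((x * z * y) ⊗ₜ[k] e₂) + e₁ ⊗ₜ[k] (x ⊗ₜ[k] (y * z)))
      + d • (e₁ ⊗ₜ[k] (x ⊗ₜ[k] e₂))
      - (s * (2 : k)⁻¹) • (e₁ ⊗ₜ[k] (x ⊗ₜ[k] (y * z)) + e₁ ⊗ₜ[k] (y ⊗ₜ[k] (x * z))))) := by
    rw [hzx]
    simp only [map_add, map_neg, map_smul, L, hbr₁, hbr₂, hleib, hyz, hyx, add_mul, mul_add,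
      neg_mul, mul_neg, TensorProduct.neg_tmul,
      smul_mul_assoc, mul_smul_comm, Algebra.TensorProduct.tmul_mul_tmul, mul_one, one_mul,
      hx1, TensorProduct.add_tmul, TensorProduct.zero_tmul, ← TensorProduct.smul_tmul',
      TensorProduct.assoc_tmul, map_zero, T', ← mul_assoc]
    module
  have t3 : tau132 (brL br z (br x y)) = -((s * (2 : k)⁻¹) • (
      (p * (2 : k)⁻¹) • ((z * x) ⊗ₜ[k] (y ⊗ₜ[k] e₂) + e₁ ⊗ₜ[k] (y ⊗ₜ[k] (x * z)))
      + c • (e₁ ⊗ₜ[k] (y ⊗ₜ[k] e₂))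
      + (q * (2 : k)⁻¹) • ((z * y) ⊗ₜ[k] (x ⊗ₜ[k] e₂) + e₁ ⊗ₜ[k] (x ⊗ₜ[k] (y * z)))
      + d • (e₁ ⊗ₜ[k] (x ⊗ₜ[k] e₂)))) := by
    rw [hxy]
    simp only [map_add, map_neg, map_smul, L, hzx, hzy,
      TensorProduct.neg_tmul,
      TensorProduct.add_tmul, TensorProduct.zero_tmul, ← TensorProduct.smul_tmul',
      TensorProduct.assoc_tmul, map_zero, T]
    module
  have h4 : (4 : k)⁻¹ = (2 : k)⁻¹ * (2 : k)⁻¹ := by norm_num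
  rw [trip, t1, t2, t3, h4]
  linear_combination (norm := module) (2 : k)⁻¹ • H2 + (((2 : k)⁻¹ * (2 : k)⁻¹) * H1) •
    ((z * x) ⊗ₜ[k] (y ⊗ₜ[k] e₂) - e₁ ⊗ₜ[k] (x ⊗ₜ[k] (y * z)))

/-- The quasi-Poisson property of the double bracket on triples with two `a`-generators and
one `b`-generator: `⟨⟨a_i, a_j, b_l⟩⟩ = (1/4)·(b_l a_i⊗a_j⊗e₂ − e₁⊗a_i⊗a_j b_l)`. -/
theorem triple_bracket_aab {k : Type*} [Field k] [CharZero k]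
    {A : Type*} [Ring A] [Algebra k A]
    (n : ℕ) (hn : 1 ≤ n)
    (e₁ e₂ : A) (a b : ℕ → A)
    (br : A →ₗ[k] A →ₗ[k] A ⊗[k] A)
    (he₁ : e₁ * e₁ = e₁) (he₂ : e₂ * e₂ = e₂)
    (h12 : e₁ * e₂ = 0) (h21 : e₂ * e₁ = 0) (hsum : e₁ + e₂ = 1)
    (ha : ∀ i, 1 ≤ i → i ≤ n → a i = e₂ * a i * e₁)
    (hb : ∀ i, 1 ≤ i → i ≤ n → b i = e₁ * b i * e₂)
    (hskew : ∀ x y : A, br x y = - TensorProduct.comm k A A (br y x))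
    (hleib : ∀ x y z : A, br x (y * z) = br x y * (1 ⊗ₜ[k] z) + (y ⊗ₜ[k] 1) * br x z)
    (hbr₁ : ∀ x : A, br x e₁ = 0) (hbr₂ : ∀ x : A, br x e₂ = 0)
    (haa_lt : ∀ i j, 1 ≤ i → i ≤ n → 1 ≤ j → j ≤ n → i < j →
      br (a i) (a j) = -((2 : k)⁻¹ • (a i ⊗ₜ[k] a j + a j ⊗ₜ[k] a i)))
    (haa_eq : ∀ i, 1 ≤ i → i ≤ n → br (a i) (a i) = 0)
    (haa_gt : ∀ i j, 1 ≤ i → i ≤ n → 1 ≤ j → j ≤ n → j < i →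
      br (a i) (a j) = (2 : k)⁻¹ • (a i ⊗ₜ[k] a j + a j ⊗ₜ[k] a i))
    (hbb_lt : ∀ i j, 1 ≤ i → i ≤ n → 1 ≤ j → j ≤ n → i < j →
      br (b i) (b j) = -((2 : k)⁻¹ • (b i ⊗ₜ[k] b j + b j ⊗ₜ[k] b i)))
    (hbb_eq : ∀ i, 1 ≤ i → i ≤ n → br (b i) (b i) = 0)
    (hbb_gt : ∀ i j, 1 ≤ i → i ≤ n → 1 ≤ j → j ≤ n → j < i →
      br (b i) (b j) = (2 : k)⁻¹ • (b i ⊗ₜ[k] b j + b j ⊗ₜ[k] b i))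
    (hab_lt : ∀ i j, 1 ≤ i → i ≤ n → 1 ≤ j → j ≤ n → i < j →
      br (a i) (b j) = (2 : k)⁻¹ • (e₁ ⊗ₜ[k] (a i * b j) + (b j * a i) ⊗ₜ[k] e₂))
    (hab_eq : ∀ i, 1 ≤ i → i ≤ n →
      br (a i) (b i) =
        (2 : k)⁻¹ • ((b i * a i) ⊗ₜ[k] e₂ + e₁ ⊗ₜ[k] (a i * b i)) + e₁ ⊗ₜ[k] e₂)
    (hab_gt : ∀ i j, 1 ≤ i → i ≤ n → 1 ≤ j → j ≤ n → j < i →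
      br (a i) (b j) = -((2 : k)⁻¹ • ((b j * a i) ⊗ₜ[k] e₂ + e₁ ⊗ₜ[k] (a i * b j)))
        - (if i = j + 1 then e₁ ⊗ₜ[k] e₂ else 0))
    :
    ∀ i j l, 1 ≤ i → i ≤ n → 1 ≤ j → j ≤ n → 1 ≤ l → l ≤ n →
      trip br (a i) (a j) (b l) =
        (4 : k)⁻¹ • ((b l * a i) ⊗ₜ[k] (a j ⊗ₜ[k] e₂) -
          e₁ ⊗ₜ[k] (a i ⊗ₜ[k] (a j * b l))) := by
  intro i j l hi hi' hj hj' hl hl'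
  have a2 : ∀ i, 1 ≤ i → i ≤ n → e₂ * a i = a i := fun i h h' => by
    rw [ha i h h', ← mul_assoc, ← mul_assoc, he₂]
  have a1 : ∀ i, 1 ≤ i → i ≤ n → a i * e₁ = a i := fun i h h' => by
    rw [ha i h h', mul_assoc, he₁]
  have b1 : ∀ i, 1 ≤ i → i ≤ n → e₁ * b i = b i := fun i h h' => by
    rw [hb i h h', ← mul_assoc, ← mul_assoc, he₁]
  have b2 : ∀ i, 1 ≤ i → i ≤ n → b i * e₂ = b i := fun i h h' => by
    rw [hb i h h', mul_assoc, he₂]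
  have hab : ∀ i l, 1 ≤ i → i ≤ n → 1 ≤ l → l ≤ n → br (a i) (b l) =
      ((if i ≤ l then (1 : k) else -1) * (2 : k)⁻¹) •
        ((b l * a i) ⊗ₜ[k] e₂ + e₁ ⊗ₜ[k] (a i * b l))
      + (if i = l then (1 : k) else if i = l + 1 then -1 else 0) • (e₁ ⊗ₜ[k] e₂) := by
    intro i l hi hi' hl hl'
    rcases lt_trichotomy i l with h | h | h
    · rw [hab_lt i l hi hi' hl hl' h, if_pos h.le, if_neg h.ne, if_neg (by omega)]
      module
    · subst h
      rw [hab_eq i hi hi', if_pos le_rfl, if_pos rfl]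
      module
    · rw [hab_gt i l hi hi' hl hl' h, if_neg (not_le.2 h), if_neg h.ne']
      split_ifs <;> module
  have haa : br (a i) (a j) =
      ((if i < j then (-1 : k) else if i = j then 0 else 1) * (2 : k)⁻¹) •
        (a i ⊗ₜ[k] a j + a j ⊗ₜ[k] a i) := by
    rcases lt_trichotomy i j with h | h | h
    · rw [haa_lt i j hi hi' hj hj' h, if_pos h]
      module
    · subst h
      rw [haa_eq i hi hi']
      simp
    · rw [haa_gt i j hi hi' hj hj' h, if_neg h.not_gt, if_neg h.ne']
      module
  refine trip_aux_s15 e₁ e₂ (a i) (a j) (b l) br (a2 i hi hi') (a1 i hi hi') (a2 j hj hj')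
    (b2 l hl hl') (b1 l hl hl') hskew hleib hbr₁ hbr₂ _ _ _ _ _ haa (hab i l hi hi' hl hl')
    (hab j l hj hj' hl hl') ?_ ?_
  · split_ifs <;> first | omega | norm_num
  · by_cases hij : i = j
    · subst hij
      simp
    · split_ifs <;> first | omega | norm_num
end
end

section
/- Let k be a field of characteristic 0, A an associative unital k-algebra carrying a double bracket ⟨⟨−,−⟩⟩ : A × A → A ⊗_k A (a k-bilinear map satisfying cyclic antisymmetry ⟨⟨x,y⟩⟩ = −σ(⟨⟨y,x⟩⟩), where σ(u⊗v) = v⊗u, and the right Leibniz rule ⟨⟨x,yz⟩⟩ = ⟨⟨x,y⟩⟩·(1⊗z) + (y⊗1)·⟨⟨x,z⟩⟩). Let c₁,…,c_N ∈ A and scalars ε_{ij} ∈ k with ε_{ij} = −ε_{ji}, such that ⟨⟨c_i,c_j⟩⟩ = ε_{ij}·(c_i⊗c_j + c_j⊗c_i) for all i,j ∈ {1,…,N}. Then the associated triple bracket satisfies, for all i,j,k ∈ {1,…,N}: ⟨⟨c_i,c_j,c_k⟩⟩ = (ε_{ij}ε_{jk} + ε_{jk}ε_{ki} + ε_{ki}ε_{ij})·(c_i⊗c_j⊗c_k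 − c_k⊗c_i⊗c_j). -/
open TensorProduct

noncomputable section

variable {k : Type*} [Field k] {A : Type*} [Ring A] [Algebra k A]

/-- Lemma 4.1 of the paper: if `⟨⟨c_i,c_j⟩⟩ = ε_{ij}·(c_i⊗c_j + c_j⊗c_i)` with
`ε_{ij} = −ε_{ji}`, then the associated triple bracket is
`⟨⟨c_i,c_j,c_l⟩⟩ = (ε_{ij}ε_{jl} + ε_{jl}ε_{li} + ε_{li}ε_{ij})·(c_i⊗c_j⊗c_l − c_l⊗c_i⊗c_j)`. -/
theorem triple_bracket_of_eps {k : Type*} [Field k] [CharZero k]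
    {A : Type*} [Ring A] [Algebra k A]
    (br : A →ₗ[k] A →ₗ[k] A ⊗[k] A)
    (hskew : ∀ x y : A, br x y = - TensorProduct.comm k A A (br y x))
    (hleib : ∀ x y z : A, br x (y * z) = br x y * (1 ⊗ₜ[k] z) + (y ⊗ₜ[k] 1) * br x z)
    (N : ℕ) (c : ℕ → A) (ε : ℕ → ℕ → k)
    (hε : ∀ i j, ε i j = -ε j i)
    (hc : ∀ i j, 1 ≤ i → i ≤ N → 1 ≤ j → j ≤ N →
      br (c i) (c j) = ε i j • (c i ⊗ₜ[k] c j + c j ⊗ₜ[k] c i)) :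
    ∀ i j l, 1 ≤ i → i ≤ N → 1 ≤ j → j ≤ N → 1 ≤ l → l ≤ N →
      trip br (c i) (c j) (c l) =
        (ε i j * ε j l + ε j l * ε l i + ε l i * ε i j) •
          (c i ⊗ₜ[k] (c j ⊗ₜ[k] c l) - c l ⊗ₜ[k] (c i ⊗ₜ[k] c j)) := by
  intro i j l hi hi' hj hj' hl hl'
  have h1 := hc i j hi hi' hj hj'
  have h2 := hc j l hj hj' hl hl'
  have h3 := hc l i hl hl' hi hi'
  have h1' := hc j i hj hj' hi hi'
  have h2' := hc l j hl hl' hj hj'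
  have h3' := hc i l hi hi' hl hl'
  rw [hε j i] at h1'
  rw [hε l j] at h2'
  rw [hε i l] at h3'
  simp only [trip, brL, tau123, tau132, h1, h2, h3, h1', h2', h3', map_add, map_smul,
    LinearMap.comp_apply, LinearEquiv.coe_coe, LinearMap.rTensor_tmul,
    TensorProduct.add_tmul, ← TensorProduct.smul_tmul', TensorProduct.assoc_tmul,
    TensorProduct.comm_tmul, smul_add]
  module
end
end

section
/- Let k be a field of characteristic 0 and A an associative unital k-algebra containing orthogonal idempotents e₁, e₂ with e₁ + e₂ = 1 and e₁e₂ = e₂e₁ = 0. For a, b, c ∈ A define the quasi-Poisson triple bracket ⟨⟨a,b,c⟩⟩_qP := (1/4)·Σ_{s∈{1,2}} ( c e_s a ⊗ e_s b ⊗ e_s − c e_s a ⊗ e_s ⊗ b e_s − c e_s ⊗ a e_s b ⊗ e_s + c e_s ⊗ a e_s ⊗ b e_s − e_s a ⊗ e_s b ⊗ e_s c + e_s a ⊗ e_s ⊗ b e_s c + e_s ⊗ a e_s b ⊗ e_s c − e_s ⊗ a e_s ⊗ b e_s c ), an element of A ⊗_k A ⊗_k A. Then for all a, b, c ∈ e₂Ae₁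 one has ⟨⟨a,b,c⟩⟩_qP = (1/4)·(c⊗a⊗b − a⊗b⊗c). -/
open TensorProduct

noncomputable section

/-- The quasi-Poisson triple bracket `⟨⟨a,b,c⟩⟩_qP` built from the gauge element, evaluated
on triples of elements of `e₂Ae₁`, equals `(1/4)·(c⊗a⊗b − a⊗b⊗c)`. -/
theorem qP_triple_bracket_on_e2Ae1 {k : Type*} [Field k] [CharZero k]
    {A : Type*} [Ring A] [Algebra k A]
    (e₁ e₂ : A)
    (he₁ : e₁ * e₁ = e₁) (he₂ : e₂ * e₂ = e₂)
    (h12 : e₁ * e₂ = 0) (h21 : e₂ * e₁ = 0) (hsum : e₁ + e₂ = 1)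
    (a b c : A)
    (ha : a = e₂ * a * e₁) (hb : b = e₂ * b * e₁) (hc : c = e₂ * c * e₁) :
    (4 : k)⁻¹ •
      (((c * e₁ * a) ⊗ₜ[k] ((e₁ * b) ⊗ₜ[k] e₁) -
          (c * e₁ * a) ⊗ₜ[k] (e₁ ⊗ₜ[k] (b * e₁)) -
          (c * e₁) ⊗ₜ[k] ((a * e₁ * b) ⊗ₜ[k] e₁) +
          (c * e₁) ⊗ₜ[k] ((a * e₁) ⊗ₜ[k] (b * e₁)) -
          (e₁ * a) ⊗ₜ[k] ((e₁ * b) ⊗ₜ[k] (e₁ * c)) +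
          (e₁ * a) ⊗ₜ[k] (e₁ ⊗ₜ[k] (b * e₁ * c)) +
          e₁ ⊗ₜ[k] ((a * e₁ * b) ⊗ₜ[k] (e₁ * c)) -
          e₁ ⊗ₜ[k] ((a * e₁) ⊗ₜ[k] (b * e₁ * c))) +
        ((c * e₂ * a) ⊗ₜ[k] ((e₂ * b) ⊗ₜ[k] e₂) -
          (c * e₂ * a) ⊗ₜ[k] (e₂ ⊗ₜ[k] (b * e₂)) -
          (c * e₂) ⊗ₜ[k] ((a * e₂ * b) ⊗ₜ[k] e₂) +
          (c * e₂) ⊗ₜ[k] ((a * e₂) ⊗ₜ[k] (b * e₂)) -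
          (e₂ * a) ⊗ₜ[k] ((e₂ * b) ⊗ₜ[k] (e₂ * c)) +
          (e₂ * a) ⊗ₜ[k] (e₂ ⊗ₜ[k] (b * e₂ * c)) +
          e₂ ⊗ₜ[k] ((a * e₂ * b) ⊗ₜ[k] (e₂ * c)) -
          e₂ ⊗ₜ[k] ((a * e₂) ⊗ₜ[k] (b * e₂ * c)))) =
      (4 : k)⁻¹ • (c ⊗ₜ[k] (a ⊗ₜ[k] b) - a ⊗ₜ[k] (b ⊗ₜ[k] c)) := by
  have key : ∀ x : A, x = e₂ * x * e₁ →
      x * e₁ = x ∧ e₂ * x = x ∧ e₁ * x = 0 ∧ x * e₂ = 0 := by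
    intro x hx
    refine ⟨?_, ?_, ?_, ?_⟩
    · rw [hx, mul_assoc, he₁]
    · rw [hx, ← mul_assoc, ← mul_assoc, he₂]
    · rw [hx, ← mul_assoc, ← mul_assoc, h12, zero_mul, zero_mul]
    · rw [hx, mul_assoc, h12, mul_zero]
  obtain ⟨a1, a2, a3, a4⟩ := key a ha
  obtain ⟨b1, b2, b3, b4⟩ := key b hb
  obtain ⟨c1, c2, c3, c4⟩ := key c hc
  have ca : c * a = 0 := by rw [← c1, mul_assoc, a3, mul_zero]
  have ab : a * b = 0 := by rw [← a1, mul_assoc, b3, mul_zero]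
  have bc : b * c = 0 := by rw [← b1, mul_assoc, c3, mul_zero]
  clear ha hb hc
  simp only [a1, a2, a3, a4, b1, b2, b3, b4, c1, c2, c3, c4, ca, ab, bc, zero_mul,
    TensorProduct.zero_tmul, TensorProduct.tmul_zero, sub_zero, add_zero, zero_add, zero_sub,
    sub_eq_add_neg, neg_zero]
end
end

section
/- Let k be a field of characteristic 0 and A an associative unital k-algebra carrying a double bracket ⟨⟨−,−⟩⟩ : A × A → A ⊗_k A (a k-bilinear map satisfying cyclic antisymmetry ⟨⟨x,y⟩⟩ = −σ(⟨⟨y,x⟩⟩), where σ(u⊗v) = v⊗u, and the right Leibniz rule ⟨⟨x,yz⟩⟩ = ⟨⟨x,y⟩⟩·(1⊗z) + (y⊗1)·⟨⟨x,z⟩⟩). Let e ∈ A be an idempotent with ⟨⟨x,e⟩⟩ = 0 for all x ∈ A, and let Φ, Ψ ∈ eAe satisfy ΦΨ = ΨΦ = e. If for all x ∈ A one has ⟨⟨Φ, x⟩⟩ = (1/2)·(xe⊗Φ − e⊗Φx + xΦ⊗e − Φ⊗ex), then for all x ∈ A one has ⟨⟨Ψ, x⟩⟩ = −(1/2)·(xΨ⊗e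 − Ψ⊗ex + xe⊗Ψ − e⊗Ψx). -/
open TensorProduct

noncomputable section

/-- If `Φ ∈ eAe` satisfies the multiplicative moment map identity
`⟨⟨Φ, x⟩⟩ = (1/2)·(xe⊗Φ − e⊗Φx + xΦ⊗e − Φ⊗ex)` and `Ψ ∈ eAe` is a two-sided inverse of `Φ`
(`ΦΨ = ΨΦ = e`), then `⟨⟨Ψ, x⟩⟩ = −(1/2)·(xΨ⊗e − Ψ⊗ex + xe⊗Ψ − e⊗Ψx)`. -/
theorem moment_map_inverse {k : Type*} [Field k] [CharZero k]
    {A : Type*} [Ring A] [Algebra k A]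
    (br : A →ₗ[k] A →ₗ[k] A ⊗[k] A)
    (hskew : ∀ x y : A, br x y = - TensorProduct.comm k A A (br y x))
    (hleib : ∀ x y z : A, br x (y * z) = br x y * (1 ⊗ₜ[k] z) + (y ⊗ₜ[k] 1) * br x z)
    (e : A) (he : e * e = e) (hbre : ∀ x : A, br x e = 0)
    (Φ Ψ : A) (hΦ : Φ = e * Φ * e) (hΨ : Ψ = e * Ψ * e)
    (hinv₁ : Φ * Ψ = e) (hinv₂ : Ψ * Φ = e)
    (hmm : ∀ x : A, br Φ x =
      (2 : k)⁻¹ • ((x * e) ⊗ₜ[k] Φ - e ⊗ₜ[k] (Φ * x) + (x * Φ) ⊗ₜ[k] e - Φ ⊗ₜ[k] (e * x))) :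
    ∀ x : A, br Ψ x =
      -((2 : k)⁻¹ •
        ((x * Ψ) ⊗ₜ[k] e - Ψ ⊗ₜ[k] (e * x) + (x * e) ⊗ₜ[k] Ψ - e ⊗ₜ[k] (Ψ * x))) := by
  intro x
  have heΨ : e * Ψ = Ψ := by
    rw [hΨ, ← mul_assoc, ← mul_assoc, he]
  have hΨe : Ψ * e = Ψ := by
    rw [hΨ, mul_assoc, he]
  have h1 : br x Ψ = br x Ψ * (1 ⊗ₜ[k] e) := by
    have h := hleib x Ψ e
    rw [hΨe, hbre, mul_zero, add_zero] at h
    exact h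
  have h2 : br x Ψ * (1 ⊗ₜ[k] Φ) = - ((Ψ ⊗ₜ[k] 1) * br x Φ) := by
    have h := hleib x Ψ Φ
    rw [hinv₂, hbre] at h
    exact eq_neg_of_add_eq_zero_left h.symm
  have h3 : br x Ψ = - ((Ψ ⊗ₜ[k] 1) * br x Φ) * (1 ⊗ₜ[k] Ψ) := by
    rw [← h2, mul_assoc, Algebra.TensorProduct.tmul_mul_tmul, one_mul, hinv₁]
    exact h1
  rw [hskew Ψ x, h3, hskew x Φ, hmm x]
  simp only [map_smul, map_add, map_sub, map_neg, TensorProduct.comm_tmul, mul_neg, neg_mul,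
    neg_neg, mul_smul_comm, smul_mul_assoc, mul_add, mul_sub, add_mul, sub_mul,
    Algebra.TensorProduct.tmul_mul_tmul, one_mul, mul_one, ← mul_assoc, hinv₁, hinv₂, hΨe, heΨ]
  simp only [mul_assoc, hinv₁, hinv₂, hΨe, heΨ]
end
end

section
/- Let n ≥ 1 and let R = ℂ[A₁,…,Aₙ,B₁,…,Bₙ] be the polynomial ring in 2n variables. Define the Euler continuant λ := (A₁,B₁,A₂,B₂,…,Aₙ,Bₙ) ∈ R via the recursion ( ) = 1, (x₁) = x₁, (x₁,…,x_k) = (x₁,…,x_{k−1})x_k + (x₁,…,x_{k−2}). Fix i ∈ {1,…,n}. Let D_i be the unique ℂ-linear derivation of R with D_i(A_j) = sgn(j−i)·A_jA_i (where sgn(0) := 0), D_i(B_j) = −A_iB_j for j > i, D_i(B_i) = −A_iB_i − 1, and D_i(B_j) = A_iB_j + δ_{i−j,1} for j < i (δ the Kronecker delta). Let E_i be the unique ℂ-linear derivation of R with E_i(B_j) = sgn(j−i)·B_jB_i, E_i(A_j) = A_jB_i for j < i, E_i(A_i) = A_iB_i + 1, and E_i(A_j) = −A_jB_i − δ_{j−i,1}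 for j > i. Then D_i(λ) = −λ·A_i and E_i(λ) = λ·B_i. -/
noncomputable section

/-- The variable `A_j` (1-indexed) of the polynomial ring `ℂ[A₁,…,Aₙ,B₁,…,Bₙ]`. -/
def Av (n : ℕ) (j : ℕ) : MvPolynomial (Fin n ⊕ Fin n) ℂ :=
  if h : j - 1 < n then MvPolynomial.X (Sum.inl ⟨j - 1, h⟩) else 0

/-- The variable `B_j` (1-indexed) of the polynomial ring `ℂ[A₁,…,Aₙ,B₁,…,Bₙ]`. -/
def Bv (n : ℕ) (j : ℕ) : MvPolynomial (Fin n ⊕ Fin n) ℂ :=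
  if h : j - 1 < n then MvPolynomial.X (Sum.inr ⟨j - 1, h⟩) else 0

/-- The 2n-th Euler continuant `λ = (A₁,B₁,A₂,B₂,…,Aₙ,Bₙ)`. -/
def lam (n : ℕ) : MvPolynomial (Fin n ⊕ Fin n) ℂ :=
  cont (fun m => if m % 2 = 1 then Av n ((m + 1) / 2) else Bv n (m / 2)) (2 * n)

/-- The odd continuants, shifted: `Qv 0 = 0`, and `Qv j = (A₁,…,A_j)`. -/
def Qv {R : Type*} [Ring R] (y : ℕ → R) : ℕ → R
  | 0 => 0
  | k + 1 => cont y (2 * k + 1)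

theorem Qv_succ {R : Type*} [Ring R] (y : ℕ → R) (k : ℕ) :
    Qv y (k + 1) = cont y (2 * k) * y (2 * k + 1) + Qv y k := by
  cases k with
  | zero => simp [Qv, cont]
  | succ k => simp only [Qv, Nat.mul_succ, cont]

theorem cont_even_succ {R : Type*} [Ring R] (y : ℕ → R) (k : ℕ) :
    cont y (2 * (k + 1)) = Qv y (k + 1) * y (2 * k + 2) + cont y (2 * k) := by
  simp only [Qv, Nat.mul_succ, cont]

/-- The derivations `D_i = {−, A_i}` and `E_i = {−, B_i}` of the Flaschka–Newell Poisson
bracket send the Euler continuant `λ = (A₁,B₁,…,Aₙ,Bₙ)` to `−λ·A_i` and `λ·B_i`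
respectively. -/
theorem flaschka_newell_moment_map (n : ℕ) (hn : 1 ≤ n)
    (i : ℕ) (hi₁ : 1 ≤ i) (hi₂ : i ≤ n)
    (D E : Derivation ℂ (MvPolynomial (Fin n ⊕ Fin n) ℂ) (MvPolynomial (Fin n ⊕ Fin n) ℂ))
    (hDA : ∀ j, 1 ≤ j → j ≤ n →
      D (Av n j) = if i < j then Av n j * Av n i
        else if j < i then -(Av n j * Av n i) else 0)
    (hDB : ∀ j, 1 ≤ j → j ≤ n →
      D (Bv n j) = if i < j then -(Av n i * Bv n j)
        else if j = i then -(Av n i * Bv n i) - 1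
        else Av n i * Bv n j + (if i = j + 1 then 1 else 0))
    (hEB : ∀ j, 1 ≤ j → j ≤ n →
      E (Bv n j) = if i < j then Bv n j * Bv n i
        else if j < i then -(Bv n j * Bv n i) else 0)
    (hEA : ∀ j, 1 ≤ j → j ≤ n →
      E (Av n j) = if j < i then Av n j * Bv n i
        else if j = i then Av n i * Bv n i + 1
        else -(Av n j * Bv n i) - (if j = i + 1 then 1 else 0)) :
    D (lam n) = -(lam n * Av n i) ∧ E (lam n) = lam n * Bv n i := by
  set y : ℕ → MvPolynomial (Fin n ⊕ Fin n) ℂ :=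
    fun m => if m % 2 = 1 then Av n ((m + 1) / 2) else Bv n (m / 2) with hy
  have hyA : ∀ k, y (2 * k + 1) = Av n (k + 1) := by
    intro k
    have h1 : (2 * k + 1) % 2 = 1 := by omega
    have h2 : (2 * k + 1 + 1) / 2 = k + 1 := by omega
    simp only [hy, h1, h2, if_true]
  have hyB : ∀ k, y (2 * k + 2) = Bv n (k + 1) := by
    intro k
    have h1 : ¬ (2 * k + 2) % 2 = 1 := by omega
    have h2 : (2 * k + 2) / 2 = k + 1 := by omega
    simp only [hy, h1, h2, if_false]
  have hlam : lam n = cont y (2 * n) := rfl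
  have hQ : ∀ k, Qv y (k + 1) = cont y (2 * k) * Av n (k + 1) + Qv y k := by
    intro k; rw [Qv_succ, hyA]
  have hP : ∀ k, cont y (2 * (k + 1)) = Qv y (k + 1) * Bv n (k + 1) + cont y (2 * k) := by
    intro k; rw [cont_even_succ, hyB]
  have hQ0 : Qv y 0 = 0 := rfl
  have hP0 : cont y (2 * 0) = 1 := rfl
  rw [hlam]
  clear_value y
  generalize hq : Qv y = Q at *
  obtain ⟨P, hp⟩ : ∃ P : ℕ → MvPolynomial (Fin n ⊕ Fin n) ℂ, ∀ k, cont y (2 * k) = P k :=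
    ⟨fun k => cont y (2 * k), fun _ => rfl⟩
  simp only [hp] at *
  have keyD : ∀ j, j ≤ n →
      D (Q j) = (if j < i then -(Av n i * Q j) else 0) ∧
      D (P j) = (if j + 1 < i then 0 else if j + 1 = i then Q j else -(Av n i * P j)) := by
    intro j
    induction j with
    | zero =>
      intro _
      rw [hQ0, hP0, if_pos (by omega)]
      refine ⟨by simp, ?_⟩
      split_ifs
      · simp
      · simp
      · omega
    | succ k ih =>
      intro hk
      obtain ⟨ih1, ih2⟩ := ih (by omega)
      have hA := hDA (k + 1) (by omega) hk
      have hB := hDB (k + 1) (by omega) hk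
      have e1 : D (Q (k + 1)) = (if k + 1 < i then -(Av n i * Q (k + 1)) else 0) := by
        rw [hQ, map_add, Derivation.leibniz, ih1, ih2, hA]
        simp only [smul_eq_mul]
        rcases lt_trichotomy (k + 1) i with h | h | h
        · simp only [h, if_true, if_neg (show ¬ i < k + 1 by omega), show k < i by omega]
          ring
        · subst h
          simp
        · simp only [h, if_true, if_neg (show ¬ k + 1 < i by omega),
            if_neg (show ¬ k + 1 = i by omega), if_neg (show ¬ k < i by omega)]
          ring
      refine ⟨e1, ?_⟩
      rw [hP, map_add, Derivation.leibniz, e1, ih2, hB]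
      simp only [smul_eq_mul]
      rcases lt_trichotomy (k + 1) i with h | h | h
      · simp only [h, if_true, if_neg (show ¬ i < k + 1 by omega),
          if_neg (show ¬ k + 1 = i by omega)]
        by_cases h' : k + 1 + 1 = i
        · subst h'
          simp
          ring
        · simp only [show k + 1 + 1 < i by omega, if_true, if_neg (Ne.symm h')]
          ring
      · subst h
        simp
        rw [hQ]
        ring
      · simp only [h, if_true, if_neg (show ¬ k + 1 < i by omega),
          if_neg (show ¬ k + 1 = i by omega), if_neg (show ¬ k + 1 + 1 < i by omega),
          if_neg (show ¬ k + 1 + 1 = i by omega)]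
        ring
  have keyE : ∀ j, j ≤ n →
      E (Q j) = (if j < i then Bv n i * Q j else if j = i then P j else 0) ∧
      E (P j) = (if j < i then 0 else Bv n i * P j) := by
    intro j
    induction j with
    | zero =>
      intro _
      rw [hQ0, hP0, if_pos (by omega), if_pos (by omega)]
      simp
    | succ k ih =>
      intro hk
      obtain ⟨ih1, ih2⟩ := ih (by omega)
      have hA := hEA (k + 1) (by omega) hk
      have hB := hEB (k + 1) (by omega) hk
      have e1 : E (Q (k + 1)) = (if k + 1 < i then Bv n i * Q (k + 1) else
          if k + 1 = i then P (k + 1) else 0) := by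
        rw [hP, hQ, map_add, Derivation.leibniz, ih1, ih2, hA]
        simp only [smul_eq_mul]
        rcases lt_trichotomy (k + 1) i with h | h | h
        · simp only [h, if_true, show k < i by omega]
          ring
        · subst h
          simp
          ring
        · simp only [if_neg (show ¬ k + 1 < i by omega),
            if_neg (show ¬ k + 1 = i by omega), if_neg (show ¬ k < i by omega)]
          by_cases h' : k = i
          · subst h'
            simp
            ring
          · simp only [if_neg h', if_neg (show ¬ k + 1 = i + 1 by omega)]
            ring
      refine ⟨e1, ?_⟩
      rw [hP, map_add, Derivation.leibniz, e1, ih2, hB]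
      simp only [smul_eq_mul]
      rcases lt_trichotomy (k + 1) i with h | h | h
      · simp only [h, if_true, if_neg (show ¬ i < k + 1 by omega), show k < i by omega]
        ring
      · subst h
        simp
        exact Or.inl (hP k)
      · simp only [h, if_true, if_neg (show ¬ k + 1 < i by omega),
          if_neg (show ¬ k + 1 = i by omega), if_neg (show ¬ k < i by omega)]
        ring
  constructor
  · rw [(keyD n le_rfl).2, if_neg (by omega), if_neg (by omega)]
    ring
  · rw [(keyE n le_rfl).2, if_neg (by omega)]
    ring
end
end
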